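/- Let π and π′ be irreducible cuspidal ψ-generic representations of the quasi-split non-split group SO_{2l} with the same central character. If γ(π×τ,ψ) = γ(π′×τ,ψ) for all irreducible ψ^{−1}-generic representations τ of GL_l(F), then (B_{π,ψ} + B_{π^c,ψ})(t·w) = (B_{π′,ψ} + B_{π′^c,ψ})(t·w) for every t = diag(t_1,…,t_{l−1}, [[a, bρ],[b, a]], t_{l−1}^{−1},…,t_1^{−1}) ∈ T with a ≠ 1 and every w ∈ B_{l−1}(SO_{2l}) (taken with its matrix representative t_{l−1}(w′)·w̃_{l−1}). -/

import Mathlib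

open scoped MatrixGroups
open Matrix

noncomputable section

namespace ConverseSO

open Classical in
/-- Evaluate a function defined on `G` at a point of `M` through the (typically injective)
map `c : G → M`, extending by zero. -/
def matFun {G M R : Type*} [Zero R] (c : G → M) (φ : G → R) (m : M) : R :=
  if h : ∃ g, c g = m then φ h.choose else 0

variable (F : Type) [Field F] [Fintype F]

/-- The antidiagonal matrix `J_m`. -/
def Jmat (m : ℕ) : Matrix (Fin m) (Fin m) F :=
  Matrix.of fun i j => if (i : ℕ) + (j : ℕ) + 1 = m then 1 else 0

/-- The middle-block modification `diag(I_{l-1}, [[0,1],[-ρ,0]], I_{l-1})`. -/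
def Dmat (l : ℕ) (ρ : F) : Matrix (Fin (2*l)) (Fin (2*l)) F :=
  Matrix.of fun i j =>
    if (i : ℕ) = l - 1 ∧ (j : ℕ) = l then 1
    else if (i : ℕ) = l ∧ (j : ℕ) = l - 1 then -ρ
    else if i = j ∧ (i : ℕ) ≠ l - 1 ∧ (i : ℕ) ≠ l then 1
    else 0

/-- `J_{2l,ρ}`. -/
def Jrho (l : ℕ) (ρ : F) : Matrix (Fin (2*l)) (Fin (2*l)) F := Dmat F l ρ * Jmat F (2*l)

/-- The matrix-level special orthogonal "set" attached to a matrix `Jm`. -/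
def SOset (m : ℕ) (Jm : Matrix (Fin m) (Fin m) F) : Set (Matrix (Fin m) (Fin m) F) :=
  {g | g.det = 1 ∧ gᵀ * Jm * g = Jm}

/-- The special orthogonal group attached to a matrix `Jm`, as a subgroup of `GL`. -/
def SOgrp (m : ℕ) (Jm : Matrix (Fin m) (Fin m) F) : Subgroup (GL (Fin m) F) where
  carrier := {g | ((g : Matrix (Fin m) (Fin m) F)).det = 1 ∧
    ((g : Matrix (Fin m) (Fin m) F))ᵀ * Jm * ((g : Matrix (Fin m) (Fin m) F)) = Jm}
  one_mem' := ⟨by simp, by simp⟩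
  mul_mem' := by
    rintro a b ⟨ha1, ha2⟩ ⟨hb1, hb2⟩
    refine ⟨by rw [Units.val_mul, Matrix.det_mul, ha1, hb1, one_mul], ?_⟩
    have hab : ((a * b : GL (Fin m) F) : Matrix (Fin m) (Fin m) F)
        = (a : Matrix (Fin m) (Fin m) F) * (b : Matrix (Fin m) (Fin m) F) := Units.val_mul a b
    rw [hab, Matrix.transpose_mul]
    calc (b : Matrix (Fin m) (Fin m) F)ᵀ * (a : Matrix (Fin m) (Fin m) F)ᵀ * Jm *
          ((a : Matrix (Fin m) (Fin m) F) * (b : Matrix (Fin m) (Fin m) F))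
        = (b : Matrix (Fin m) (Fin m) F)ᵀ *
            ((a : Matrix (Fin m) (Fin m) F)ᵀ * Jm * (a : Matrix (Fin m) (Fin m) F)) *
            (b : Matrix (Fin m) (Fin m) F) := by
          simp only [mul_assoc]
      _ = Jm := by rw [ha2, hb2]
  inv_mem' := by
    intro g hg
    obtain ⟨h1, h2⟩ := hg
    have hv1 : ((g⁻¹ : GL (Fin m) F) : Matrix (Fin m) (Fin m) F) * (g : Matrix (Fin m) (Fin m) F)
        = 1 := by rw [← Units.val_mul, inv_mul_cancel, Units.val_one]
    have hv2 : (g : Matrix (Fin m) (Fin m) F) * ((g⁻¹ : GL (Fin m) F) : Matrix (Fin m) (Fin m) F)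
        = 1 := by rw [← Units.val_mul, mul_inv_cancel, Units.val_one]
    constructor
    · have hd := congrArg Matrix.det hv1
      rw [Matrix.det_mul, h1, mul_one, Matrix.det_one] at hd
      exact hd
    · calc ((g⁻¹ : GL (Fin m) F) : Matrix (Fin m) (Fin m) F)ᵀ * Jm *
            ((g⁻¹ : GL (Fin m) F) : Matrix (Fin m) (Fin m) F)
          = ((g⁻¹ : GL (Fin m) F) : Matrix (Fin m) (Fin m) F)ᵀ *
              ((g : Matrix (Fin m) (Fin m) F)ᵀ * Jm * (g : Matrix (Fin m) (Fin m) F)) *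
              ((g⁻¹ : GL (Fin m) F) : Matrix (Fin m) (Fin m) F) := by rw [h2]
        _ = ((g : Matrix (Fin m) (Fin m) F) *
              ((g⁻¹ : GL (Fin m) F) : Matrix (Fin m) (Fin m) F))ᵀ * Jm *
              ((g : Matrix (Fin m) (Fin m) F) *
              ((g⁻¹ : GL (Fin m) F) : Matrix (Fin m) (Fin m) F)) := by
            rw [Matrix.transpose_mul]; simp only [mul_assoc]
        _ = Jm := by rw [hv2]; simp

/-- The quasi-split even special orthogonal group `SO_{2l}` attached to `J_{2l,ρ}`. -/
abbrev SO2l (l : ℕ) (ρ : F) : Subgroup (GL (Fin (2*l)) F) := SOgrp F (2*l) (Jrho F l ρ)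

/-- The odd special orthogonal group `SO_{2m+1}` (split form). -/
abbrev SOodd (m : ℕ) : Subgroup (GL (Fin (2*m+1)) F) := SOgrp F (2*m+1) (Jmat F (2*m+1))

/-- The underlying matrix of an element of a special orthogonal group. -/
def mat {m : ℕ} {Jm : Matrix (Fin m) (Fin m) F} (g : SOgrp F m Jm) :
    Matrix (Fin m) (Fin m) F :=
  ((g : GL (Fin m) F) : Matrix (Fin m) (Fin m) F)

/-- Upper triangular unipotent predicate for matrices. -/
def upUnip {m : ℕ} (M : Matrix (Fin m) (Fin m) F) : Prop :=
  ∀ i j : Fin m, (j : ℕ) ≤ (i : ℕ) → M i j = if i = j then 1 else 0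

/-- The upper triangular unipotent subgroup (as a set) of `SO_{2l}`. -/
def USet (l : ℕ) (ρ : F) : Set (SO2l F l ρ) := {u | upUnip F (mat F u)}

/-- The upper triangular unipotent matrices in `SO_{2m+1}` (matrix level). -/
def UoddMatSet (m : ℕ) : Set (Matrix (Fin (2*m+1)) (Fin (2*m+1)) F) :=
  {g | g ∈ SOset F (2*m+1) (Jmat F (2*m+1)) ∧ upUnip F g}

/-- The generic character of the upper unipotent subgroup of `SO_{2l}`:
`ψ(u_{1,2} + ⋯ + u_{l-2,l-1} + (1/2)·u_{l-1,l+1})` (1-indexed). -/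
def psiU (l : ℕ) (ψ : AddChar F ℂ) (M : Matrix (Fin (2*l)) (Fin (2*l)) F) : ℂ :=
  ψ (∑ i : Fin (2*l), ∑ j : Fin (2*l),
    (if (j : ℕ) = (i : ℕ) + 1 ∧ (i : ℕ) + 3 ≤ l then M i j
     else if (i : ℕ) + 2 = l ∧ (j : ℕ) = l then (2 : F)⁻¹ * M i j else 0))

/-- The sum `u_{1,2} + ⋯ + u_{n-1,n}` for an `n × n` matrix. -/
def glUSum (n : ℕ) (M : Matrix (Fin n) (Fin n) F) : F :=
  ∑ i : Fin n, ∑ j : Fin n, (if (j : ℕ) = (i : ℕ) + 1 then M i j else 0)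

/-- The character `ψ_γ` of `N^{l-n}`:
`ψ(Σ_{i=1}^{l-n-1} v_{i,i+1} + (1/2)·v_{l-n-1,l+1})` (1-indexed). -/
def psiGam (l n : ℕ) (ψ : AddChar F ℂ) (M : Matrix (Fin (2*l)) (Fin (2*l)) F) : ℂ :=
  ψ (∑ i : Fin (2*l), ∑ j : Fin (2*l),
    (if (j : ℕ) = (i : ℕ) + 1 ∧ (i : ℕ) + 2 + n ≤ l then M i j
     else if (i : ℕ) + 2 + n = l ∧ (j : ℕ) = l then (2 : F)⁻¹ * M i j else 0))

/-- Irreducibility of a representation. -/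
def IsIrrep {G V : Type*} [Group G] [AddCommGroup V] [Module ℂ V]
    (π : Representation ℂ G V) : Prop :=
  (∃ v : V, v ≠ 0) ∧
    ∀ W : Submodule ℂ V, (∀ g : G, ∀ v ∈ W, π g v ∈ W) → W = ⊥ ∨ W = ⊤

/-- Block index function determined by a set `C` of cuts (and their mirrors) for `SO_{2l}`. -/
def blkCut (l : ℕ) (C : Finset ℕ) (i : ℕ) : ℕ :=
  (C.filter (fun c => c ≤ i)).card + (C.filter (fun c => 2*l - c ≤ i)).card

/-- The unipotent radical of the standard parabolic subgroup of `SO_{2l}` given by cuts `C`. -/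
def cuspUnip (l : ℕ) (ρ : F) (C : Finset ℕ) : Set (SO2l F l ρ) :=
  {g | ∀ i j : Fin (2*l), blkCut l C (j : ℕ) ≤ blkCut l C (i : ℕ) →
    mat F g i j = if i = j then 1 else 0}

/-- Cuspidality: the full unipotent-radical sums vanish for every proper standard parabolic. -/
def IsCuspidal (l : ℕ) (ρ : F) {V : Type*} [AddCommGroup V] [Module ℂ V]
    (π : Representation ℂ (SO2l F l ρ) V) : Prop :=
  ∀ C : Finset ℕ, C.Nonempty → (∀ c ∈ C, 1 ≤ c ∧ c ≤ l - 1) →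
    ∀ v : V, (∑ᶠ u ∈ cuspUnip F l ρ C, π u v) = 0

/-- `Γ` is a (nonzero) `ψ`-Whittaker functional for `π`. -/
def IsWhittaker (l : ℕ) (ρ : F) (ψ : AddChar F ℂ) {V : Type*} [AddCommGroup V] [Module ℂ V]
    (π : Representation ℂ (SO2l F l ρ) V) (Γ : V →ₗ[ℂ] ℂ) : Prop :=
  Γ ≠ 0 ∧ ∀ u ∈ USet F l ρ, ∀ v : V, Γ (π u v) = psiU F l ψ (mat F u) * Γ v

/-- `v₀` is a Whittaker vector with `Γ v₀ ≠ 0`. -/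
def IsWhitVec (l : ℕ) (ρ : F) (ψ : AddChar F ℂ) {V : Type*} [AddCommGroup V] [Module ℂ V]
    (π : Representation ℂ (SO2l F l ρ) V) (Γ : V →ₗ[ℂ] ℂ) (v₀ : V) : Prop :=
  Γ v₀ ≠ 0 ∧ ∀ u ∈ USet F l ρ, π u v₀ = psiU F l ψ (mat F u) • v₀

/-- The normalized Bessel function attached to the Whittaker data `(Γ, v₀)`. -/
def Bessel (l : ℕ) (ρ : F) {V : Type*} [AddCommGroup V] [Module ℂ V]
    (π : Representation ℂ (SO2l F l ρ) V) (Γ : V →ₗ[ℂ] ℂ) (v₀ : V) :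
    SO2l F l ρ → ℂ :=
  fun g => Γ (π g v₀) / Γ v₀

/-- Equality of central characters. -/
def SameCentralChar (l : ℕ) (ρ : F) {V V' : Type*} [AddCommGroup V] [Module ℂ V]
    [AddCommGroup V'] [Module ℂ V'] (π : Representation ℂ (SO2l F l ρ) V)
    (π' : Representation ℂ (SO2l F l ρ) V') : Prop :=
  ∃ ω : ℂ, (∀ g : SO2l F l ρ, mat F g = -1 → ∀ v : V, π g v = ω • v) ∧
    (∀ g : SO2l F l ρ, mat F g = -1 → ∀ v' : V', π' g v' = ω • v')
/-- `a^* = J_n · (a⁻¹)ᵀ · J_n`. -/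
def aStar (n : ℕ) (a : Matrix (Fin n) (Fin n) F) : Matrix (Fin n) (Fin n) F :=
  Jmat F n * (a⁻¹)ᵀ * Jmat F n

/-- The permutation matrix of `σ`. -/
def permMat (n : ℕ) (σ : Equiv.Perm (Fin n)) : Matrix (Fin n) (Fin n) F :=
  Matrix.of fun i j => if σ j = i then 1 else 0

/-- `t_n(a) = diag(a, I_{2l-2n}, a^*)` inside `2l × 2l` matrices. -/
def tnMat (l n : ℕ) (a : Matrix (Fin n) (Fin n) F) : Matrix (Fin (2*l)) (Fin (2*l)) F :=
  Matrix.of fun i j =>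
    if hi : (i : ℕ) < n then (if hj : (j : ℕ) < n then a ⟨i, hi⟩ ⟨j, hj⟩ else 0)
    else if hi2 : (i : ℕ) < 2*l - n then (if i = j then 1 else 0)
    else if hj2 : 2*l - n ≤ (j : ℕ) then
      aStar F n a ⟨(i : ℕ) - (2*l - n), by have := i.isLt; omega⟩
        ⟨(j : ℕ) - (2*l - n), by have := j.isLt; omega⟩
    else 0

/-- The Weyl representative `w̃_n` of `SO_{2l}` as a block matrix. -/
def wTildeMat (l n : ℕ) : Matrix (Fin (2*l)) (Fin (2*l)) F :=
  Matrix.of fun i j =>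
    if (i : ℕ) < n then (if (j : ℕ) = (i : ℕ) + (2*l - n) then 1 else 0)
    else if (i : ℕ) < l - 1 then (if i = j then 1 else 0)
    else if (i : ℕ) = l - 1 then (if i = j then (-1)^n else 0)
    else if (i : ℕ) < 2*l - n then (if i = j then 1 else 0)
    else (if (j : ℕ) + (2*l - n) = (i : ℕ) then 1 else 0)

/-- The torus matrix `diag(t_1,…,t_{l-1}, [[a,bρ],[b,a]], t_{l-1}⁻¹,…,t_1⁻¹)`. -/
def torusMat (l : ℕ) (ρ : F) (tv : ℕ → Fˣ) (a b : F) :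
    Matrix (Fin (2*l)) (Fin (2*l)) F :=
  Matrix.of fun i j =>
    if (i : ℕ) < l - 1 then (if i = j then (tv (i : ℕ) : F) else 0)
    else if (i : ℕ) = l - 1 then
      (if (j : ℕ) = l - 1 then a else if (j : ℕ) = l then b * ρ else 0)
    else if (i : ℕ) = l then
      (if (j : ℕ) = l - 1 then b else if (j : ℕ) = l then a else 0)
    else (if i = j then ((tv (2*l - 1 - (i : ℕ)))⁻¹ : F) else 0)

/-- The outer element `c = diag(I_{l-1}, 1, -1, I_{l-1})`. -/
def cMat (l : ℕ) : Matrix (Fin (2*l)) (Fin (2*l)) F :=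
  Matrix.of fun i j => if i = j then (if (i : ℕ) = l then -1 else 1) else 0

/-- The torus element `t̃ = diag(I_{l-1}, -1, -1, I_{l-1})`. -/
def tTildeMat (l : ℕ) : Matrix (Fin (2*l)) (Fin (2*l)) F :=
  Matrix.of fun i j =>
    if i = j then (if (i : ℕ) = l - 1 ∨ (i : ℕ) = l then -1 else 1) else 0

/-- `l_n(a) = diag(a, 1, a^*)` inside `(2n+1) × (2n+1)` matrices. -/
def lnMat (n : ℕ) (a : Matrix (Fin n) (Fin n) F) :
    Matrix (Fin (2*n+1)) (Fin (2*n+1)) F :=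
  Matrix.of fun i j =>
    if hi : (i : ℕ) < n then (if hj : (j : ℕ) < n then a ⟨i, hi⟩ ⟨j, hj⟩ else 0)
    else if hi2 : (i : ℕ) = n then (if i = j then 1 else 0)
    else if hj2 : n + 1 ≤ (j : ℕ) then
      aStar F n a ⟨(i : ℕ) - (n+1), by have := i.isLt; omega⟩
        ⟨(j : ℕ) - (n+1), by have := j.isLt; omega⟩
    else 0

/-- The Weyl element `w_n` of `SO_{2n+1}` with block rows `(0,0,I_n)`, `(0,(-1)^n,0)`, `(I_n,0,0)`. -/
def wnOddMat (n : ℕ) : Matrix (Fin (2*n+1)) (Fin (2*n+1)) F :=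
  Matrix.of fun i j =>
    if (i : ℕ) < n then (if (j : ℕ) = (i : ℕ) + n + 1 then 1 else 0)
    else if (i : ℕ) = n then (if i = j then (-1)^n else 0)
    else (if (j : ℕ) + n + 1 = (i : ℕ) then 1 else 0)

/-- `d_n = diag(-1, 1, …, (-1)^n)`. -/
def dnMat (n : ℕ) : Matrix (Fin n) (Fin n) F :=
  Matrix.of fun i j => if i = j then (-1)^((i : ℕ) + 1) else 0

/-- The block permutation matrix `w^{l,n}` of `SO_{2l}`. -/
def wlnMat (l n : ℕ) : Matrix (Fin (2*l)) (Fin (2*l)) F :=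
  Matrix.of fun i j =>
    if (i : ℕ) < n then (if (j : ℕ) = (i : ℕ) + (l - n - 1) then 1 else 0)
    else if (i : ℕ) < l - 1 then (if (j : ℕ) + n = (i : ℕ) then 1 else 0)
    else if (i : ℕ) < l + 1 then (if i = j then 1 else 0)
    else if (i : ℕ) < 2*l - n then (if (j : ℕ) = (i : ℕ) + n then 1 else 0)
    else (if (j : ℕ) + (l - n - 1) = (i : ℕ) then 1 else 0)

/-- `w_{l,l} = diag(γ·I_l, 1, γ⁻¹·I_l)` with `γ = ρ/2`. -/
def wllMat (l : ℕ) (ρ : F) : Matrix (Fin (2*l+1)) (Fin (2*l+1)) F :=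
  Matrix.of fun i j =>
    if i = j then
      (if (i : ℕ) < l then ρ/2 else if (i : ℕ) = l then 1 else (ρ/2)⁻¹)
    else 0

/-- The conjugating matrix `M` for the embedding of `SO_{2l}` into `SO_{2l+1}`. -/
def Mtop (l : ℕ) (ρ : F) : Matrix (Fin (2*l+1)) (Fin (2*l+1)) F :=
  Matrix.of fun i j =>
    if (i : ℕ) + 2 = l + 1 then (if (j : ℕ) = l then 1 else 0)
    else if (i : ℕ) = l then
      (if (j : ℕ) + 2 = l + 1 then (2 : F)⁻¹
       else if (j : ℕ) = l + 1 then (2 * (ρ/2))⁻¹ else 0)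
    else if (i : ℕ) = l + 1 then
      (if (j : ℕ) + 2 = l + 1 then (2 : F)⁻¹
       else if (j : ℕ) = l + 1 then -(2 * (ρ/2))⁻¹ else 0)
    else if i = j then 1 else 0

/-- Insert a trivial `(l+1)`-st row and column (1-indexed) into a `2l × 2l` matrix. -/
def insTop (l : ℕ) (g : Matrix (Fin (2*l)) (Fin (2*l)) F) :
    Matrix (Fin (2*l+1)) (Fin (2*l+1)) F :=
  Matrix.of fun i j =>
    if hi : (i : ℕ) = l then (if (j : ℕ) = l then 1 else 0)
    else if hj : (j : ℕ) = l then 0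
    else
      g ⟨if (i : ℕ) < l then (i : ℕ) else (i : ℕ) - 1, by have := i.isLt; split <;> omega⟩
        ⟨if (j : ℕ) < l then (j : ℕ) else (j : ℕ) - 1, by have := j.isLt; split <;> omega⟩

/-- The embedding of `SO_{2l}` into `SO_{2l+1}` at the matrix level. -/
def embTop (l : ℕ) (ρ : F) (g : Matrix (Fin (2*l)) (Fin (2*l)) F) :
    Matrix (Fin (2*l+1)) (Fin (2*l+1)) F :=
  (Mtop F l ρ)⁻¹ * insTop F l g * Mtop F l ρ

/-- The conjugating matrix `M = diag(I_n, [[0,2],[1,0]], I_n)` (size `2n+2`). -/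
def Mlow (n : ℕ) : Matrix (Fin (2*n+2)) (Fin (2*n+2)) F :=
  Matrix.of fun i j =>
    if (i : ℕ) = n then (if (j : ℕ) = n + 1 then 2 else 0)
    else if (i : ℕ) = n + 1 then (if (j : ℕ) = n then 1 else 0)
    else if i = j then 1 else 0

/-- Insert a trivial `(n+2)`-nd row and column (1-indexed) into a `(2n+1) × (2n+1)` matrix. -/
def insLow (n : ℕ) (g : Matrix (Fin (2*n+1)) (Fin (2*n+1)) F) :
    Matrix (Fin (2*n+2)) (Fin (2*n+2)) F :=
  Matrix.of fun i j =>
    if hi : (i : ℕ) = n + 1 then (if (j : ℕ) = n + 1 then 1 else 0)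
    else if hj : (j : ℕ) = n + 1 then 0
    else
      g ⟨if (i : ℕ) < n + 1 then (i : ℕ) else (i : ℕ) - 1, by have := i.isLt; split <;> omega⟩
        ⟨if (j : ℕ) < n + 1 then (j : ℕ) else (j : ℕ) - 1, by have := j.isLt; split <;> omega⟩

/-- The middle `2n+2` block of the embedding of `SO_{2n+1}` into `SO_{2l}`. -/
def embLowMid (n : ℕ) (g : Matrix (Fin (2*n+1)) (Fin (2*n+1)) F) :
    Matrix (Fin (2*n+2)) (Fin (2*n+2)) F :=
  (Mlow F n)⁻¹ * insLow F n g * Mlow F n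

/-- The embedding of `SO_{2n+1}` into `SO_{2l}` (for `n < l`) at the matrix level. -/
def embLow (l n : ℕ) (g : Matrix (Fin (2*n+1)) (Fin (2*n+1)) F) :
    Matrix (Fin (2*l)) (Fin (2*l)) F :=
  Matrix.of fun i j =>
    if h : l - n - 1 ≤ (i : ℕ) ∧ (i : ℕ) < l + n + 1 ∧ l - n - 1 ≤ (j : ℕ) ∧ (j : ℕ) < l + n + 1
    then embLowMid F n g ⟨(i : ℕ) - (l - n - 1), by omega⟩ ⟨(j : ℕ) - (l - n - 1), by omega⟩
    else if i = j then 1 else 0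
/-- The maximal torus `T` of `SO_{2l}`. -/
def TSet (l : ℕ) (ρ : F) : Set (SO2l F l ρ) :=
  {g | ∃ (tv : ℕ → Fˣ) (a b : F), a^2 - b^2 * ρ = 1 ∧ mat F g = torusMat F l ρ tv a b}

/-- The split subtorus `S` of `T`. -/
def SSet (l : ℕ) (ρ : F) : Set (SO2l F l ρ) :=
  {g | ∃ tv : ℕ → Fˣ, mat F g = torusMat F l ρ tv 1 0}

/-- The standard Borel subgroup `B = T·U` of `SO_{2l}` (as a set). -/
def BorelSet (l : ℕ) (ρ : F) : Set (SO2l F l ρ) :=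
  {b | ∃ t ∈ TSet F l ρ, ∃ u ∈ USet F l ρ, b = t * u}

/-- `w` normalizes the torus `T`. -/
def NormalizesT (l : ℕ) (ρ : F) (w : SO2l F l ρ) : Prop :=
  ∀ t ∈ TSet F l ρ, w * t * w⁻¹ ∈ TSet F l ρ ∧ w⁻¹ * t * w ∈ TSet F l ρ

/-- Standard basis weight `e_k` (as an integral character vector). -/
def eVec (k : ℕ) : ℕ → ℤ := fun i => if i = k then 1 else 0

/-- The simple (restricted) roots of `SO_{2l}`: `α_k = e_k - e_{k+1}` for `k < l-2`
(0-indexed) and `α_{l-2} = e_{l-2}`. -/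
def simpleRoot (l k : ℕ) : ℕ → ℤ :=
  fun i => (if i = k then 1 else 0) - (if i = k + 1 ∧ k + 3 ≤ l then 1 else 0)

/-- The positive (restricted) roots of `SO_{2l}` (type `B_{l-1}`). -/
def posRoot (l : ℕ) : Set (ℕ → ℤ) :=
  {α | (∃ i j, i < j ∧ j < l - 1 ∧ α = fun k => eVec i k - eVec j k) ∨
       (∃ i j, i < j ∧ j < l - 1 ∧ α = fun k => eVec i k + eVec j k) ∨
       (∃ i, i < l - 1 ∧ α = eVec i)}

/-- Negative roots. -/
def negRoot (l : ℕ) : Set (ℕ → ℤ) := {α | (fun k => -(α k)) ∈ posRoot l}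

/-- Simple roots (as a set). -/
def isSimpleRoot (l : ℕ) (α : ℕ → ℤ) : Prop := ∃ k, k < l - 1 ∧ α = simpleRoot l k

/-- Evaluation of an integral character vector on an element of the split torus. -/
def rootEval (l : ℕ) (ρ : F) (α : ℕ → ℤ) (g : SO2l F l ρ) : F :=
  ∏ i : Fin (2*l), (if (i : ℕ) < l - 1 then (mat F g i i) ^ (α (i : ℕ)) else 1)

/-- The Weyl representative `w` maps the character `α` of `S` to the character `β`. -/
def mapsRoot (l : ℕ) (ρ : F) (w : SO2l F l ρ) (α β : ℕ → ℤ) : Prop :=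
  ∀ s ∈ SSet F l ρ, w⁻¹ * s * w ∈ SSet F l ρ ∧
    rootEval F l ρ β s = rootEval F l ρ α (w⁻¹ * s * w)

/-- The Weyl representative `w` supports Bessel functions: every simple root is mapped
to a negative or simple root. -/
def SupportsBessel (l : ℕ) (ρ : F) (w : SO2l F l ρ) : Prop :=
  ∀ k, k < l - 1 → ∃ β : ℕ → ℤ, mapsRoot F l ρ w (simpleRoot l k) β ∧
    (β ∈ negRoot l ∨ isSimpleRoot l β)

/-- `θ_w = {k : wα_k is positive}`. -/
def besselTheta (l : ℕ) (ρ : F) (w : SO2l F l ρ) : Set ℕ :=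
  {k | k < l - 1 ∧ ∃ β : ℕ → ℤ, mapsRoot F l ρ w (simpleRoot l k) β ∧ β ∈ posRoot l}

/-- The cell `B_n(SO_{2l}) = {t_n(w')·w̃_n : w' ∈ W(GL_n)}`. -/
def BnSet (l : ℕ) (ρ : F) (n : ℕ) : Set (SO2l F l ρ) :=
  {g | ∃ σ : Equiv.Perm (Fin n), mat F g = tnMat F l n (permMat F n σ) * wTildeMat F l n}

/-- Block index for the Siegel parabolic of `SO_{2n+1}`. -/
def blkSiegel (n i : ℕ) : ℕ := if i < n then 0 else if i = n then 1 else 2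

/-- The unipotent radical `V_n` of the Siegel parabolic of `SO_{2n+1}` (matrix level). -/
def VnSet (n : ℕ) : Set (Matrix (Fin (2*n+1)) (Fin (2*n+1)) F) :=
  {m | m ∈ SOset F (2*n+1) (Jmat F (2*n+1)) ∧
    ∀ i j : Fin (2*n+1), blkSiegel n (j : ℕ) ≤ blkSiegel n (i : ℕ) →
      m i j = if i = j then 1 else 0}

/-- The group `R^{l,n}` (matrix level). -/
def RlnSet (l : ℕ) (ρ : F) (n : ℕ) : Set (Matrix (Fin (2*l)) (Fin (2*l)) F) :=
  {m | m ∈ SOset F (2*l) (Jrho F l ρ) ∧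
    ∀ i j : Fin (2*l),
      ¬((n ≤ (i : ℕ) ∧ (i : ℕ) < l - 1 ∧ (j : ℕ) < n) ∨
        (2*l - n ≤ (i : ℕ) ∧ l + 1 ≤ (j : ℕ) ∧ (j : ℕ) < 2*l - n)) →
      m i j = if i = j then 1 else 0}

/-- The subgroup `N^{l-n} = U_{GL_{l-n-1}}·N_{l-n-1}` of `SO_{2l}`. -/
def NlnSet (l : ℕ) (ρ : F) (n : ℕ) : Set (SO2l F l ρ) :=
  {g | upUnip F (mat F g) ∧
    ∀ i j : Fin (2*l), l - n - 1 ≤ (i : ℕ) → (i : ℕ) < l + n + 1 →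
      l - n - 1 ≤ (j : ℕ) → (j : ℕ) < l + n + 1 →
      mat F g i j = if i = j then 1 else 0}

/-- Block index for standard parabolic subgroups of `SO_{2m+1}`, given cuts `C`. -/
def blkB (m : ℕ) (C : Finset ℕ) (i : ℕ) : ℕ :=
  (C.filter (fun c => c ≤ i)).card + (C.filter (fun c => 2*m + 1 - c ≤ i)).card

/-- The standard parabolic subgroup of `SO_{2m+1}` given by cuts `C` (as a set). -/
def pbP (m : ℕ) (C : Finset ℕ) : Set (SOodd F m) :=
  {g | ∀ i j : Fin (2*m+1), blkB m C (j : ℕ) < blkB m C (i : ℕ) → mat F g i j = 0}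

/-- The unipotent radical of the standard parabolic subgroup of `SO_{2m+1}` given by cuts `C`. -/
def pbV (m : ℕ) (C : Finset ℕ) : Set (SOodd F m) :=
  {g | ∀ i j : Fin (2*m+1), blkB m C (j : ℕ) ≤ blkB m C (i : ℕ) →
    mat F g i j = if i = j then 1 else 0}
/-- Apply a representation of `GL_n(F)` at a plain matrix (zero if not invertible). -/
def tauApp (n : ℕ) {Wτ : Type*} [AddCommGroup Wτ] [Module ℂ Wτ]
    (τ : Representation ℂ (GL (Fin n) F) Wτ) (m : Matrix (Fin n) (Fin n) F) :
    Wτ →ₗ[ℂ] Wτ :=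
  matFun (fun g : GL (Fin n) F => (g : Matrix (Fin n) (Fin n) F)) (fun g => τ g) m

/-- `Λ` is a nonzero `ψ⁻¹`-Whittaker functional for the representation `τ` of `GL_n(F)`. -/
def IsGenericGLinv (n : ℕ) (ψ : AddChar F ℂ) {Wτ : Type*} [AddCommGroup Wτ] [Module ℂ Wτ]
    (τ : Representation ℂ (GL (Fin n) F) Wτ) (Λ : Wτ →ₗ[ℂ] ℂ) : Prop :=
  Λ ≠ 0 ∧ ∀ u : GL (Fin n) F, upUnip F ((u : Matrix (Fin n) (Fin n) F)) →
    ∀ x : Wτ, Λ (τ u x) = ψ (-(glUSum F n (u : Matrix (Fin n) (Fin n) F))) * Λ x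

/-- The induced space `I(τ) = Ind_{Q_n}^{SO_{2n+1}} τ` (matrix level). -/
def IndTau (n : ℕ) {Wτ : Type*} [AddCommGroup Wτ] [Module ℂ Wτ]
    (τ : Representation ℂ (GL (Fin n) F) Wτ) :
    Set (Matrix (Fin (2*n+1)) (Fin (2*n+1)) F → Wτ) :=
  {ξ | (∀ g, g ∉ SOset F (2*n+1) (Jmat F (2*n+1)) → ξ g = 0) ∧
    ∀ a : GL (Fin n) F, ∀ u ∈ VnSet F n, ∀ g,
      ξ (lnMat F n (a : Matrix (Fin n) (Fin n) F) * u * g) = τ a (ξ g)}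

/-- The space `I(τ, ψ⁻¹)` spanned by the functions `f_ξ(g,a) = Λ(τ(a)ξ(g))`. -/
def Imodel (n : ℕ) {Wτ : Type*} [AddCommGroup Wτ] [Module ℂ Wτ]
    (τ : Representation ℂ (GL (Fin n) F) Wτ) (Λ : Wτ →ₗ[ℂ] ℂ) :
    Set (Matrix (Fin (2*n+1)) (Fin (2*n+1)) F → Matrix (Fin n) (Fin n) F → ℂ) :=
  {f | ∃ ξ ∈ IndTau F n τ, f = fun g a => Λ (tauApp F n τ a (ξ g))}

open Classical in
/-- The section `ξ_v ∈ I(τ)` supported on the Siegel parabolic with `ξ_v(l_n(a)u) = τ(a)v`. -/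
def xiv (n : ℕ) {Wτ : Type*} [AddCommGroup Wτ] [Module ℂ Wτ]
    (τ : Representation ℂ (GL (Fin n) F) Wτ) (v : Wτ) :
    Matrix (Fin (2*n+1)) (Fin (2*n+1)) F → Wτ :=
  fun m =>
    if h : ∃ p : (GL (Fin n) F) × Matrix (Fin (2*n+1)) (Fin (2*n+1)) F,
        p.2 ∈ VnSet F n ∧ m = lnMat F n ((p.1 : Matrix (Fin n) (Fin n) F)) * p.2
    then τ h.choose.1 v else 0

/-- The function `f_v = f_{ξ_v} ∈ I(τ, ψ⁻¹)`. -/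
def fvFun (n : ℕ) {Wτ : Type*} [AddCommGroup Wτ] [Module ℂ Wτ]
    (τ : Representation ℂ (GL (Fin n) F) Wτ) (Λ : Wτ →ₗ[ℂ] ℂ) (v : Wτ) :
    Matrix (Fin (2*n+1)) (Fin (2*n+1)) F → Matrix (Fin n) (Fin n) F → ℂ :=
  fun g a => Λ (tauApp F n τ a (xiv F n τ v g))

/-- The intertwining operator `M(τ, ψ⁻¹)` at the level of functions. -/
def MOp (n : ℕ)
    (f : Matrix (Fin (2*n+1)) (Fin (2*n+1)) F → Matrix (Fin n) (Fin n) F → ℂ) :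
    Matrix (Fin (2*n+1)) (Fin (2*n+1)) F → Matrix (Fin n) (Fin n) F → ℂ :=
  fun h a => ∑ᶠ u ∈ VnSet F n, f (wnOddMat F n * u * h) (dnMat F n * aStar F n a)

/-- The zeta integral for `n < l`, via the embedding `SO_{2n+1} → SO_{2l}`
(the sum over coset representatives is realized as `|U|⁻¹` times the full sum). -/
def ZetaLow (l : ℕ) (ρ : F) (n : ℕ) (φ : SO2l F l ρ → ℂ)
    (f : Matrix (Fin (2*n+1)) (Fin (2*n+1)) F → Matrix (Fin n) (Fin n) F → ℂ) : ℂ :=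
  (Nat.card (UoddMatSet F n) : ℂ)⁻¹ *
    ∑ᶠ g ∈ SOset F (2*n+1) (Jmat F (2*n+1)),
      (∑ᶠ r ∈ RlnSet F l ρ n,
        matFun (fun x : SO2l F l ρ => mat F x) φ
          (r * wlnMat F l n * embLow F l n g * (wlnMat F l n)⁻¹)) * f g 1

/-- The zeta integral for `n = l`, via the embedding `SO_{2l} → SO_{2l+1}`. -/
def ZetaTop (l : ℕ) (ρ : F) (φ : SO2l F l ρ → ℂ)
    (f : Matrix (Fin (2*l+1)) (Fin (2*l+1)) F → Matrix (Fin l) (Fin l) F → ℂ) : ℂ :=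
  (Nat.card (USet F l ρ) : ℂ)⁻¹ *
    ∑ᶠ g : SO2l F l ρ, φ g * f (wllMat F l ρ * embTop F l ρ (mat F g)) 1

/-- The combined zeta integral `Ψ` for `1 ≤ n ≤ l`. -/
def Zeta (l : ℕ) (ρ : F) (n : ℕ) (φ : SO2l F l ρ → ℂ)
    (f : Matrix (Fin (2*n+1)) (Fin (2*n+1)) F → Matrix (Fin n) (Fin n) F → ℂ) : ℂ :=
  if n < l then ZetaLow F l ρ n φ f
  else if h : n = l then ZetaTop F l ρ φ (cast (by rw [h]) f)
  else 0

/-- `c` is the gamma factor `γ(π × τ, ψ)`: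
`c · Ψ(W_v, f) = Ψ(W_v, M(τ,ψ⁻¹) f)` for all Whittaker functions `W_v` of `π`
and all `f ∈ I(τ, ψ⁻¹)`. -/
def IsGamma (l : ℕ) (ρ : F) (n : ℕ) {V : Type*} [AddCommGroup V] [Module ℂ V]
    (π : Representation ℂ (SO2l F l ρ) V) (Γ : V →ₗ[ℂ] ℂ)
    {Wτ : Type*} [AddCommGroup Wτ] [Module ℂ Wτ]
    (τ : Representation ℂ (GL (Fin n) F) Wτ) (Λ : Wτ →ₗ[ℂ] ℂ) (c : ℂ) : Prop :=
  ∀ v : V, ∀ f ∈ Imodel F n τ Λ,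
    c * Zeta F l ρ n (fun g => Γ (π g v)) f =
      Zeta F l ρ n (fun g => Γ (π g v)) (MOp F n f)

/-- The Bessel function of the conjugate representation `π^c`:
`B_{π^c,ψ}(g) = B_{π,ψ}(c·t̃⁻¹·g·t̃·c)`. -/
def BesselConj (l : ℕ) (ρ : F) (B : SO2l F l ρ → ℂ) : SO2l F l ρ → ℂ :=
  fun g => matFun (fun x : SO2l F l ρ => mat F x) B
    (cMat F l * (tTildeMat F l)⁻¹ * mat F g * tTildeMat F l * cMat F l)

set_option linter.unusedSectionVars false
set_option linter.unusedFintypeInType false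

section Completeness

open MonoidAlgebra

variable {G : Type} [Group G]

/-- The representation of `G` on a left ideal of its group algebra. -/
def idealRep (S : Submodule (MonoidAlgebra ℂ G) (MonoidAlgebra ℂ G)) :
    Representation ℂ G S where
  toFun g :=
    { toFun := fun s => MonoidAlgebra.single g (1 : ℂ) • s
      map_add' := fun x y => smul_add _ x y
      map_smul' := fun c x => by
        apply Subtype.ext
        simp }
  map_one' := by
    ext x
    simp [← MonoidAlgebra.one_def]
  map_mul' g h := by
    ext x
    simp [← mul_assoc, MonoidAlgebra.single_mul_single]

lemma idealRep_coe (S : Submodule (MonoidAlgebra ℂ G) (MonoidAlgebra ℂ G)) (g : G) (s : S) :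
    (idealRep S g s : MonoidAlgebra ℂ G) = MonoidAlgebra.single g 1 * (s : MonoidAlgebra ℂ G) :=
  rfl

lemma idealRep_asAlgebraHom_coe (S : Submodule (MonoidAlgebra ℂ G) (MonoidAlgebra ℂ G))
    (e : MonoidAlgebra ℂ G) (s : S) :
    ((idealRep S).asAlgebraHom e s : MonoidAlgebra ℂ G) = e * (s : MonoidAlgebra ℂ G) := by
  induction e using MonoidAlgebra.induction_linear with
  | zero => simp
  | add f g hf hg => simp [map_add, add_mul, hf, hg]
  | single g c =>
    rw [Representation.asAlgebraHom_single]
    have : MonoidAlgebra.single g c = c • MonoidAlgebra.single g (1 : ℂ) := by simp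
    rw [this, smul_mul_assoc, ← idealRep_coe]
    rfl

lemma isIrrep_idealRep (S : Submodule (MonoidAlgebra ℂ G) (MonoidAlgebra ℂ G))
    (hS : IsSimpleModule (MonoidAlgebra ℂ G) S) : IsIrrep (idealRep S) := by
  constructor
  · have := IsSimpleModule.nontrivial (MonoidAlgebra ℂ G) S
    exact exists_ne (0 : S)
  · intro W hW
    have key : ∀ (e : MonoidAlgebra ℂ G) (s : S), s ∈ W → e • s ∈ W := by
      intro e s hs
      induction e using MonoidAlgebra.induction_linear with
      | zero => rw [zero_smul]; exact W.zero_mem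
      | add f g hf hg => rw [add_smul]; exact W.add_mem hf hg
      | single g c =>
        have : MonoidAlgebra.single g c = c • MonoidAlgebra.single g (1 : ℂ) := by simp
        rw [this, smul_assoc]
        exact W.smul_mem _ (hW g s hs)
    let W' : Submodule (MonoidAlgebra ℂ G) S :=
      { carrier := W
        add_mem' := fun ha hb => W.add_mem ha hb
        zero_mem' := W.zero_mem
        smul_mem' := fun e s hs => key e s hs }
    rcases eq_bot_or_eq_top W' with h | h
    · left
      ext x
      have : x ∈ W ↔ x ∈ (⊥ : Submodule (MonoidAlgebra ℂ G) S) := by rw [← h]; rfl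
      simpa using this
    · right
      ext x
      have : x ∈ W ↔ x ∈ (⊤ : Submodule (MonoidAlgebra ℂ G) S) := by rw [← h]; rfl
      simpa using this

/-- An element of the group algebra which is `(U, χ)`-equivariant on the left and is killed by
all matrix coefficients of irreducible representations against `(U, χ)`-equivariant
functionals vanishes. -/
lemma eq_zero_of_generic_coeffs [Finite G] (U : Subgroup G) (χ : G → ℂ)
    (hχ1 : χ 1 = 1) (hχm : ∀ u ∈ U, ∀ v ∈ U, χ (u * v) = χ u * χ v)
    (e : MonoidAlgebra ℂ G) (he : ∀ u ∈ U, MonoidAlgebra.single u 1 * e = χ u • e)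
    (h : ∀ (W : Type) [AddCommGroup W] [Module ℂ W] (τ : Representation ℂ G W) (Λ : W →ₗ[ℂ] ℂ),
      IsIrrep τ → Λ ≠ 0 → (∀ u ∈ U, ∀ x, Λ (τ u x) = χ u * Λ x) →
      ∀ v, Λ (τ.asAlgebraHom e v) = 0) : e = 0 := by
  classical
  have : Fintype G := Fintype.ofFinite G
  have hcard : NeZero (Nat.card G : ℂ) := ⟨by exact_mod_cast Nat.card_pos.ne'⟩
  have hne : ∀ u ∈ U, χ u ≠ 0 := fun u hu h0 => by
    have := hχm u hu u⁻¹ (U.inv_mem hu)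
    rw [mul_inv_cancel, hχ1, h0, zero_mul] at this
    exact one_ne_zero this
  have kill : ∀ S : Submodule (MonoidAlgebra ℂ G) (MonoidAlgebra ℂ G),
      IsSimpleModule (MonoidAlgebra ℂ G) S → ∀ s ∈ S, e * s = 0 := by
    intro S hS s hs
    set τ := idealRep S with hτ
    by_contra hne0
    have hv : τ.asAlgebraHom e ⟨s, hs⟩ ≠ 0 := fun h0 => hne0 (by
      rw [← idealRep_asAlgebraHom_coe S e ⟨s, hs⟩, ← hτ, h0]; rfl)
    obtain ⟨f, hf⟩ : ∃ f : Module.Dual ℂ S, f (τ.asAlgebraHom e ⟨s, hs⟩) ≠ 0 := by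
      by_contra! hcon
      exact hv ((Module.forall_dual_apply_eq_zero_iff ℂ _).1 hcon)
    have hinv : ∀ u ∈ U, τ u (τ.asAlgebraHom e ⟨s, hs⟩) = χ u • τ.asAlgebraHom e ⟨s, hs⟩ := by
      intro u hu
      apply Subtype.ext
      rw [hτ, idealRep_coe, idealRep_asAlgebraHom_coe, ← mul_assoc, he u hu]
      rw [Submodule.coe_smul_of_tower, idealRep_asAlgebraHom_coe, smul_mul_assoc]
    let P : S →ₗ[ℂ] S := ∑ u : U, (χ u)⁻¹ • τ u
    have hPe : P (τ.asAlgebraHom e ⟨s, hs⟩) = (Fintype.card U : ℂ) • τ.asAlgebraHom e ⟨s, hs⟩ := by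
      simp only [P, LinearMap.sum_apply, LinearMap.smul_apply]
      rw [Finset.sum_congr rfl (fun u _ => by
        rw [hinv u u.2, smul_smul, inv_mul_cancel₀ (hne u u.2), one_smul])]
      rw [Finset.sum_const, Finset.card_univ, Nat.cast_smul_eq_nsmul]
    have hPu : ∀ u ∈ U, ∀ x, P (τ u x) = χ u • P x := by
      intro u hu x
      simp only [P, LinearMap.sum_apply, LinearMap.smul_apply, Finset.smul_sum]
      refine Fintype.sum_equiv (Equiv.mulRight ⟨u, hu⟩) _ _ fun w => ?_
      simp only [Equiv.coe_mulRight, Subgroup.coe_mul, smul_smul, hχm w w.2 u hu, map_mul,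
        Module.End.mul_apply]
      congr 1
      field_simp [hne u hu, hne w w.2]
    have hz := h S τ (f ∘ₗ P) (isIrrep_idealRep S hS)
      (fun h0 => by
        have := congrArg (fun L => L (τ.asAlgebraHom e ⟨s, hs⟩)) h0
        simp only [LinearMap.comp_apply, hPe, map_smul, LinearMap.zero_apply, smul_eq_mul,
          mul_eq_zero] at this
        rcases this with h1 | h1
        · exact Fintype.card_ne_zero (Nat.cast_eq_zero.1 h1)
        · exact hf h1)
      (fun u hu x => by simp [hPu u hu]) ⟨s, hs⟩
    rw [LinearMap.comp_apply, hPe, map_smul, smul_eq_mul, mul_eq_zero] at hz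
    rcases hz with h1 | h1
    · exact Fintype.card_ne_zero (Nat.cast_eq_zero.1 h1)
    · exact hf h1
  have htop := IsSemisimpleModule.sSup_simples_eq_top (MonoidAlgebra ℂ G) (MonoidAlgebra ℂ G)
  have all : ∀ x : MonoidAlgebra ℂ G, e * x = 0 := by
    intro x
    have hx : x ∈ sSup {m : Submodule (MonoidAlgebra ℂ G) (MonoidAlgebra ℂ G) |
        IsSimpleModule (MonoidAlgebra ℂ G) m} := by rw [htop]; trivial
    rw [sSup_eq_iSup'] at hx
    refine Submodule.iSup_induction _ (motive := fun x => e * x = 0) hx ?_ (mul_zero e) ?_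
    · intro S y hy
      exact kill S S.2 y hy
    · intro a b ha hb
      rw [mul_add, ha, hb, add_zero]
  simpa using all 1

end Completeness

section Unipotent

variable {F} {m : ℕ}

lemma Jmat_mul {k : ℕ} (M : Matrix (Fin m) (Fin k) F) :
    Jmat F m * M = M.submatrix Fin.rev id := by
  ext i j
  rw [Matrix.mul_apply, Finset.sum_eq_single (Fin.rev i)]
  · simp only [Jmat, Matrix.of_apply, Fin.val_rev, Matrix.submatrix_apply, id_eq]
    rw [if_pos (by omega), one_mul]
  · intro b _ hb
    simp only [Jmat, Matrix.of_apply]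
    rw [if_neg, zero_mul]
    intro h
    apply hb
    ext
    simp only [Fin.val_rev]
    omega
  · simp

lemma transpose_Jmat : (Jmat F m)ᵀ = Jmat F m := by
  ext i j
  simp only [Jmat, Matrix.transpose_apply, Matrix.of_apply]
  congr 1
  rw [add_comm (j : ℕ)]

lemma mul_Jmat {k : ℕ} (M : Matrix (Fin k) (Fin m) F) :
    M * Jmat F m = M.submatrix id Fin.rev := by
  rw [← Matrix.transpose_inj, Matrix.transpose_mul, transpose_Jmat, Jmat_mul]
  rfl

lemma Jmat_sq : Jmat F m * Jmat F m = 1 := by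
  rw [Jmat_mul]
  ext i j
  simp only [Jmat, Matrix.submatrix_apply, Matrix.of_apply, Matrix.one_apply, Fin.val_rev, id_eq,
    Fin.ext_iff]
  congr 1
  simp only [eq_iff_iff]
  omega

lemma aStar_apply (a : Matrix (Fin m) (Fin m) F) (i j : Fin m) :
    aStar F m a i j = a⁻¹ (Fin.rev j) (Fin.rev i) := by
  rw [aStar, mul_Jmat, Jmat_mul]
  rfl

lemma aStar_one : aStar F m 1 = 1 := by
  simp [aStar, Jmat_sq]

lemma aStar_aStar {a : Matrix (Fin m) (Fin m) F} (ha : IsUnit a.det) :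
    aStar F m (aStar F m a) = a := by
  have hJ : (Jmat F m)⁻¹ = Jmat F m := Matrix.inv_eq_right_inv Jmat_sq
  simp only [aStar, Matrix.mul_inv_rev, Matrix.transpose_mul, hJ, transpose_Jmat,
    ← Matrix.transpose_nonsing_inv, Matrix.transpose_transpose, Matrix.nonsing_inv_nonsing_inv a ha]
  calc _ = (Jmat F m * Jmat F m) * a * (Jmat F m * Jmat F m) := by simp only [Matrix.mul_assoc]
    _ = a := by rw [Jmat_sq]; simp

lemma transpose_mul_Jmat_mul_aStar {a : Matrix (Fin m) (Fin m) F} (ha : IsUnit a.det) :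
    aᵀ * Jmat F m * aStar F m a = Jmat F m := by
  calc aᵀ * Jmat F m * aStar F m a = aᵀ * (Jmat F m * Jmat F m) * (a⁻¹)ᵀ * Jmat F m := by
        simp only [aStar, Matrix.mul_assoc]
    _ = Jmat F m := by
        rw [Jmat_sq, Matrix.mul_one, ← Matrix.transpose_mul, Matrix.nonsing_inv_mul _ ha]; simp

lemma det_mul_det_aStar {a : Matrix (Fin m) (Fin m) F} (ha : IsUnit a.det) :
    a.det * (aStar F m a).det = 1 := by
  have h := congrArg Matrix.det (Jmat_sq (F := F) (m := m))
  rw [Matrix.det_mul, Matrix.det_one] at h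
  rw [aStar, Matrix.det_mul, Matrix.det_mul, Matrix.det_transpose]
  have h2 := congrArg Matrix.det (Matrix.mul_nonsing_inv a ha)
  rw [Matrix.det_mul, Matrix.det_one] at h2
  linear_combination h * a.det * a⁻¹.det + h2

lemma upUnip_one : upUnip F (1 : Matrix (Fin m) (Fin m) F) := by
  intro i j _
  rw [Matrix.one_apply]

lemma upUnip.blockTriangular {M : Matrix (Fin m) (Fin m) F} (hM : upUnip F M) :
    M.BlockTriangular id := by
  intro i j hij
  have := hM i j (Fin.val_fin_le.2 (le_of_lt hij))
  rw [this]
  exact if_neg (ne_of_gt hij)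

lemma upUnip.apply_self {M : Matrix (Fin m) (Fin m) F} (hM : upUnip F M) (i : Fin m) :
    M i i = 1 := by
  rw [hM i i le_rfl, if_pos rfl]

lemma upUnip.det_eq_one {M : Matrix (Fin m) (Fin m) F} (hM : upUnip F M) : M.det = 1 := by
  rw [Matrix.det_of_isUpperTriangular hM.blockTriangular]
  exact Finset.prod_eq_one fun i _ => hM.apply_self i

lemma upUnip_iff {M : Matrix (Fin m) (Fin m) F} :
    upUnip F M ↔ M.BlockTriangular id ∧ ∀ i, M i i = 1 := by
  refine ⟨fun h => ⟨h.blockTriangular, h.apply_self⟩, fun ⟨h1, h2⟩ i j hij => ?_⟩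
  by_cases h : i = j
  · subst h; simp [h2]
  · rw [if_neg h]
    exact h1 (lt_of_le_of_ne (Fin.val_fin_le.1 hij) (Ne.symm h))

lemma upUnip.mul {A B : Matrix (Fin m) (Fin m) F} (hA : upUnip F A) (hB : upUnip F B) :
    upUnip F (A * B) := by
  refine upUnip_iff.2 ⟨hA.blockTriangular.mul hB.blockTriangular, fun i => ?_⟩
  rw [Matrix.mul_apply, Finset.sum_eq_single i, hA.apply_self, hB.apply_self, one_mul]
  · intro k _ hk
    rcases lt_or_gt_of_ne hk with h | h
    · rw [hA.blockTriangular h, zero_mul]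
    · rw [hB.blockTriangular h, mul_zero]
  · simp

lemma upUnip.pow {A : Matrix (Fin m) (Fin m) F} (hA : upUnip F A) (k : ℕ) : upUnip F (A ^ k) := by
  induction k with
  | zero => rw [pow_zero]; exact upUnip_one
  | succ k ih => rw [pow_succ]; exact ih.mul hA

lemma upUnip_inv_val {u : GL (Fin m) F} (hu : upUnip F (u : Matrix (Fin m) (Fin m) F)) :
    upUnip F ((u⁻¹ : GL (Fin m) F) : Matrix (Fin m) (Fin m) F) := by
  have : u⁻¹ = u ^ (Nat.card (GL (Fin m) F) - 1) := by
    rw [inv_eq_iff_mul_eq_one, ← pow_succ', Nat.sub_add_cancel Nat.card_pos, pow_card_eq_one']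
  rw [this, Units.val_pow_eq_pow_val]
  exact hu.pow _

lemma upUnip.inv {A : Matrix (Fin m) (Fin m) F} (hA : upUnip F A) : upUnip F A⁻¹ := by
  have h : IsUnit A.det := by rw [hA.det_eq_one]; exact isUnit_one
  have := upUnip_inv_val (u := Matrix.nonsingInvUnit A h) hA
  rwa [Matrix.coe_units_inv] at this

/-- The upper triangular unipotent subgroup of `GL_m(F)`. -/
def upUnipSubgroup (F : Type) [Field F] [Fintype F] (m : ℕ) : Subgroup (GL (Fin m) F) where
  carrier := {u | upUnip F (u : Matrix (Fin m) (Fin m) F)}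
  one_mem' := upUnip_one
  mul_mem' := fun {a b} ha hb => by
    have : upUnip F ((a : Matrix (Fin m) (Fin m) F) * (b : Matrix (Fin m) (Fin m) F)) :=
      upUnip.mul ha hb
    simpa using this
  inv_mem' := fun h => upUnip_inv_val h

lemma upUnip.mul_apply_succ {A B : Matrix (Fin m) (Fin m) F} (hA : upUnip F A) (hB : upUnip F B)
    {i j : Fin m} (hij : (j : ℕ) = (i : ℕ) + 1) : (A * B) i j = A i j + B i j := by
  have hne : i ≠ j := fun h => by rw [h] at hij; omega
  rw [Matrix.mul_apply, Finset.sum_eq_add i j hne, hA.apply_self, hB.apply_self]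
  · ring
  · intro k _ hk
    rcases lt_or_gt_of_ne hk.1 with h | h
    · rw [hA.blockTriangular h, zero_mul]
    · have : j < k := by
        have h1 := Fin.lt_def.1 h
        have h2 : (k : ℕ) ≠ j := fun h => hk.2 (Fin.ext h)
        rw [Fin.lt_def]; omega
      rw [hB.blockTriangular this, mul_zero]
  · simp
  · simp

lemma glUSum_one : glUSum F m 1 = 0 := by
  refine Finset.sum_eq_zero fun i _ => Finset.sum_eq_zero fun j _ => ?_
  split_ifs with h
  · rw [Matrix.one_apply_ne]
    intro h'
    rw [h'] at h
    omega
  · rfl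

lemma glUSum_mul {A B : Matrix (Fin m) (Fin m) F} (hA : upUnip F A) (hB : upUnip F B) :
    glUSum F m (A * B) = glUSum F m A + glUSum F m B := by
  simp only [glUSum, ← Finset.sum_add_distrib]
  refine Finset.sum_congr rfl fun i _ => Finset.sum_congr rfl fun j _ => ?_
  split_ifs with h
  · exact hA.mul_apply_succ hB h
  · simp

lemma glUSum_inv {A : Matrix (Fin m) (Fin m) F} (hA : upUnip F A) :
    glUSum F m A⁻¹ = -glUSum F m A := by
  have h : IsUnit A.det := by rw [hA.det_eq_one]; exact isUnit_one
  have := glUSum_mul hA hA.inv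
  rw [Matrix.mul_nonsing_inv _ h, glUSum_one] at this
  linear_combination -this

lemma upUnip_aStar {A : Matrix (Fin m) (Fin m) F} (hA : upUnip F A) :
    upUnip F (aStar F m A) := by
  intro i j hij
  rw [aStar_apply, hA.inv _ _ (by simp only [Fin.val_rev]; omega)]
  simp only [Fin.rev_inj, eq_comm]

lemma glUSum_aStar {A : Matrix (Fin m) (Fin m) F} (hA : upUnip F A) :
    glUSum F m (aStar F m A) = -glUSum F m A := by
  rw [← glUSum_inv hA, glUSum, glUSum, Finset.sum_comm]
  refine Fintype.sum_equiv Fin.revPerm _ _ fun i => Fintype.sum_equiv Fin.revPerm _ _ fun j => ?_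
  rw [aStar_apply]
  simp only [Fin.revPerm_apply, Fin.val_rev]
  have h1 := i.isLt
  have h2 := j.isLt
  congr 1
  simp only [eq_iff_iff]
  omega

lemma dnMat_eq : dnMat F m = Matrix.diagonal fun i : Fin m => (-1 : F) ^ ((i : ℕ) + 1) := by
  ext i j
  simp [dnMat, Matrix.diagonal_apply]

lemma dnMat_sq : dnMat F m * dnMat F m = 1 := by
  rw [dnMat_eq, Matrix.diagonal_mul_diagonal, ← Matrix.diagonal_one]
  congr 1
  ext i
  rw [← mul_pow]
  simp

lemma dnMat_conj_apply (A : Matrix (Fin m) (Fin m) F) (i j : Fin m) :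
    (dnMat F m * A * dnMat F m) i j = (-1) ^ ((i : ℕ) + 1) * A i j * (-1) ^ ((j : ℕ) + 1) := by
  rw [dnMat_eq, Matrix.mul_diagonal, Matrix.diagonal_mul]

lemma upUnip_dnMat_conj {A : Matrix (Fin m) (Fin m) F} (hA : upUnip F A) :
    upUnip F (dnMat F m * A * dnMat F m) := by
  intro i j hij
  rw [dnMat_conj_apply, hA i j hij]
  split_ifs with h
  · subst h
    rw [mul_one, ← mul_pow]
    simp
  · simp

lemma glUSum_dnMat_conj (A : Matrix (Fin m) (Fin m) F) :
    glUSum F m (dnMat F m * A * dnMat F m) = -glUSum F m A := by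
  simp only [glUSum, ← Finset.sum_neg_distrib]
  refine Finset.sum_congr rfl fun i _ => Finset.sum_congr rfl fun j _ => ?_
  split_ifs with h
  · rw [dnMat_conj_apply, h, mul_right_comm, ← pow_add]
    rw [Odd.neg_one_pow ⟨(i : ℕ) + 1, by ring⟩]
    ring
  · simp

end Unipotent

section ThreeBlocks

variable {F}
variable {α β ι κ μ : Type*} [Fintype α] [Fintype β] [Fintype ι] (e : α ⊕ β ⊕ α ≃ ι)

/-- First block of indices. -/
def fstIdx : α → ι := fun i => e (Sum.inl i)

/-- Middle block of indices. -/
def midIdx : β → ι := fun i => e (Sum.inr (Sum.inl i))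

/-- Last block of indices. -/
def lstIdx : α → ι := fun i => e (Sum.inr (Sum.inr i))

lemma sum_three {M : Type*} [AddCommMonoid M] (f : ι → M) :
    ∑ i, f i = ∑ i, f (fstIdx e i) + ∑ i, f (midIdx e i) + ∑ i, f (lstIdx e i) := by
  rw [← e.sum_comp, Fintype.sum_sum_type, Fintype.sum_sum_type, add_assoc]
  rfl

lemma forall_three {p : ι → Prop} :
    (∀ i, p i) ↔ (∀ i, p (fstIdx e i)) ∧ (∀ i, p (midIdx e i)) ∧ ∀ i, p (lstIdx e i) := by
  refine ⟨fun h => ⟨fun i => h _, fun i => h _, fun i => h _⟩, fun ⟨h1, h2, h3⟩ i => ?_⟩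
  obtain ⟨j, rfl⟩ := e.surjective i
  rcases j with j | j | j
  · exact h1 j
  · exact h2 j
  · exact h3 j

lemma mul_three (A : Matrix κ ι F) (B : Matrix ι μ F) :
    A * B = A.submatrix id (fstIdx e) * B.submatrix (fstIdx e) id
      + A.submatrix id (midIdx e) * B.submatrix (midIdx e) id
      + A.submatrix id (lstIdx e) * B.submatrix (lstIdx e) id := by
  ext i j
  simp only [Matrix.mul_apply, Matrix.add_apply, Matrix.submatrix_apply, id_eq]
  exact sum_three e _

lemma rows_ext_three {A B : Matrix ι μ F}
    (h1 : A.submatrix (fstIdx e) id = B.submatrix (fstIdx e) id)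
    (h2 : A.submatrix (midIdx e) id = B.submatrix (midIdx e) id)
    (h3 : A.submatrix (lstIdx e) id = B.submatrix (lstIdx e) id) : A = B := by
  ext i j
  revert i
  rw [forall_three e]
  exact ⟨fun i => congrFun (congrFun h1 i) j, fun i => congrFun (congrFun h2 i) j,
    fun i => congrFun (congrFun h3 i) j⟩

lemma cols_ext_three {A B : Matrix μ ι F}
    (h1 : A.submatrix id (fstIdx e) = B.submatrix id (fstIdx e))
    (h2 : A.submatrix id (midIdx e) = B.submatrix id (midIdx e))
    (h3 : A.submatrix id (lstIdx e) = B.submatrix id (lstIdx e)) : A = B := by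
  rw [← Matrix.transpose_inj]
  exact rows_ext_three e (congrArg Matrix.transpose h1) (congrArg Matrix.transpose h2)
    (congrArg Matrix.transpose h3)

/-- The symmetric form with antidiagonal blocks `J` and middle block `S`. -/
def formThree (J : Matrix α α F) (S : Matrix β β F) : Matrix ι ι F :=
  (Matrix.fromBlocks 0 (Matrix.fromCols 0 J) (Matrix.fromRows 0 J)
    (Matrix.fromBlocks S 0 0 0)).submatrix e.symm e.symm

/-- The block upper triangular matrix with diagonal blocks `a`, `1`, `A`. -/
def upThree [DecidableEq β] (a : Matrix α α F) (b : Matrix α β F) (z : Matrix α α F)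
    (b' : Matrix β α F) (A : Matrix α α F) : Matrix ι ι F :=
  (Matrix.fromBlocks a (Matrix.fromCols b z) 0
    (Matrix.fromBlocks 1 b' 0 A)).submatrix e.symm e.symm

lemma formThree_mul (J : Matrix α α F) (S : Matrix β β F) (k : Matrix ι μ F) :
    (formThree e J S * k).submatrix (fstIdx e) id = J * k.submatrix (lstIdx e) id ∧
    (formThree e J S * k).submatrix (midIdx e) id = S * k.submatrix (midIdx e) id ∧
    (formThree e J S * k).submatrix (lstIdx e) id = J * k.submatrix (fstIdx e) id := by
  refine ⟨?_, ?_, ?_⟩ <;> ext i j <;>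
    simp [Matrix.mul_apply, sum_three e, formThree, fstIdx, midIdx, lstIdx]

lemma form_apply_three (J : Matrix α α F) (S : Matrix β β F) (k : Matrix ι κ F)
    (k' : Matrix ι μ F) :
    kᵀ * formThree e J S * k' =
      (k.submatrix (fstIdx e) id)ᵀ * J * k'.submatrix (lstIdx e) id
      + (k.submatrix (midIdx e) id)ᵀ * S * k'.submatrix (midIdx e) id
      + (k.submatrix (lstIdx e) id)ᵀ * J * k'.submatrix (fstIdx e) id := by
  obtain ⟨h1, h2, h3⟩ := formThree_mul e J S k'
  rw [Matrix.mul_assoc, mul_three e, h1, h2, h3]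
  simp only [Matrix.mul_assoc, Matrix.transpose_submatrix]

lemma form_submatrix_three {γ δ : Type*} (J : Matrix α α F) (S : Matrix β β F) (k : Matrix ι κ F)
    (k' : Matrix ι μ F) (f : γ → κ) (g : δ → μ) :
    (kᵀ * formThree e J S * k').submatrix f g =
      (k.submatrix (fstIdx e) f)ᵀ * J * k'.submatrix (lstIdx e) g
      + (k.submatrix (midIdx e) f)ᵀ * S * k'.submatrix (midIdx e) g
      + (k.submatrix (lstIdx e) f)ᵀ * J * k'.submatrix (fstIdx e) g := by
  rw [form_apply_three]
  rfl

section Up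

variable [DecidableEq β] (a : Matrix α α F) (b : Matrix α β F) (z : Matrix α α F)
  (b' : Matrix β α F) (A : Matrix α α F)

lemma upThree_fst_fst : (upThree e a b z b' A).submatrix (fstIdx e) (fstIdx e) = a := by
  ext; simp [upThree, fstIdx]

lemma upThree_fst_mid : (upThree e a b z b' A).submatrix (fstIdx e) (midIdx e) = b := by
  ext; simp [upThree, fstIdx, midIdx]

lemma upThree_fst_lst : (upThree e a b z b' A).submatrix (fstIdx e) (lstIdx e) = z := by
  ext; simp [upThree, fstIdx, lstIdx]

lemma upThree_mid_fst : (upThree e a b z b' A).submatrix (midIdx e) (fstIdx e) = 0 := by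
  ext; simp [upThree, fstIdx, midIdx]

lemma upThree_mid_mid : (upThree e a b z b' A).submatrix (midIdx e) (midIdx e) = 1 := by
  ext; simp [upThree, midIdx]

lemma upThree_mid_lst : (upThree e a b z b' A).submatrix (midIdx e) (lstIdx e) = b' := by
  ext; simp [upThree, midIdx, lstIdx]

lemma upThree_lst_fst : (upThree e a b z b' A).submatrix (lstIdx e) (fstIdx e) = 0 := by
  ext; simp [upThree, fstIdx, lstIdx]

lemma upThree_lst_mid : (upThree e a b z b' A).submatrix (lstIdx e) (midIdx e) = 0 := by
  ext; simp [upThree, midIdx, lstIdx]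

lemma upThree_lst_lst : (upThree e a b z b' A).submatrix (lstIdx e) (lstIdx e) = A := by
  ext; simp [upThree, lstIdx]

lemma det_upThree [DecidableEq α] [DecidableEq ι] :
    (upThree e a b z b' A).det = a.det * A.det := by
  rw [upThree, Matrix.det_submatrix_equiv_self, Matrix.det_fromBlocks_zero₂₁,
    Matrix.det_fromBlocks_zero₂₁, Matrix.det_one, one_mul]

variable {a b z b' A} in
lemma upThree_isometry {J : Matrix α α F} {S : Matrix β β F} (hJ : Jᵀ = J) (hS : Sᵀ = S)
    (h1 : aᵀ * J * A = J) (h2 : bᵀ * J * A + S * b' = 0)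
    (h3 : zᵀ * J * A + b'ᵀ * S * b' + Aᵀ * J * z = 0) :
    (upThree e a b z b' A)ᵀ * formThree e J S * upThree e a b z b' A = formThree e J S := by
  have h1' : Aᵀ * J * a = J := by
    simpa [Matrix.transpose_mul, hJ, Matrix.mul_assoc] using congrArg Matrix.transpose h1
  have h2' : b'ᵀ * S + Aᵀ * J * b = 0 := by
    simpa [Matrix.transpose_mul, hJ, hS, Matrix.mul_assoc, add_comm]
      using congrArg Matrix.transpose h2
  refine rows_ext_three e (cols_ext_three e ?_ ?_ ?_) (cols_ext_three e ?_ ?_ ?_)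
    (cols_ext_three e ?_ ?_ ?_) <;>
  · rw [Matrix.submatrix_submatrix, Matrix.submatrix_submatrix, Function.comp_id, Function.id_comp]
    refine (form_submatrix_three e J S _ _ _ _).trans ?_
    simp only [upThree_fst_fst, upThree_fst_mid,
      upThree_fst_lst, upThree_mid_fst, upThree_mid_mid,
      upThree_mid_lst, upThree_lst_fst, upThree_lst_mid, upThree_lst_lst, Matrix.transpose_zero,
      Matrix.zero_mul, Matrix.mul_zero, add_zero, zero_add, Matrix.transpose_one, Matrix.one_mul,
      Matrix.mul_one, h1, h2, h3, h1', h2']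
    ext
    simp [formThree, fstIdx, midIdx, lstIdx]

end Up

end ThreeBlocks

section OddSide

variable {F}

/-- Splitting of `Fin N` into consecutive blocks of sizes `a`, `b`, `a`. -/
def finThree (a b N : ℕ) (h : a + b + a = N) : Fin a ⊕ Fin b ⊕ Fin a ≃ Fin N :=
  (Equiv.sumAssoc _ _ _).symm.trans
    (((Equiv.sumCongr finSumFinEquiv (Equiv.refl _)).trans finSumFinEquiv).trans (finCongr h))

lemma fstIdx_finThree {a b N : ℕ} (h : a + b + a = N) (i : Fin a) :
    ((fstIdx (finThree a b N h) i : Fin N) : ℕ) = i := by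
  simp [fstIdx, finThree]

lemma midIdx_finThree {a b N : ℕ} (h : a + b + a = N) (i : Fin b) :
    ((midIdx (finThree a b N h) i : Fin N) : ℕ) = a + i := by
  simp [midIdx, finThree]

lemma lstIdx_finThree {a b N : ℕ} (h : a + b + a = N) (i : Fin a) :
    ((lstIdx (finThree a b N h) i : Fin N) : ℕ) = a + b + i := by
  simp [lstIdx, finThree]

lemma upThree_mul {α β ι μ : Type*} [Fintype α] [Fintype β] [Fintype ι] [DecidableEq β]
    (e : α ⊕ β ⊕ α ≃ ι) (a : Matrix α α F) (b : Matrix α β F) (z : Matrix α α F)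
    (b' : Matrix β α F) (A : Matrix α α F) (k : Matrix ι μ F) :
    (upThree e a b z b' A * k).submatrix (fstIdx e) id =
        a * k.submatrix (fstIdx e) id + b * k.submatrix (midIdx e) id
          + z * k.submatrix (lstIdx e) id ∧
    (upThree e a b z b' A * k).submatrix (midIdx e) id =
        k.submatrix (midIdx e) id + b' * k.submatrix (lstIdx e) id ∧
    (upThree e a b z b' A * k).submatrix (lstIdx e) id = A * k.submatrix (lstIdx e) id := by
  refine ⟨?_, ?_, ?_⟩
  · rw [← upThree_fst_fst e a b z b' A]
    conv_rhs => rw [← upThree_fst_mid e a b z b' A]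
    ext i j
    simp [Matrix.mul_apply, sum_three e, upThree, fstIdx, midIdx, lstIdx]
  · ext i j
    simp [Matrix.mul_apply, sum_three e, upThree, fstIdx, midIdx, lstIdx, Matrix.one_apply]
  · ext i j
    simp [Matrix.mul_apply, sum_three e, upThree, fstIdx, midIdx, lstIdx]

lemma SOset_mul {m : ℕ} {Jm g h : Matrix (Fin m) (Fin m) F} (hg : g ∈ SOset F m Jm)
    (hh : h ∈ SOset F m Jm) : g * h ∈ SOset F m Jm := by
  refine ⟨by rw [Matrix.det_mul, hg.1, hh.1, one_mul], ?_⟩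
  calc (g * h)ᵀ * Jm * (g * h) = hᵀ * (gᵀ * Jm * g) * h := by
        simp only [Matrix.transpose_mul, Matrix.mul_assoc]
    _ = Jm := by rw [hg.2, hh.2]

lemma SOset_mul_iff {m : ℕ} {Jm g h : Matrix (Fin m) (Fin m) F} (hg : g ∈ SOset F m Jm) :
    g * h ∈ SOset F m Jm ↔ h ∈ SOset F m Jm := by
  refine ⟨fun hh => ⟨?_, ?_⟩, SOset_mul hg⟩
  · have := hh.1
    rwa [Matrix.det_mul, hg.1, one_mul] at this
  · calc hᵀ * Jm * h = hᵀ * (gᵀ * Jm * g) * h := by rw [hg.2]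
      _ = (g * h)ᵀ * Jm * (g * h) := by simp only [Matrix.transpose_mul, Matrix.mul_assoc]
      _ = Jm := hh.2

/-- Splitting of the indices of `SO_{2m+1}`. -/
def oddIdx (m : ℕ) : Fin m ⊕ Fin 1 ⊕ Fin m ≃ Fin (2 * m + 1) := finThree m 1 (2 * m + 1) (by omega)

lemma fstIdx_oddIdx {m : ℕ} (i : Fin m) : ((fstIdx (oddIdx m) i : Fin (2 * m + 1)) : ℕ) = i := fstIdx_finThree _ i

lemma midIdx_oddIdx {m : ℕ} (i : Fin 1) : ((midIdx (oddIdx m) i : Fin (2 * m + 1)) : ℕ) = m := by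
  have := midIdx_finThree (by omega : m + 1 + m = 2 * m + 1) i
  rwa [Fin.val_eq_zero, add_zero] at this

lemma lstIdx_oddIdx {m : ℕ} (i : Fin m) : ((lstIdx (oddIdx m) i : Fin (2 * m + 1)) : ℕ) = m + 1 + i :=
  lstIdx_finThree _ i

variable {m : ℕ}

lemma Jmat_odd : Jmat F (2 * m + 1) = formThree (oddIdx m) (Jmat F m) 1 := by
  refine Matrix.ext ?_
  simp only [forall_three (oddIdx m)]
  refine ⟨fun i => ⟨fun j => ?_, fun j => ?_, fun j => ?_⟩,
    fun i => ⟨fun j => ?_, fun j => ?_, fun j => ?_⟩,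
    fun i => ⟨fun j => ?_, fun j => ?_, fun j => ?_⟩⟩
  all_goals
    simp only [Jmat, Matrix.of_apply, fstIdx_oddIdx, midIdx_oddIdx, lstIdx_oddIdx]
    simp only [formThree, fstIdx, midIdx, lstIdx, Matrix.submatrix_apply, Equiv.symm_apply_apply,
      Matrix.fromBlocks_apply₁₁, Matrix.fromBlocks_apply₁₂, Matrix.fromBlocks_apply₂₁,
      Matrix.fromBlocks_apply₂₂, Matrix.fromCols_apply_inl, Matrix.fromCols_apply_inr,
      Matrix.fromRows_apply_inl, Matrix.fromRows_apply_inr, Matrix.zero_apply, Matrix.of_apply,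
      Matrix.one_apply, eq_iff_true_of_subsingleton, if_true]
    try have h1 := i.isLt
    try have h2 := j.isLt
    split_ifs <;> first | rfl | omega

lemma lnMat_eq (a : Matrix (Fin m) (Fin m) F) :
    lnMat F m a = upThree (oddIdx m) a 0 0 0 (aStar F m a) := by
  refine Matrix.ext ?_
  simp only [forall_three (oddIdx m)]
  refine ⟨fun i => ⟨fun j => ?_, fun j => ?_, fun j => ?_⟩,
    fun i => ⟨fun j => ?_, fun j => ?_, fun j => ?_⟩,
    fun i => ⟨fun j => ?_, fun j => ?_, fun j => ?_⟩⟩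
  all_goals
    have h1 (k : Fin m) : ¬ m + 1 + (k : ℕ) < m := by omega
    have h2 (k : Fin m) : m + 1 + (k : ℕ) ≠ m := by omega
    have h3 (k : Fin m) : m ≠ m + 1 + (k : ℕ) := by omega
    have h4 (k : Fin m) : ¬ m < (k : ℕ) := by omega
    have h5 (k : Fin m) : m ≠ (k : ℕ) := by omega
    simp only [lnMat, Matrix.of_apply, fstIdx_oddIdx, midIdx_oddIdx, lstIdx_oddIdx, Fin.ext_iff]
    simp [upThree, fstIdx, midIdx, lstIdx, Matrix.one_apply, h1, h2, h3, h4, h5,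
      eq_iff_true_of_subsingleton]

lemma lnMat_mem {a : Matrix (Fin m) (Fin m) F} (ha : IsUnit a.det) :
    lnMat F m a ∈ SOset F (2 * m + 1) (Jmat F (2 * m + 1)) := by
  rw [lnMat_eq]
  refine ⟨by rw [det_upThree, det_mul_det_aStar ha], ?_⟩
  rw [Jmat_odd]
  exact upThree_isometry _ transpose_Jmat Matrix.transpose_one (transpose_mul_Jmat_mul_aStar ha)
    (by simp) (by simp)

lemma blkSiegel_fst (i : Fin m) : blkSiegel m (fstIdx (oddIdx m) i : Fin (2 * m + 1)) = 0 := by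
  rw [blkSiegel, fstIdx_oddIdx, if_pos i.isLt]

lemma blkSiegel_mid (i : Fin 1) : blkSiegel m (midIdx (oddIdx m) i : Fin (2 * m + 1)) = 1 := by
  rw [blkSiegel, midIdx_oddIdx, if_neg (lt_irrefl m), if_pos rfl]

lemma blkSiegel_lst (i : Fin m) : blkSiegel m (lstIdx (oddIdx m) i : Fin (2 * m + 1)) = 2 := by
  rw [blkSiegel, lstIdx_oddIdx, if_neg (by omega), if_neg (by omega)]

lemma mem_VnSet_iff {u : Matrix (Fin (2 * m + 1)) (Fin (2 * m + 1)) F} :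
    u ∈ VnSet F m ↔ u ∈ SOset F (2 * m + 1) (Jmat F (2 * m + 1)) ∧
      ∃ y z y', u = upThree (oddIdx m) 1 y z y' 1 := by
  refine and_congr_right fun _ => ?_
  constructor
  · intro h
    refine ⟨u.submatrix (fstIdx (oddIdx m)) (midIdx (oddIdx m)),
      u.submatrix (fstIdx (oddIdx m)) (lstIdx (oddIdx m)),
      u.submatrix (midIdx (oddIdx m)) (lstIdx (oddIdx m)), ?_⟩
    refine Matrix.ext ?_
    simp only [forall_three (oddIdx m)]
    refine ⟨fun i => ⟨fun j => ?_, fun j => ?_, fun j => ?_⟩,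
      fun i => ⟨fun j => ?_, fun j => ?_, fun j => ?_⟩,
      fun i => ⟨fun j => ?_, fun j => ?_, fun j => ?_⟩⟩
    case refine_2 | refine_3 | refine_6 => simp [upThree, fstIdx, midIdx, lstIdx]
    all_goals
      rw [h _ _ (by simp only [blkSiegel_fst, blkSiegel_mid, blkSiegel_lst]; norm_num)]
      simp [upThree, fstIdx, midIdx, lstIdx, Matrix.one_apply]
  · rintro ⟨y, z, y', rfl⟩
    simp only [forall_three (oddIdx m)]
    refine ⟨fun i => ⟨fun j => ?_, fun j => ?_, fun j => ?_⟩,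
      fun i => ⟨fun j => ?_, fun j => ?_, fun j => ?_⟩,
      fun i => ⟨fun j => ?_, fun j => ?_, fun j => ?_⟩⟩
    all_goals
      simp only [blkSiegel_fst, blkSiegel_mid, blkSiegel_lst]
      norm_num
      try simp [upThree, fstIdx, midIdx, lstIdx, Matrix.one_apply]

end OddSide

section Intertwining

variable {F} {m : ℕ}

lemma wnOddMat_mul {μ : Type*} (k : Matrix (Fin (2 * m + 1)) μ F) :
    (wnOddMat F m * k).submatrix (fstIdx (oddIdx m)) id = k.submatrix (lstIdx (oddIdx m)) id ∧
    (wnOddMat F m * k).submatrix (midIdx (oddIdx m)) id =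
      (-1 : F) ^ m • k.submatrix (midIdx (oddIdx m)) id ∧
    (wnOddMat F m * k).submatrix (lstIdx (oddIdx m)) id = k.submatrix (fstIdx (oddIdx m)) id := by
  have hrow (i i' : Fin (2 * m + 1)) (c : F)
      (h : ∀ j, wnOddMat F m i j = if j = i' then c else 0) (j : μ) :
      (wnOddMat F m * k) i j = c * k i' j := by
    simp [Matrix.mul_apply, h]
  refine ⟨?_, ?_, ?_⟩ <;> ext i j <;> simp only [Matrix.submatrix_apply, id_eq, Matrix.smul_apply,
    smul_eq_mul]
  · rw [hrow _ (lstIdx (oddIdx m) i) 1, one_mul]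
    intro j
    simp only [wnOddMat, Matrix.of_apply, fstIdx_oddIdx, Fin.ext_iff, lstIdx_oddIdx]
    rw [if_pos i.isLt]
    congr 1
    simp only [eq_iff_iff]
    omega
  · rw [hrow _ (midIdx (oddIdx m) i) ((-1) ^ m)]
    intro j
    simp only [wnOddMat, Matrix.of_apply, midIdx_oddIdx, Fin.ext_iff]
    rw [if_neg (lt_irrefl m), if_pos trivial]
    congr 1
    simp only [eq_iff_iff]
    omega
  · rw [hrow _ (fstIdx (oddIdx m) i) 1, one_mul]
    intro j
    simp only [wnOddMat, Matrix.of_apply, fstIdx_oddIdx, Fin.ext_iff, lstIdx_oddIdx]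
    rw [if_neg (by omega), if_neg (by omega)]
    congr 1
    simp only [eq_iff_iff]
    omega

lemma det_fromBlocks_swap :
    (Matrix.fromBlocks 0 1 1 0 : Matrix (Fin m ⊕ Fin m) (Fin m ⊕ Fin m) F).det = (-1) ^ m := by
  have h : (Matrix.fromBlocks 0 1 1 0 : Matrix (Fin m ⊕ Fin m) (Fin m ⊕ Fin m) F)
      * Matrix.fromBlocks 1 0 1 1 = Matrix.fromBlocks 1 1 1 0 := by
    simp [Matrix.fromBlocks_multiply]
  have h2 := congrArg Matrix.det h
  rw [Matrix.det_mul, Matrix.det_fromBlocks_zero₁₂, Matrix.det_fromBlocks_one₁₁] at h2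
  simpa [Matrix.det_neg] using h2

lemma wnOddMat_mem : wnOddMat F m ∈ SOset F (2 * m + 1) (Jmat F (2 * m + 1)) := by
  obtain ⟨h1, h2, h3⟩ := wnOddMat_mul (1 : Matrix (Fin (2 * m + 1)) (Fin (2 * m + 1)) F)
  rw [Matrix.mul_one] at h1 h2 h3
  constructor
  · let e : (Fin m ⊕ Fin m) ⊕ Fin 1 ≃ Fin (2 * m + 1) :=
      (((Equiv.sumAssoc _ _ _).trans
        (Equiv.sumCongr (Equiv.refl _) (Equiv.sumComm _ _)))).trans (oddIdx m)
    have key : (wnOddMat F m).submatrix e e =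
        Matrix.fromBlocks (Matrix.fromBlocks 0 1 1 0) 0 0 ((-1 : F) ^ m • 1) := by
      ext i j
      have e1 (i : Fin m) (j) : wnOddMat F m (e (.inl (.inl i))) j =
        (1 : Matrix _ _ F) (e (.inl (.inr i))) j := congrFun (congrFun h1 i) j
      have e2 (i : Fin 1) (j) : wnOddMat F m (e (.inr i)) j =
        (-1) ^ m * (1 : Matrix _ _ F) (e (.inr i)) j := congrFun (congrFun h2 i) j
      have e3 (i : Fin m) (j) : wnOddMat F m (e (.inl (.inr i))) j =
        (1 : Matrix _ _ F) (e (.inl (.inl i))) j := congrFun (congrFun h3 i) j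
      rcases i with (i | i) | i <;> rcases j with (j | j) | j <;>
        simp [e1, e2, e3, Matrix.one_apply]
    rw [← Matrix.det_submatrix_equiv_self e, key, Matrix.det_fromBlocks_zero₂₁,
      det_fromBlocks_swap]
    simp [← mul_pow]
  · rw [Jmat_odd, form_apply_three, h1, h2, h3]
    have := form_apply_three (oddIdx m) (Jmat F m) (1 : Matrix (Fin 1) (Fin 1) F)
      (1 : Matrix (Fin (2 * m + 1)) (Fin (2 * m + 1)) F)
      (1 : Matrix (Fin (2 * m + 1)) (Fin (2 * m + 1)) F)
    rw [Matrix.transpose_one, Matrix.one_mul, Matrix.mul_one] at this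
    rw [this]
    simp only [Matrix.transpose_smul, Matrix.smul_mul, Matrix.mul_smul, smul_smul, ← mul_pow]
    simp only [mul_neg, mul_one, neg_neg, one_pow, one_smul]
    abel

variable {W : Type*} [AddCommGroup W] [Module ℂ W] (τ : Representation ℂ (GL (Fin m) F) W)

lemma tauApp_coe (a : GL (Fin m) F) : tauApp F m τ (a : Matrix (Fin m) (Fin m) F) = τ a := by
  have h : ∃ g : GL (Fin m) F, (g : Matrix (Fin m) (Fin m) F) = a := ⟨a, rfl⟩
  rw [tauApp, matFun, dif_pos h]
  exact congrArg τ (Units.ext h.choose_spec)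

lemma tauApp_of_not_isUnit {a : Matrix (Fin m) (Fin m) F} (ha : ¬ IsUnit a) :
    tauApp F m τ a = 0 := by
  rw [tauApp, matFun, dif_neg]
  exact fun ⟨g, hg⟩ => ha ⟨g, hg⟩

lemma tauApp_mul (a : GL (Fin m) F) (b : Matrix (Fin m) (Fin m) F) (v : W) :
    tauApp F m τ ((a : Matrix (Fin m) (Fin m) F) * b) v = τ a (tauApp F m τ b v) := by
  by_cases hb : IsUnit b
  · obtain ⟨b, rfl⟩ := hb
    rw [← Units.val_mul, tauApp_coe, tauApp_coe, map_mul]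
    rfl
  · rw [tauApp_of_not_isUnit τ hb, tauApp_of_not_isUnit τ (by rwa [Units.isUnit_units_mul])]
    simp

open Classical in
/-- The section of the induced space supported on the Siegel parabolic with value `v`. -/
def siegelSection (v : W) : Matrix (Fin (2 * m + 1)) (Fin (2 * m + 1)) F → W := fun g =>
  if g ∈ SOset F (2 * m + 1) (Jmat F (2 * m + 1)) ∧
      g.submatrix (midIdx (oddIdx m)) (fstIdx (oddIdx m)) = 0 ∧
      g.submatrix (lstIdx (oddIdx m)) (fstIdx (oddIdx m)) = 0 then
    tauApp F m τ (g.submatrix (fstIdx (oddIdx m)) (fstIdx (oddIdx m))) v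
  else 0

lemma isUnit_aStar (a : GL (Fin m) F) : IsUnit (aStar F m (a : Matrix (Fin m) (Fin m) F)) := by
  rw [Matrix.isUnit_iff_isUnit_det]
  exact IsUnit.of_mul_eq_one_right _
    (det_mul_det_aStar ((Matrix.isUnit_iff_isUnit_det _).1 a.isUnit))

lemma siegelSection_mem (v : W) : siegelSection τ v ∈ IndTau F m τ := by
  refine ⟨fun g hg => if_neg fun h => hg h.1, fun a u hu g => ?_⟩
  obtain ⟨huS, y, z, y', rfl⟩ := mem_VnSet_iff.1 hu
  have hl := lnMat_mem ((Matrix.isUnit_iff_isUnit_det _).1 a.isUnit)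
  set e := oddIdx m with he
  set k := g.submatrix id (fstIdx e) with hk
  obtain ⟨h1, h2, h3⟩ := upThree_mul e 1 y z y' 1 k
  obtain ⟨h1', h2', h3'⟩ := upThree_mul e (a : Matrix (Fin m) (Fin m) F) 0 0 0
    (aStar F m (a : Matrix (Fin m) (Fin m) F)) (upThree e 1 y z y' 1 * k)
  have hs : (lnMat F m (a : Matrix (Fin m) (Fin m) F) * upThree e 1 y z y' 1 * g).submatrix
      id (fstIdx e) = upThree e (a : Matrix (Fin m) (Fin m) F) 0 0 0
    (aStar F m (a : Matrix (Fin m) (Fin m) F)) * (upThree e 1 y z y' 1 * k) := by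
    rw [lnMat_eq, Matrix.mul_assoc]
    rfl
  have hf {γ : Type} (f : γ → Fin (2 * m + 1)) :
      (lnMat F m (a : Matrix (Fin m) (Fin m) F) * upThree e 1 y z y' 1 * g).submatrix f (fstIdx e)
        = (upThree e (a : Matrix (Fin m) (Fin m) F) 0 0 0
          (aStar F m (a : Matrix (Fin m) (Fin m) F)) * (upThree e 1 y z y' 1 * k)).submatrix f id := by
    rw [← hs]
    rfl
  have hg {γ : Type} (f : γ → Fin (2 * m + 1)) :
      g.submatrix f (fstIdx e) = k.submatrix f id := rfl
  have hiff : aStar F m (a : Matrix (Fin m) (Fin m) F) * k.submatrix (lstIdx e) id = 0 ↔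
      k.submatrix (lstIdx e) id = 0 := by
    refine ⟨fun h => ?_, fun h => by rw [h, Matrix.mul_zero]⟩
    obtain ⟨c, hc⟩ := isUnit_aStar a
    rw [← hc] at h
    simpa using congrArg (fun M => ((c⁻¹ : GL (Fin m) F) : Matrix (Fin m) (Fin m) F) * M) h
  have hcond : (lnMat F m (a : Matrix (Fin m) (Fin m) F) * upThree e 1 y z y' 1 * g ∈
        SOset F (2 * m + 1) (Jmat F (2 * m + 1)) ∧
      (lnMat F m (a : Matrix (Fin m) (Fin m) F) * upThree e 1 y z y' 1 * g).submatrix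
        (midIdx e) (fstIdx e) = 0 ∧
      (lnMat F m (a : Matrix (Fin m) (Fin m) F) * upThree e 1 y z y' 1 * g).submatrix
        (lstIdx e) (fstIdx e) = 0) ↔
      g ∈ SOset F (2 * m + 1) (Jmat F (2 * m + 1)) ∧
        g.submatrix (midIdx e) (fstIdx e) = 0 ∧ g.submatrix (lstIdx e) (fstIdx e) = 0 := by
    rw [SOset_mul_iff (SOset_mul hl huS), hf, hf, hg, hg, h2', h3', h2, h3]
    simp only [Matrix.one_mul, Matrix.zero_mul, add_zero]
    rw [hiff]
    refine and_congr_right fun _ => and_congr_left fun h => ?_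
    rw [h, Matrix.mul_zero, add_zero]
  by_cases hc : g ∈ SOset F (2 * m + 1) (Jmat F (2 * m + 1)) ∧
      g.submatrix (midIdx e) (fstIdx e) = 0 ∧ g.submatrix (lstIdx e) (fstIdx e) = 0
  · rw [siegelSection, siegelSection, if_pos hc, if_pos (hcond.2 hc), hf, h1', h1]
    obtain ⟨-, hc2, hc3⟩ := hc
    rw [hg] at hc2 hc3
    rw [hc2, hc3]
    simp only [Matrix.one_mul, Matrix.zero_mul, Matrix.mul_zero, add_zero]
    exact tauApp_mul τ a _ v
  · rw [siegelSection, siegelSection, if_neg hc, if_neg fun h => hc (hcond.1 h), map_zero]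

end Intertwining

section MOpEvaluation

variable {F}

lemma eq_zero_of_conj {α : Type*} [Fintype α] [DecidableEq α] {K M : Matrix α α F}
    (hK : IsUnit K) (h : Kᵀ * M * K = 0) : M = 0 := by
  have hK' : IsUnit Kᵀ := (Matrix.isUnit_transpose K).2 hK
  have h1 : (Kᵀ * M) * K = 0 * K := by rw [h, Matrix.zero_mul]
  have h2 : Kᵀ * M = Kᵀ * 0 := by rw [hK.mul_left_injective h1, Matrix.mul_zero]
  exact hK'.mul_right_injective h2

lemma exists_upThree_move {α β ι : Type*} [Fintype α] [Fintype β] [Fintype ι] [DecidableEq α]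
    [DecidableEq β] [DecidableEq ι] (e : α ⊕ β ⊕ α ≃ ι) {J : Matrix α α F} {S : Matrix β β F}
    (hJ : Jᵀ = J) (hJJ : J * J = 1) (hS : Sᵀ = S) {K₁ L₁ K₃ : Matrix α α F}
    {K₂ L₂ : Matrix β α F} (hK : IsUnit K₃)
    (h : L₁ᵀ * J * K₃ + L₂ᵀ * S * L₂ + K₃ᵀ * J * L₁ =
      K₁ᵀ * J * K₃ + K₂ᵀ * S * K₂ + K₃ᵀ * J * K₁) :
    ∃ y z y', y = -(J * y'ᵀ * S) ∧ K₂ + y' * K₃ = L₂ ∧ K₁ + y * K₂ + z * K₃ = L₁ ∧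
      (upThree e 1 y z y' 1)ᵀ * formThree e J S * upThree e 1 y z y' 1 = formThree e J S := by
  have hinv : K₃⁻¹ * K₃ = 1 := Matrix.nonsing_inv_mul _ ((Matrix.isUnit_iff_isUnit_det _).1 hK)
  set y' := (L₂ - K₂) * K₃⁻¹ with hy'
  set y := -(J * y'ᵀ * S) with hy
  set z := (L₁ - K₁ - y * K₂) * K₃⁻¹ with hz
  have e1 : y' * K₃ = L₂ - K₂ := by rw [hy', Matrix.mul_assoc, hinv, Matrix.mul_one]
  have e2 : z * K₃ = L₁ - K₁ - y * K₂ := by rw [hz, Matrix.mul_assoc, hinv, Matrix.mul_one]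
  have e1' : K₃ᵀ * y'ᵀ = L₂ᵀ - K₂ᵀ := by
    rw [← Matrix.transpose_mul, e1, Matrix.transpose_sub]
  have e2' : K₃ᵀ * zᵀ = L₁ᵀ - K₁ᵀ - K₂ᵀ * yᵀ := by
    rw [← Matrix.transpose_mul, e2]
    simp
  have hyt : yᵀ * J = -(S * y') := by
    rw [hy]
    simp only [Matrix.transpose_neg, Matrix.transpose_mul, Matrix.transpose_transpose, hJ, hS,
      Matrix.neg_mul, Matrix.mul_assoc, hJJ, Matrix.mul_one]
  have hyJ : J * y = -(y'ᵀ * S) := by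
    rw [hy, Matrix.mul_neg, ← Matrix.mul_assoc, ← Matrix.mul_assoc, hJJ, Matrix.one_mul]
  refine ⟨y, z, y', rfl, by rw [e1]; abel, by rw [e2]; abel,
    upThree_isometry e hJ hS (by simp) (by rw [Matrix.mul_one, hyt, neg_add_cancel]) ?_⟩
  simp only [Matrix.mul_one, Matrix.transpose_one, Matrix.one_mul]
  refine eq_zero_of_conj hK ?_
  have expand : K₃ᵀ * (zᵀ * J + y'ᵀ * S * y' + J * z) * K₃ =
      (K₃ᵀ * zᵀ) * J * K₃ + (K₃ᵀ * y'ᵀ) * S * (y' * K₃) + K₃ᵀ * J * (z * K₃) := by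
    simp only [Matrix.mul_add, Matrix.add_mul, Matrix.mul_assoc]
  rw [expand, e1, e2, e1', e2']
  have t1 : (K₂ᵀ * yᵀ) * J * K₃ = -(K₂ᵀ * S * (L₂ - K₂)) := by
    rw [Matrix.mul_assoc K₂ᵀ, hyt, ← e1]
    simp only [Matrix.mul_neg, Matrix.neg_mul, Matrix.mul_assoc]
  have t2 : K₃ᵀ * J * (y * K₂) = -((L₂ᵀ - K₂ᵀ) * S * K₂) := by
    rw [← e1', Matrix.mul_assoc, ← Matrix.mul_assoc J, hyJ]
    simp only [Matrix.mul_neg, Matrix.neg_mul, Matrix.mul_assoc]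
  have split : (L₁ᵀ - K₁ᵀ - K₂ᵀ * yᵀ) * J * K₃ = L₁ᵀ * J * K₃ - K₁ᵀ * J * K₃
      - (K₂ᵀ * yᵀ) * J * K₃ := by simp only [Matrix.sub_mul]
  have split2 : K₃ᵀ * J * (L₁ - K₁ - y * K₂) = K₃ᵀ * J * L₁ - K₃ᵀ * J * K₁
      - K₃ᵀ * J * (y * K₂) := by simp only [Matrix.mul_sub]
  rw [split, split2, t1, t2]
  simp only [Matrix.mul_sub, Matrix.sub_mul]
  rw [← sub_eq_zero] at h
  rw [← h]
  abel

variable {m : ℕ} {W : Type*} [AddCommGroup W] [Module ℂ W]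
  (τ : Representation ℂ (GL (Fin m) F) W)

lemma first_cols_wnOddMat_mul (y z y') (k : Matrix (Fin (2 * m + 1)) (Fin (2 * m + 1)) F) :
    let K₁ := k.submatrix (fstIdx (oddIdx m)) (fstIdx (oddIdx m))
    let K₂ := k.submatrix (midIdx (oddIdx m)) (fstIdx (oddIdx m))
    let K₃ := k.submatrix (lstIdx (oddIdx m)) (fstIdx (oddIdx m))
    let g := wnOddMat F m * upThree (oddIdx m) 1 y z y' 1 * k
    g.submatrix (fstIdx (oddIdx m)) (fstIdx (oddIdx m)) = K₃ ∧
    g.submatrix (midIdx (oddIdx m)) (fstIdx (oddIdx m)) = (-1 : F) ^ m • (K₂ + y' * K₃) ∧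
    g.submatrix (lstIdx (oddIdx m)) (fstIdx (oddIdx m)) = K₁ + y * K₂ + z * K₃ := by
  intro K₁ K₂ K₃ g
  set e := oddIdx m with he
  have hg {γ : Type} (f : γ → Fin (2 * m + 1)) : g.submatrix f (fstIdx e) =
      (wnOddMat F m * (upThree e 1 y z y' 1 * k.submatrix id (fstIdx e))).submatrix f id := by
    simp only [g, Matrix.mul_assoc]
    rfl
  obtain ⟨h1, h2, h3⟩ := upThree_mul e 1 y z y' 1 (k.submatrix id (fstIdx e))
  obtain ⟨h1', h2', h3'⟩ := wnOddMat_mul (upThree e 1 y z y' 1 * k.submatrix id (fstIdx e))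
  rw [hg, hg, hg, h1', h2', h3', h1, h2, h3]
  simp only [Matrix.one_mul, Matrix.submatrix_submatrix, Function.comp_id, Function.id_comp]
  exact ⟨rfl, rfl, rfl⟩

lemma MOp_siegelSection (Λ : W →ₗ[ℂ] ℂ) (v : W) {k : Matrix (Fin (2 * m + 1)) (Fin (2 * m + 1)) F}
    (hk : k ∈ SOset F (2 * m + 1) (Jmat F (2 * m + 1))) :
    MOp F m (fun g a => Λ (tauApp F m τ a (siegelSection τ v g))) k 1 =
      Λ (tauApp F m τ
        (dnMat F m * k.submatrix (lstIdx (oddIdx m)) (fstIdx (oddIdx m))) v) := by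
  set e := oddIdx m with he
  set K₁ := k.submatrix (fstIdx e) (fstIdx e) with hK₁
  set K₂ := k.submatrix (midIdx e) (fstIdx e) with hK₂
  set K₃ := k.submatrix (lstIdx e) (fstIdx e) with hK₃
  let d : GL (Fin m) F := ⟨dnMat F m, dnMat F m, dnMat_sq, dnMat_sq⟩
  have hd : dnMat F m * aStar F m 1 = (d : Matrix (Fin m) (Fin m) F) := by
    rw [aStar_one, Matrix.mul_one]
  have hdK : tauApp F m τ (dnMat F m * K₃) v = τ d (tauApp F m τ K₃ v) := tauApp_mul τ d K₃ v
  simp only [MOp, hd, tauApp_coe]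
  rw [hdK]
  have hcond (y z y') (hu : upThree e 1 y z y' 1 ∈ SOset F (2 * m + 1) (Jmat F (2 * m + 1))) :
      (wnOddMat F m * upThree e 1 y z y' 1 * k ∈ SOset F (2 * m + 1) (Jmat F (2 * m + 1)) ∧
      (wnOddMat F m * upThree e 1 y z y' 1 * k).submatrix (midIdx e) (fstIdx e) = 0 ∧
      (wnOddMat F m * upThree e 1 y z y' 1 * k).submatrix (lstIdx e) (fstIdx e) = 0) ↔
      K₂ + y' * K₃ = 0 ∧ K₁ + y * K₂ + z * K₃ = 0 := by
    obtain ⟨-, h2, h3⟩ := first_cols_wnOddMat_mul y z y' k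
    rw [SOset_mul_iff (SOset_mul wnOddMat_mem hu), h2, h3]
    simp only [hk, true_and]
    rw [smul_eq_zero_iff_right (pow_ne_zero _ (neg_ne_zero.2 one_ne_zero))]
  have hval (y z y') (hu : upThree e 1 y z y' 1 ∈ SOset F (2 * m + 1) (Jmat F (2 * m + 1)))
      (hc : K₂ + y' * K₃ = 0 ∧ K₁ + y * K₂ + z * K₃ = 0) :
      siegelSection τ v (wnOddMat F m * upThree e 1 y z y' 1 * k) = tauApp F m τ K₃ v := by
    rw [siegelSection, if_pos ((hcond y z y' hu).2 hc), (first_cols_wnOddMat_mul y z y' k).1]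
  have hval0 (y z y') (hu : upThree e 1 y z y' 1 ∈ SOset F (2 * m + 1) (Jmat F (2 * m + 1)))
      (hc : ¬(K₂ + y' * K₃ = 0 ∧ K₁ + y * K₂ + z * K₃ = 0)) :
      siegelSection τ v (wnOddMat F m * upThree e 1 y z y' 1 * k) = 0 := by
    rw [siegelSection, if_neg (fun h => hc ((hcond y z y' hu).1 h))]
  by_cases hunit : IsUnit K₃
  · have hiso : K₁ᵀ * Jmat F m * K₃ + K₂ᵀ * (1 : Matrix (Fin 1) (Fin 1) F) * K₂
        + K₃ᵀ * Jmat F m * K₁ = 0 := by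
      have h1 := form_submatrix_three e (Jmat F m) 1 k k (fstIdx e) (fstIdx e)
      rw [← Jmat_odd, hk.2, Jmat_odd] at h1
      rw [hK₁, hK₂, hK₃, ← h1]
      ext i j
      simp [formThree, fstIdx, ← he]
    obtain ⟨y, z, y', hy, h2, h1, hform⟩ := exists_upThree_move e (transpose_Jmat (F := F) (m := m))
      Jmat_sq (Matrix.transpose_one (n := Fin 1)) (K₁ := K₁) (K₂ := K₂) (L₁ := 0) (L₂ := 0) hunit
      (by rw [hiso]; simp)
    have huSO : upThree e 1 y z y' 1 ∈ SOset F (2 * m + 1) (Jmat F (2 * m + 1)) :=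
      ⟨by simp [det_upThree], by rw [Jmat_odd]; exact hform⟩
    have huV : upThree e 1 y z y' 1 ∈ VnSet F m := mem_VnSet_iff.2 ⟨huSO, y, z, y', rfl⟩
    rw [finsum_mem_def, finsum_eq_single _ (upThree e 1 y z y' 1), Set.indicator_of_mem huV,
      hval y z y' huSO ⟨h2, h1⟩]
    intro u hne
    by_cases hu : u ∈ VnSet F m
    · rw [Set.indicator_of_mem hu]
      obtain ⟨hus, Y, Z, Y', rfl⟩ := mem_VnSet_iff.1 hu
      rw [hval0 Y Z Y' hus, map_zero, map_zero]
      rintro ⟨h2', h1'⟩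
      apply hne
      have a1 : Y' = y' := by
        have h : Y' * K₃ = y' * K₃ := add_left_cancel (h2'.trans h2.symm)
        have h' := congrArg (fun M => M * K₃⁻¹) h
        simpa only [Matrix.mul_assoc,
          Matrix.mul_nonsing_inv _ ((Matrix.isUnit_iff_isUnit_det _).1 hunit), Matrix.mul_one]
          using h'
      have a2 : Y = -(Jmat F m * Y'ᵀ * (1 : Matrix (Fin 1) (Fin 1) F)) := by
        have h3 := form_submatrix_three e (Jmat F m) 1 (upThree e 1 Y Z Y' 1)
          (upThree e 1 Y Z Y' 1) (midIdx e) (lstIdx e)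
        rw [← Jmat_odd, hus.2, Jmat_odd, upThree_fst_mid, upThree_mid_mid, upThree_lst_mid,
          upThree_lst_lst, upThree_mid_lst] at h3
        have h4 : (formThree e (Jmat F m) 1).submatrix (midIdx e) (lstIdx e) = 0 := by
          ext i j
          simp [formThree, midIdx, lstIdx]
        rw [h4] at h3
        simp only [Matrix.mul_one, Matrix.transpose_one, Matrix.transpose_zero, Matrix.zero_mul,
          add_zero, Matrix.one_mul] at h3
        have h5 := congrArg Matrix.transpose (eq_neg_of_add_eq_zero_left h3.symm)
        rw [Matrix.transpose_mul, Matrix.transpose_transpose, transpose_Jmat,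
          Matrix.transpose_neg] at h5
        calc Y = Jmat F m * (Jmat F m * Y) := by rw [← Matrix.mul_assoc, Jmat_sq, Matrix.one_mul]
          _ = _ := by rw [h5, Matrix.mul_neg, Matrix.mul_one]
      have a3 : Y = y := by rw [a2, a1, hy]
      have a4 : Z = z := by
        rw [a3] at h1'
        have h : Z * K₃ = z * K₃ := add_left_cancel (h1'.trans h1.symm)
        exact hunit.mul_left_injective h
      rw [a1, a3, a4]
    · rw [Set.indicator_of_notMem hu]
  · rw [tauApp_of_not_isUnit τ hunit, LinearMap.zero_apply, map_zero, map_zero]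
    refine finsum_mem_eq_zero_of_forall_eq_zero fun u hu => ?_
    obtain ⟨hus, Y, Z, Y', rfl⟩ := mem_VnSet_iff.1 hu
    by_cases hc : K₂ + Y' * K₃ = 0 ∧ K₁ + Y * K₂ + Z * K₃ = 0
    · rw [hval Y Z Y' hus hc, tauApp_of_not_isUnit τ hunit]
      simp
    · rw [hval0 Y Z Y' hus hc, map_zero, map_zero]

end MOpEvaluation

section Embedding

variable {F}

lemma Jmat_finThree {a b N : ℕ} (h : a + b + a = N) :
    Jmat F N = formThree (finThree a b N h) (Jmat F a) (Jmat F b) := by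
  refine Matrix.ext ?_
  simp only [forall_three (finThree a b N h)]
  refine ⟨fun i => ⟨fun j => ?_, fun j => ?_, fun j => ?_⟩,
    fun i => ⟨fun j => ?_, fun j => ?_, fun j => ?_⟩,
    fun i => ⟨fun j => ?_, fun j => ?_, fun j => ?_⟩⟩
  all_goals
    simp only [Jmat, Matrix.of_apply, fstIdx_finThree, midIdx_finThree, lstIdx_finThree]
    simp only [formThree, fstIdx, midIdx, lstIdx, Matrix.submatrix_apply, Equiv.symm_apply_apply,
      Matrix.fromBlocks_apply₁₁, Matrix.fromBlocks_apply₁₂, Matrix.fromBlocks_apply₂₁,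
      Matrix.fromBlocks_apply₂₂, Matrix.fromCols_apply_inl, Matrix.fromCols_apply_inr,
      Matrix.fromRows_apply_inl, Matrix.fromRows_apply_inr, Matrix.zero_apply, Matrix.of_apply]
    have h1 := i.isLt
    have h2 := j.isLt
    split_ifs <;> first | rfl | omega

/-- Splitting of the indices of `SO_{2n+2}`. -/
def evenIdx (n : ℕ) : Fin n ⊕ Fin 2 ⊕ Fin n ≃ Fin (2 * (n + 1)) :=
  finThree n 2 (2 * (n + 1)) (by omega)

/-- Splitting of the indices of `SO_{2n+3}` with a middle block of size three. -/
def oddIdx₃ (n : ℕ) : Fin n ⊕ Fin 3 ⊕ Fin n ≃ Fin (2 * (n + 1) + 1) :=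
  finThree n 3 (2 * (n + 1) + 1) (by omega)

variable {n : ℕ}

lemma fstIdx_evenIdx (i : Fin n) : ((fstIdx (evenIdx n) i : Fin (2 * (n + 1))) : ℕ) = i :=
  fstIdx_finThree _ i

lemma midIdx_evenIdx (i : Fin 2) : ((midIdx (evenIdx n) i : Fin (2 * (n + 1))) : ℕ) = n + i :=
  midIdx_finThree _ i

lemma lstIdx_evenIdx (i : Fin n) : ((lstIdx (evenIdx n) i : Fin (2 * (n + 1))) : ℕ) = n + 2 + i :=
  lstIdx_finThree _ i

lemma fstIdx_oddIdx₃ (i : Fin n) : ((fstIdx (oddIdx₃ n) i : Fin (2 * (n + 1) + 1)) : ℕ) = i :=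
  fstIdx_finThree _ i

lemma midIdx_oddIdx₃ (i : Fin 3) : ((midIdx (oddIdx₃ n) i : Fin (2 * (n + 1) + 1)) : ℕ) = n + i :=
  midIdx_finThree _ i

lemma lstIdx_oddIdx₃ (i : Fin n) :
    ((lstIdx (oddIdx₃ n) i : Fin (2 * (n + 1) + 1)) : ℕ) = n + 3 + i :=
  lstIdx_finThree _ i

lemma Dmat_evenIdx (ρ : F) (i j : Fin (2 * (n + 1))) : Jrho F (n + 1) ρ i j =
    Dmat F (n + 1) ρ i j.rev := by
  rw [Jrho, mul_Jmat]
  rfl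

/-- The form on the middle plane. -/
def midForm (ρ : F) : Matrix (Fin 2) (Fin 2) F := Matrix.diagonal ![1, -ρ]

lemma Jrho_eq (ρ : F) :
    Jrho F (n + 1) ρ = formThree (evenIdx n) (Jmat F n) (midForm ρ) := by
  refine Matrix.ext ?_
  simp only [forall_three (evenIdx n), Dmat_evenIdx]
  refine ⟨fun i => ⟨fun j => ?_, fun j => ?_, fun j => ?_⟩,
    fun i => ⟨fun j => ?_, fun j => ?_, fun j => ?_⟩,
    fun i => ⟨fun j => ?_, fun j => ?_, fun j => ?_⟩⟩
  all_goals
    simp only [Dmat, Matrix.of_apply, Fin.ext_iff, Fin.val_rev, fstIdx_evenIdx, midIdx_evenIdx,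
      lstIdx_evenIdx]
    simp only [formThree, fstIdx, midIdx, lstIdx, Matrix.submatrix_apply, Equiv.symm_apply_apply,
      Matrix.fromBlocks_apply₁₁, Matrix.fromBlocks_apply₁₂, Matrix.fromBlocks_apply₂₁,
      Matrix.fromBlocks_apply₂₂, Matrix.fromCols_apply_inl, Matrix.fromCols_apply_inr,
      Matrix.fromRows_apply_inl, Matrix.fromRows_apply_inr, Matrix.zero_apply, Matrix.of_apply,
      Jmat, midForm, Matrix.diagonal_apply]
  case refine_5 =>
    fin_cases i <;> fin_cases j <;> simp <;> omega
  all_goals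
    have h1 := i.isLt
    have h2 := j.isLt
    split_ifs <;> first | rfl | omega

/-- The index map of `SO_{2n+2}` into `SO_{2n+3}` skipping the inserted position. -/
def insIdx (n : ℕ) : Fin (2 * (n + 1)) → Fin (2 * (n + 1) + 1) :=
  (⟨n + 1, by omega⟩ : Fin (2 * (n + 1) + 1)).succAbove

/-- The inserted position. -/
def insPt (n : ℕ) : Fin (2 * (n + 1) + 1) := ⟨n + 1, by omega⟩

lemma insIdx_val (i : Fin (2 * (n + 1))) :
    (insIdx n i : ℕ) = if (i : ℕ) < n + 1 then (i : ℕ) else i + 1 := by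
  simp only [insIdx, Fin.succAbove, Fin.lt_def]
  simp only [Fin.val_castSucc]
  split_ifs <;> rfl

lemma insTop_insIdx (g : Matrix (Fin (2 * (n + 1))) (Fin (2 * (n + 1))) F)
    (i j : Fin (2 * (n + 1))) : insTop F (n + 1) g (insIdx n i) (insIdx n j) = g i j := by
  have hi : ¬ (insIdx n i : ℕ) = n + 1 := by rw [insIdx_val]; split_ifs <;> omega
  have hj : ¬ (insIdx n j : ℕ) = n + 1 := by rw [insIdx_val]; split_ifs <;> omega
  simp only [insTop, Matrix.of_apply, dif_neg hi, dif_neg hj]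
  congr 1 <;> ext <;> simp only [insIdx_val] <;> split_ifs <;> omega

lemma insTop_insIdx_insPt (g : Matrix (Fin (2 * (n + 1))) (Fin (2 * (n + 1))) F)
    (i : Fin (2 * (n + 1))) : insTop F (n + 1) g (insIdx n i) (insPt n) = 0 := by
  have hi : ¬ (insIdx n i : ℕ) = n + 1 := by rw [insIdx_val]; split_ifs <;> omega
  simp [insTop, hi, insPt]

lemma insTop_insPt (g : Matrix (Fin (2 * (n + 1))) (Fin (2 * (n + 1))) F)
    (j : Fin (2 * (n + 1) + 1)) :
    insTop F (n + 1) g (insPt n) j = if j = insPt n then 1 else 0 := by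
  simp [insTop, insPt, Fin.ext_iff]

lemma sum_insIdx {M : Type*} [AddCommMonoid M] (f : Fin (2 * (n + 1) + 1) → M) :
    ∑ i, f i = f (insPt n) + ∑ i, f (insIdx n i) :=
  Fin.sum_univ_succAbove f (insPt n)

lemma det_insTop (g : Matrix (Fin (2 * (n + 1))) (Fin (2 * (n + 1))) F) :
    (insTop F (n + 1) g).det = g.det := by
  rw [Matrix.det_succ_row _ (insPt n), Finset.sum_eq_single (insPt n)]
  · rw [insTop_insPt, if_pos rfl, ← two_mul, pow_mul, neg_one_sq, one_pow, one_mul, one_mul]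
    congr 1
    ext i j
    exact insTop_insIdx g i j
  · intro j _ hj
    rw [insTop_insPt, if_neg hj, mul_zero, zero_mul]
  · simp

lemma insTop_mul_insIdx {μ : Type*} (g : Matrix (Fin (2 * (n + 1))) (Fin (2 * (n + 1))) F)
    (k : Matrix (Fin (2 * (n + 1) + 1)) μ F) :
    (insTop F (n + 1) g * k).submatrix (insIdx n) id = g * k.submatrix (insIdx n) id := by
  ext i j
  simp [Matrix.mul_apply, sum_insIdx, insTop_insIdx, insTop_insIdx_insPt]

lemma insTop_mul_insPt {μ : Type*} (g : Matrix (Fin (2 * (n + 1))) (Fin (2 * (n + 1))) F)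
    (k : Matrix (Fin (2 * (n + 1) + 1)) μ F) (j : μ) :
    (insTop F (n + 1) g * k) (insPt n) j = k (insPt n) j := by
  simp [Matrix.mul_apply, insTop_insPt]

lemma Mtop_insIdx_apply (ρ : F) (i : Fin (2 * (n + 1))) (j : Fin (2 * (n + 1) + 1)) :
    Mtop F (n + 1) ρ (insIdx n i) j =
      if (i : ℕ) = n then (if (j : ℕ) = n + 1 then 1 else 0)
      else if (i : ℕ) = n + 1 then
        (if (j : ℕ) = n then 2⁻¹ else if (j : ℕ) = n + 2 then -(2 * (ρ / 2))⁻¹ else 0)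
      else if (insIdx n i : ℕ) = j then 1 else 0 := by
  simp only [Mtop, Matrix.of_apply, insIdx_val, Fin.ext_iff]
  have := i.isLt
  split_ifs <;> first | rfl | omega

lemma Mtop_insPt_apply (ρ : F) (j : Fin (2 * (n + 1) + 1)) :
    Mtop F (n + 1) ρ (insPt n) j =
      if (j : ℕ) = n then 2⁻¹ else if (j : ℕ) = n + 2 then (2 * (ρ / 2))⁻¹ else 0 := by
  simp only [Mtop, Matrix.of_apply, insPt, Fin.ext_iff]
  split_ifs <;> first | rfl | omega

/-- The middle block of the rows of `Mtop` coming from `SO_{2n+2}`. -/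
def MtopMid (ρ : F) : Matrix (Fin 2) (Fin 3) F := !![0, 1, 0; 2⁻¹, 0, -(2 * (ρ / 2))⁻¹]

lemma Mtop_blocks (ρ : F) :
    (∀ i j, Mtop F (n + 1) ρ (insIdx n (fstIdx (evenIdx n) i)) (fstIdx (oddIdx₃ n) j) =
      if i = j then 1 else 0) ∧
    (∀ i j, Mtop F (n + 1) ρ (insIdx n (fstIdx (evenIdx n) i)) (midIdx (oddIdx₃ n) j) = 0) ∧
    (∀ i j, Mtop F (n + 1) ρ (insIdx n (fstIdx (evenIdx n) i)) (lstIdx (oddIdx₃ n) j) = 0) ∧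
    (∀ i j, Mtop F (n + 1) ρ (insIdx n (midIdx (evenIdx n) i)) (fstIdx (oddIdx₃ n) j) = 0) ∧
    (∀ i j, Mtop F (n + 1) ρ (insIdx n (midIdx (evenIdx n) i)) (midIdx (oddIdx₃ n) j) =
      MtopMid ρ i j) ∧
    (∀ i j, Mtop F (n + 1) ρ (insIdx n (midIdx (evenIdx n) i)) (lstIdx (oddIdx₃ n) j) = 0) ∧
    (∀ i j, Mtop F (n + 1) ρ (insIdx n (lstIdx (evenIdx n) i)) (fstIdx (oddIdx₃ n) j) = 0) ∧
    (∀ i j, Mtop F (n + 1) ρ (insIdx n (lstIdx (evenIdx n) i)) (midIdx (oddIdx₃ n) j) = 0) ∧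
    (∀ i j, Mtop F (n + 1) ρ (insIdx n (lstIdx (evenIdx n) i)) (lstIdx (oddIdx₃ n) j) =
      if i = j then 1 else 0) := by
  refine ⟨fun i j => ?_, fun i j => ?_, fun i j => ?_, fun i j => ?_, fun i j => ?_,
    fun i j => ?_, fun i j => ?_, fun i j => ?_, fun i j => ?_⟩
  all_goals
    simp only [Mtop_insIdx_apply, insIdx_val, fstIdx_evenIdx, midIdx_evenIdx, lstIdx_evenIdx,
      fstIdx_oddIdx₃, midIdx_oddIdx₃, lstIdx_oddIdx₃, Fin.ext_iff]
  case refine_5 => fin_cases i <;> fin_cases j <;> simp [MtopMid]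
  all_goals
    have h1 := i.isLt
    have h2 := j.isLt
    split_ifs <;> first | rfl | omega

lemma Mtop_form (ρ : F) (h2 : (2 : F) ≠ 0) (hρ : ρ ≠ 0) :
    ((Mtop F (n + 1) ρ).submatrix (insIdx n) id)ᵀ * Jrho F (n + 1) ρ *
        (Mtop F (n + 1) ρ).submatrix (insIdx n) id +
      ρ • Matrix.vecMulVec (Mtop F (n + 1) ρ (insPt n)) (Mtop F (n + 1) ρ (insPt n)) =
      Jmat F (2 * (n + 1) + 1) := by
  obtain ⟨b1, b2, b3, b4, b5, b6, b7, b8, b9⟩ := Mtop_blocks (F := F) (n := n) ρ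
  have hq1 (j) : Mtop F (n + 1) ρ (insPt n) (fstIdx (oddIdx₃ n) j) = 0 := by
    rw [Mtop_insPt_apply, fstIdx_oddIdx₃, if_neg (by omega), if_neg (by omega)]
  have hq2 (j) : Mtop F (n + 1) ρ (insPt n) (midIdx (oddIdx₃ n) j) =
      ![2⁻¹, 0, (2 * (ρ / 2))⁻¹] j := by
    rw [Mtop_insPt_apply, midIdx_oddIdx₃]
    fin_cases j <;> simp
  have hq3 (j) : Mtop F (n + 1) ρ (insPt n) (lstIdx (oddIdx₃ n) j) = 0 := by
    rw [Mtop_insPt_apply, lstIdx_oddIdx₃, if_neg (by omega), if_neg (by omega)]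
  rw [Jrho_eq, form_apply_three, Jmat_finThree (show n + 3 + n = 2 * (n + 1) + 1 by omega)]
  change _ = formThree (oddIdx₃ n) _ _
  refine Matrix.ext ?_
  simp only [forall_three (oddIdx₃ n)]
  refine ⟨fun i => ⟨fun j => ?_, fun j => ?_, fun j => ?_⟩,
    fun i => ⟨fun j => ?_, fun j => ?_, fun j => ?_⟩,
    fun i => ⟨fun j => ?_, fun j => ?_, fun j => ?_⟩⟩
  all_goals
    simp only [Matrix.add_apply, Matrix.mul_apply, Matrix.transpose_apply, Matrix.submatrix_apply,
      id_eq, b1, b2, b3, b4, b5, b6, b7, b8, b9, Matrix.smul_apply, Matrix.vecMulVec_apply, hq1,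
      hq2, hq3]
    simp only [formThree, fstIdx, midIdx, lstIdx, Matrix.submatrix_apply, Equiv.symm_apply_apply,
      Matrix.fromBlocks_apply₁₁, Matrix.fromBlocks_apply₁₂, Matrix.fromBlocks_apply₂₁,
      Matrix.fromBlocks_apply₂₂, Matrix.fromCols_apply_inl, Matrix.fromCols_apply_inr,
      Matrix.fromRows_apply_inl, Matrix.fromRows_apply_inr, Matrix.zero_apply]
  case refine_5 =>
    fin_cases i <;> fin_cases j <;>
      simp [MtopMid, midForm, Jmat, Fin.sum_univ_two, Matrix.diagonal_apply] <;>
      field_simp <;> ring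
  all_goals simp

lemma isUnit_Mtop (ρ : F) (h2 : (2 : F) ≠ 0) (hρ : ρ ≠ 0) : IsUnit (Mtop F (n + 1) ρ).det := by
  rw [isUnit_iff_ne_zero]
  intro h
  obtain ⟨v, hv, h0⟩ := Matrix.exists_mulVec_eq_zero_iff.2 h
  apply hv
  have e1 : ((Mtop F (n + 1) ρ).submatrix (insIdx n) id).mulVec v = 0 := by
    ext i
    exact congrFun h0 (insIdx n i)
  have e2 : Mtop F (n + 1) ρ (insPt n) ⬝ᵥ v = 0 := congrFun h0 (insPt n)
  have e3 : (Jmat F (2 * (n + 1) + 1)).mulVec v = 0 := by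
    rw [← Mtop_form ρ h2 hρ, Matrix.add_mulVec, ← Matrix.mulVec_mulVec, e1, Matrix.mulVec_zero,
      Matrix.smul_mulVec, Matrix.vecMulVec_mulVec, e2]
    simp
  calc v = (Jmat F (2 * (n + 1) + 1) * Jmat F (2 * (n + 1) + 1)).mulVec v := by
        rw [Jmat_sq, Matrix.one_mulVec]
    _ = 0 := by rw [← Matrix.mulVec_mulVec, e3, Matrix.mulVec_zero]

end Embedding

section EmbeddingProperties

variable {F} {n : ℕ}

variable (F) in
/-- The first `n + 1` columns of the rows of `Mtop` coming from `SO_{2n+2}`. -/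
def Pmat (n : ℕ) : Matrix (Fin (2 * (n + 1))) (Fin (n + 1)) F :=
  Matrix.of fun i j =>
    if (j : ℕ) < n then (if (i : ℕ) = j then 1 else 0) else if (i : ℕ) = n + 1 then 2⁻¹ else 0

variable (F) in
/-- The matrix unit at the last diagonal position. -/
def lastUnit (n : ℕ) : Matrix (Fin (n + 1)) (Fin (n + 1)) F :=
  Matrix.single (Fin.last n) (Fin.last n) 1

/-- The image in `SO_{2n+3}` of `g`, multiplied by the diagonal element `w_{l,l}`. -/
def wllEmb (ρ : F) (g : Matrix (Fin (2 * (n + 1))) (Fin (2 * (n + 1))) F) :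
    Matrix (Fin (2 * (n + 1) + 1)) (Fin (2 * (n + 1) + 1)) F :=
  wllMat F (n + 1) ρ * embTop F (n + 1) ρ g

lemma Mtop_submatrix_fst (ρ : F) :
    (Mtop F (n + 1) ρ).submatrix (insIdx n) (fstIdx (oddIdx (n + 1))) = Pmat F n := by
  ext i j
  simp only [Matrix.submatrix_apply, Mtop_insIdx_apply, insIdx_val, fstIdx_oddIdx, Pmat,
    Matrix.of_apply]
  have h1 := i.isLt
  have h2 := j.isLt
  split_ifs <;> first | rfl | omega

lemma Mtop_insPt_fst (ρ : F) (j : Fin (n + 1)) :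
    Mtop F (n + 1) ρ (insPt n) (fstIdx (oddIdx (n + 1)) j) =
      2⁻¹ * (1 : Matrix (Fin (n + 1)) (Fin (n + 1)) F) (Fin.last n) j := by
  simp only [Mtop_insPt_apply, fstIdx_oddIdx, Matrix.one_apply, Fin.ext_iff, Fin.val_last]
  have h2 := j.isLt
  split_ifs <;> first | omega | simp

lemma wllMat_mul {μ : Type*} (ρ : F) {m : ℕ} (k : Matrix (Fin (2 * m + 1)) μ F) :
    (wllMat F m ρ * k).submatrix (fstIdx (oddIdx m)) id =
      (ρ / 2) • k.submatrix (fstIdx (oddIdx m)) id ∧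
    (wllMat F m ρ * k).submatrix (midIdx (oddIdx m)) id = k.submatrix (midIdx (oddIdx m)) id ∧
    (wllMat F m ρ * k).submatrix (lstIdx (oddIdx m)) id =
      (ρ / 2)⁻¹ • k.submatrix (lstIdx (oddIdx m)) id := by
  have hw : wllMat F m ρ = Matrix.diagonal fun i : Fin (2 * m + 1) =>
      if (i : ℕ) < m then ρ / 2 else if (i : ℕ) = m then 1 else (ρ / 2)⁻¹ := by
    ext i j
    simp only [wllMat, Matrix.of_apply, Matrix.diagonal_apply]
  rw [hw]
  refine ⟨?_, ?_, ?_⟩ <;> ext i j <;> simp [Matrix.diagonal_mul, fstIdx_oddIdx, midIdx_oddIdx,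
    lstIdx_oddIdx]
  rw [if_neg (by omega), if_neg (by omega)]

lemma wllMat_mem (ρ : F) {m : ℕ} (h : ρ / 2 ≠ 0) :
    wllMat F m ρ ∈ SOset F (2 * m + 1) (Jmat F (2 * m + 1)) := by
  have hw : wllMat F m ρ = lnMat F m ((ρ / 2) • 1) := by
    rw [lnMat_eq]
    obtain ⟨h1, h2, h3⟩ := wllMat_mul ρ (1 : Matrix (Fin (2 * m + 1)) (Fin (2 * m + 1)) F)
    obtain ⟨k1, k2, k3⟩ := upThree_mul (oddIdx m) ((ρ / 2) • 1) 0 0 0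
      (aStar F m ((ρ / 2) • 1)) (1 : Matrix (Fin (2 * m + 1)) (Fin (2 * m + 1)) F)
    rw [Matrix.mul_one] at h1 h2 h3 k1 k2 k3
    have ha : aStar F m ((ρ / 2) • 1) = (ρ / 2)⁻¹ • (1 : Matrix (Fin m) (Fin m) F) := by
      rw [aStar, Matrix.inv_eq_left_inv (B := (ρ / 2)⁻¹ • (1 : Matrix (Fin m) (Fin m) F))]
      · simp [Jmat_sq]
      · rw [Matrix.smul_mul, Matrix.one_mul, smul_smul, inv_mul_cancel₀ h, one_smul]
    refine rows_ext_three (oddIdx m) ?_ ?_ ?_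
    · rw [h1, k1]; simp
    · rw [h2, k2]; simp
    · rw [h3, k3, ha]; simp
  rw [hw]
  refine lnMat_mem ?_
  rw [isUnit_iff_ne_zero]
  simp [h]

lemma embTop_rows (ρ : F) (h2 : (2 : F) ≠ 0) (hρ : ρ ≠ 0)
    (g : Matrix (Fin (2 * (n + 1))) (Fin (2 * (n + 1))) F) :
    (Mtop F (n + 1) ρ).submatrix (insIdx n) id * embTop F (n + 1) ρ g =
        g * (Mtop F (n + 1) ρ).submatrix (insIdx n) id ∧
      Matrix.vecMul (Mtop F (n + 1) ρ (insPt n)) (embTop F (n + 1) ρ g) =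
        Mtop F (n + 1) ρ (insPt n) := by
  have h : Mtop F (n + 1) ρ * embTop F (n + 1) ρ g = insTop F (n + 1) g * Mtop F (n + 1) ρ := by
    rw [embTop, ← Matrix.mul_assoc, ← Matrix.mul_assoc,
      Matrix.mul_nonsing_inv _ (isUnit_Mtop ρ h2 hρ), Matrix.one_mul]
  constructor
  · rw [← insTop_mul_insIdx, ← h]
    rfl
  · ext j
    rw [← insTop_mul_insPt g (Mtop F (n + 1) ρ) j, ← h]
    rfl

lemma Jmat_mul_embTop (ρ : F) (h2 : (2 : F) ≠ 0) (hρ : ρ ≠ 0)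
    (g : Matrix (Fin (2 * (n + 1))) (Fin (2 * (n + 1))) F) :
    Jmat F (2 * (n + 1) + 1) * embTop F (n + 1) ρ g =
      ((Mtop F (n + 1) ρ).submatrix (insIdx n) id)ᵀ * Jrho F (n + 1) ρ * g *
        (Mtop F (n + 1) ρ).submatrix (insIdx n) id +
      ρ • Matrix.vecMulVec (Mtop F (n + 1) ρ (insPt n)) (Mtop F (n + 1) ρ (insPt n)) := by
  obtain ⟨h3, h4⟩ := embTop_rows ρ h2 hρ g
  rw [← Mtop_form ρ h2 hρ, Matrix.add_mul, Matrix.mul_assoc, h3, Matrix.smul_mul,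
    Matrix.vecMulVec_mul, h4]
  simp only [Matrix.mul_assoc]

lemma embTop_mem (ρ : F) (h2 : (2 : F) ≠ 0) (hρ : ρ ≠ 0)
    {g : Matrix (Fin (2 * (n + 1))) (Fin (2 * (n + 1))) F}
    (hg : g ∈ SOset F (2 * (n + 1)) (Jrho F (n + 1) ρ)) :
    embTop F (n + 1) ρ g ∈ SOset F (2 * (n + 1) + 1) (Jmat F (2 * (n + 1) + 1)) := by
  obtain ⟨h3, h4⟩ := embTop_rows ρ h2 hρ g
  have hu := isUnit_Mtop (n := n) ρ h2 hρ
  constructor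
  · rw [embTop, Matrix.det_mul, Matrix.det_mul, det_insTop, hg.1, mul_one, ← Matrix.det_mul,
      Matrix.nonsing_inv_mul _ hu, Matrix.det_one]
  · have h3' := congrArg Matrix.transpose h3
    rw [Matrix.transpose_mul, Matrix.transpose_mul] at h3'
    rw [Matrix.mul_assoc, Jmat_mul_embTop ρ h2 hρ, Matrix.mul_add, Matrix.mul_smul,
      Matrix.mul_vecMulVec, Matrix.mulVec_transpose, h4, ← Mtop_form ρ h2 hρ]
    congr 1
    simp only [← Matrix.mul_assoc]
    rw [h3', Matrix.mul_assoc _ _ (Jrho F (n + 1) ρ), Matrix.mul_assoc _ _ g]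
    rw [hg.2]

lemma wllEmb_mem (ρ : F) (h2 : (2 : F) ≠ 0) (hρ : ρ ≠ 0)
    {g : Matrix (Fin (2 * (n + 1))) (Fin (2 * (n + 1))) F}
    (hg : g ∈ SOset F (2 * (n + 1)) (Jrho F (n + 1) ρ)) :
    wllEmb ρ g ∈ SOset F (2 * (n + 1) + 1) (Jmat F (2 * (n + 1) + 1)) :=
  SOset_mul (wllMat_mem ρ (div_ne_zero hρ h2)) (embTop_mem ρ h2 hρ hg)

lemma wllEmb_lst_fst (ρ : F) (h2 : (2 : F) ≠ 0) (hρ : ρ ≠ 0)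
    (g : Matrix (Fin (2 * (n + 1))) (Fin (2 * (n + 1))) F) :
    (wllEmb ρ g).submatrix (lstIdx (oddIdx (n + 1))) (fstIdx (oddIdx (n + 1))) =
      Jmat F (n + 1) * ((ρ / 2)⁻¹ • ((Pmat F n)ᵀ * Jrho F (n + 1) ρ * g * Pmat F n +
        (ρ * (2⁻¹ * 2⁻¹)) • lastUnit F n)) := by
  set e := oddIdx (n + 1) with he
  set k := (embTop F (n + 1) ρ g).submatrix id (fstIdx e) with hk
  have h3 : (wllEmb ρ g).submatrix (lstIdx e) (fstIdx e) =
      (ρ / 2)⁻¹ • k.submatrix (lstIdx e) id := (wllMat_mul ρ k).2.2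
  have h4 : Jmat F (n + 1) * k.submatrix (lstIdx e) id =
      (Jmat F (2 * (n + 1) + 1) * embTop F (n + 1) ρ g).submatrix (fstIdx e) (fstIdx e) := by
    rw [Jmat_odd]
    exact ((formThree_mul e (Jmat F (n + 1)) 1 k).1).symm
  have h5 : Jmat F (n + 1) * k.submatrix (lstIdx e) id =
      (Pmat F n)ᵀ * Jrho F (n + 1) ρ * g * Pmat F n + (ρ * (2⁻¹ * 2⁻¹)) • lastUnit F n := by
    rw [h4, Jmat_mul_embTop ρ h2 hρ, Matrix.submatrix_add, Pi.add_apply, Pi.add_apply]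
    refine congrArg₂ (· + ·) ?_ ?_
    · rw [← Mtop_submatrix_fst (n := n) ρ]
      rfl
    · ext i j
      simp only [Matrix.submatrix_apply, Matrix.smul_apply, Matrix.vecMulVec_apply, he,
        Mtop_insPt_fst, lastUnit, smul_eq_mul, Matrix.single_apply, Matrix.one_apply]
      by_cases hi : Fin.last n = i <;> by_cases hj : Fin.last n = j <;> simp [hi, hj]
  rw [h3, ← h5, Matrix.mul_smul, ← Matrix.mul_assoc, Jmat_sq, Matrix.one_mul]

lemma mul_Pmat_of_siegel (ρ : F) (h2 : (2 : F) ≠ 0) (hρ : ρ ≠ 0)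
    (g : Matrix (Fin (2 * (n + 1))) (Fin (2 * (n + 1))) F)
    (hm : (wllEmb ρ g).submatrix (midIdx (oddIdx (n + 1))) (fstIdx (oddIdx (n + 1))) = 0)
    (hl : (wllEmb ρ g).submatrix (lstIdx (oddIdx (n + 1))) (fstIdx (oddIdx (n + 1))) = 0) :
    ∃ m : Matrix (Fin (n + 1)) (Fin (n + 1)) F,
      g * Pmat F n = Pmat F n * m ∧ m (Fin.last n) = (1 : Matrix _ _ F) (Fin.last n) := by
  set e := oddIdx (n + 1) with he
  set k := (embTop F (n + 1) ρ g).submatrix id (fstIdx e) with hk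
  obtain ⟨w1, w2, w3⟩ := wllMat_mul ρ k
  have k2 : k.submatrix (midIdx e) id = 0 := w2.symm.trans hm
  have k3 : k.submatrix (lstIdx e) id = 0 := by
    have : (ρ / 2)⁻¹ • k.submatrix (lstIdx e) id = 0 := w3.symm.trans hl
    rwa [smul_eq_zero_iff_right (inv_ne_zero (div_ne_zero hρ h2))] at this
  obtain ⟨h3, h4⟩ := embTop_rows ρ h2 hρ g
  refine ⟨k.submatrix (fstIdx e) id, ?_, ?_⟩
  · have h5 := congrArg (fun M => M.submatrix id (fstIdx e)) h3
    have h6 : (Mtop F (n + 1) ρ).submatrix (insIdx n) id * k =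
        (Mtop F (n + 1) ρ).submatrix (insIdx n) (fstIdx e) * k.submatrix (fstIdx e) id := by
      ext i j
      have k2' (r) : k (midIdx e r) j = 0 := congrFun (congrFun k2 r) j
      have k3' (r) : k (lstIdx e r) j = 0 := congrFun (congrFun k3 r) j
      simp [Matrix.mul_apply, sum_three e, k2', k3']
    rw [← Mtop_submatrix_fst ρ]
    exact h5.symm.trans h6
  · ext j
    have h5 := congrFun h4 (fstIdx e j)
    have k2' (r) : embTop F (n + 1) ρ g (midIdx e r) (fstIdx e j) = 0 := congrFun (congrFun k2 r) j
    have k3' (r) : embTop F (n + 1) ρ g (lstIdx e r) (fstIdx e j) = 0 := congrFun (congrFun k3 r) j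
    simp only [Matrix.vecMul, dotProduct, sum_three e, k2', k3', mul_zero,
      Finset.sum_const_zero, add_zero] at h5
    simp only [he, Mtop_insPt_fst, mul_assoc, ← Finset.mul_sum] at h5
    have h6 := mul_left_cancel₀ (inv_ne_zero h2) h5
    rw [← h6]
    simp [Matrix.one_apply, hk, he]

end EmbeddingProperties

section WhittakerSide

variable {F} {n : ℕ}

lemma Pmat_fst_castSucc (i j : Fin n) :
    Pmat F n (fstIdx (evenIdx n) i) j.castSucc = if i = j then 1 else 0 := by
  simp [Pmat, fstIdx_evenIdx, Fin.ext_iff]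

lemma Pmat_fst_last (i : Fin n) : Pmat F n (fstIdx (evenIdx n) i) (Fin.last n) = 0 := by
  have := i.isLt
  simp [Pmat, fstIdx_evenIdx]
  omega

lemma Pmat_mid_castSucc (i : Fin 2) (j : Fin n) :
    Pmat F n (midIdx (evenIdx n) i) j.castSucc = 0 := by
  have := j.isLt
  simp [Pmat, midIdx_evenIdx]
  omega

lemma Pmat_mid_last (i : Fin 2) :
    Pmat F n (midIdx (evenIdx n) i) (Fin.last n) = ![0, 2⁻¹] i := by
  fin_cases i <;> simp [Pmat, midIdx_evenIdx]

lemma Pmat_lst (i : Fin n) (j : Fin (n + 1)) : Pmat F n (lstIdx (evenIdx n) i) j = 0 := by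
  have := i.isLt
  have := j.isLt
  simp only [Pmat, Matrix.of_apply, lstIdx_evenIdx]
  split_ifs <;> first | rfl | omega

lemma Pmat_mul_fst (m : Matrix (Fin (n + 1)) (Fin (n + 1)) F) (i : Fin n) (k : Fin (n + 1)) :
    (Pmat F n * m) (fstIdx (evenIdx n) i) k = m i.castSucc k := by
  simp [Matrix.mul_apply, Fin.sum_univ_castSucc, Pmat_fst_castSucc, Pmat_fst_last]

lemma Pmat_mul_mid (m : Matrix (Fin (n + 1)) (Fin (n + 1)) F) (i : Fin 2) (k : Fin (n + 1)) :
    (Pmat F n * m) (midIdx (evenIdx n) i) k = ![0, 2⁻¹] i * m (Fin.last n) k := by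
  simp only [Matrix.mul_apply, Fin.sum_univ_castSucc, Pmat_mid_castSucc, Pmat_mid_last, zero_mul,
    Finset.sum_const_zero, zero_add]

lemma Pmat_mul_lst (m : Matrix (Fin (n + 1)) (Fin (n + 1)) F) (i : Fin n) (k : Fin (n + 1)) :
    (Pmat F n * m) (lstIdx (evenIdx n) i) k = 0 := by
  simp [Matrix.mul_apply, Pmat_lst]

lemma mul_Pmat_castSucc {μ : Type*} (A : Matrix μ (Fin (2 * (n + 1))) F) (i : μ) (j : Fin n) :
    (A * Pmat F n) i j.castSucc = A i (fstIdx (evenIdx n) j) := by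
  simp [Matrix.mul_apply, sum_three (evenIdx n), Pmat_fst_castSucc, Pmat_mid_castSucc, Pmat_lst]

lemma mul_Pmat_last {μ : Type*} (A : Matrix μ (Fin (2 * (n + 1))) F) (i : μ) :
    (A * Pmat F n) i (Fin.last n) = A i (midIdx (evenIdx n) 1) * 2⁻¹ := by
  simp [Matrix.mul_apply, sum_three (evenIdx n), Pmat_fst_last, Pmat_mid_last, Pmat_lst]

lemma psiU_eq (ψ : AddChar F ℂ) (M : Matrix (Fin (2 * (n + 1))) (Fin (2 * (n + 1))) F) :
    psiU F (n + 1) ψ M = ψ (∑ i : Fin n, (M * Pmat F n) (fstIdx (evenIdx n) i) i.succ) := by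
  rw [psiU]
  congr 1
  rw [sum_three (evenIdx n)]
  refine (congrArg₂ (· + ·) (congrArg₂ (· + ·) rfl (Finset.sum_eq_zero fun i _ =>
    Finset.sum_eq_zero fun j _ => ?_)) (Finset.sum_eq_zero fun i _ =>
    Finset.sum_eq_zero fun j _ => ?_)).trans ?_
  · rw [midIdx_evenIdx, if_neg (by omega), if_neg (by omega)]
  · rw [lstIdx_evenIdx, if_neg (by omega), if_neg (by omega)]
  · rw [add_zero, add_zero]
    refine Finset.sum_congr rfl fun i _ => ?_
    rw [Matrix.mul_apply]
    refine Finset.sum_congr rfl fun j _ => ?_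
    have := i.isLt
    simp only [Pmat, Matrix.of_apply, fstIdx_evenIdx, Fin.val_succ]
    split_ifs <;> first | omega | simp [mul_comm]

lemma glUSum_succ (m : Matrix (Fin (n + 1)) (Fin (n + 1)) F) :
    glUSum F (n + 1) m = ∑ i : Fin n, m i.castSucc i.succ := by
  rw [glUSum, Fin.sum_univ_castSucc]
  rw [Finset.sum_eq_zero (s := Finset.univ (α := Fin (n + 1))), add_zero]
  · refine Finset.sum_congr rfl fun i _ => ?_
    rw [Finset.sum_eq_single i.succ]
    · simp
    · intro j _ hj
      rw [if_neg]
      intro h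
      exact hj (Fin.ext (by simpa using h))
    · simp
  · intro j _
    have := j.isLt
    rw [if_neg]
    rw [Fin.val_last]
    omega

lemma psiU_of_mul_Pmat (ψ : AddChar F ℂ) {M : Matrix (Fin (2 * (n + 1))) (Fin (2 * (n + 1))) F}
    {m : Matrix (Fin (n + 1)) (Fin (n + 1)) F} (h : M * Pmat F n = Pmat F n * m) :
    psiU F (n + 1) ψ M = ψ (glUSum F (n + 1) m) := by
  rw [psiU_eq, glUSum_succ, h]
  simp only [Pmat_mul_fst]

lemma cols_of_mul_Pmat (h2 : (2 : F) ≠ 0) {H H' : Matrix (Fin (2 * (n + 1))) (Fin (2 * (n + 1))) F}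
    (h : H * Pmat F n = H' * Pmat F n) :
    (∀ i j, H i (fstIdx (evenIdx n) j) = H' i (fstIdx (evenIdx n) j)) ∧
      ∀ i, H i (midIdx (evenIdx n) 1) = H' i (midIdx (evenIdx n) 1) := by
  refine ⟨fun i j => ?_, fun i => ?_⟩
  · rw [← mul_Pmat_castSucc H, h, mul_Pmat_castSucc]
  · have := congrFun (congrFun h i) (Fin.last n)
    rw [mul_Pmat_last, mul_Pmat_last] at this
    exact mul_right_cancel₀ (inv_ne_zero h2) this

lemma form_row_fst (ρ : F) (H : Matrix (Fin (2 * (n + 1))) (Fin (2 * (n + 1))) F) (i : Fin n)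
    (j : Fin (2 * (n + 1))) : (Jrho F (n + 1) ρ * H) (fstIdx (evenIdx n) i) j =
      H (lstIdx (evenIdx n) i.rev) j := by
  have := (formThree_mul (evenIdx n) (Jmat F n) (midForm ρ) H).1
  rw [← Jrho_eq, Jmat_mul] at this
  exact congrFun (congrFun this i) j

lemma form_row_mid (ρ : F) (H : Matrix (Fin (2 * (n + 1))) (Fin (2 * (n + 1))) F) (i : Fin 2)
    (j : Fin (2 * (n + 1))) : (Jrho F (n + 1) ρ * H) (midIdx (evenIdx n) i) j =
      ![1, -ρ] i * H (midIdx (evenIdx n) i) j := by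
  have := (formThree_mul (evenIdx n) (Jmat F n) (midForm ρ) H).2.1
  rw [← Jrho_eq, midForm] at this
  exact (congrFun (congrFun this i) j).trans (Matrix.diagonal_mul _ _ i j)

lemma rows_of_mul_Pmat (ρ : F) (h2 : (2 : F) ≠ 0) (hρ : ρ ≠ 0)
    {H H' : Matrix (Fin (2 * (n + 1))) (Fin (2 * (n + 1))) F}
    (h : (Pmat F n)ᵀ * Jrho F (n + 1) ρ * H = (Pmat F n)ᵀ * Jrho F (n + 1) ρ * H') :
    (∀ i j, H (lstIdx (evenIdx n) i) j = H' (lstIdx (evenIdx n) i) j) ∧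
      ∀ j, H (midIdx (evenIdx n) 1) j = H' (midIdx (evenIdx n) 1) j := by
  have h' : (Jrho F (n + 1) ρ * H)ᵀ * Pmat F n = (Jrho F (n + 1) ρ * H')ᵀ * Pmat F n := by
    rw [Matrix.mul_assoc, Matrix.mul_assoc] at h
    rw [← Matrix.transpose_inj]
    simpa only [Matrix.transpose_mul, Matrix.transpose_transpose, ← Matrix.mul_assoc] using h
  obtain ⟨h3, h4⟩ := cols_of_mul_Pmat h2 h'
  simp only [Matrix.transpose_apply, form_row_fst, form_row_mid] at h3 h4
  refine ⟨fun i j => ?_, fun j => ?_⟩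
  · simpa using h3 j i.rev
  · have := h4 j
    simpa [hρ] using this

lemma SOset_transpose_mul {m : ℕ} {Jm H : Matrix (Fin m) (Fin m) F} (hH : H ∈ SOset F m Jm)
    {μ : Type*} {A : Matrix (Fin m) μ F} (hA : H * A = A) : Aᵀ * Jm * H = Aᵀ * Jm := by
  calc Aᵀ * Jm * H = (H * A)ᵀ * Jm * H := by rw [hA]
    _ = Aᵀ * (Hᵀ * Jm * H) := by rw [Matrix.transpose_mul]; simp only [Matrix.mul_assoc]
    _ = Aᵀ * Jm := by rw [hH.2]

lemma upUnip_of_mul_Pmat (ρ : F) (h2 : (2 : F) ≠ 0) (hρ : ρ ≠ 0)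
    {H : Matrix (Fin (2 * (n + 1))) (Fin (2 * (n + 1))) F}
    (hH : H ∈ SOset F (2 * (n + 1)) (Jrho F (n + 1) ρ)) (h : H * Pmat F n = Pmat F n) :
    upUnip F H := by
  obtain ⟨c1, c2⟩ := cols_of_mul_Pmat h2 (H := H) (H' := 1) (by rw [h, Matrix.one_mul])
  obtain ⟨r1, r2⟩ := rows_of_mul_Pmat ρ h2 hρ (H := H) (H' := 1)
    (by rw [SOset_transpose_mul hH h, Matrix.mul_one])
  have hoff : ∀ i j : Fin (2 * (n + 1)), j ≤ i → (i ≠ midIdx (evenIdx n) 0 ∨ i ≠ j) →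
      H i j = (1 : Matrix _ _ F) i j := by
    intro i
    revert i
    rw [forall_three (evenIdx n)]
    refine ⟨fun i j hij _ => ?_, fun i j hij hne => ?_, fun i j _ _ => r1 i j⟩
    · revert j
      rw [forall_three (evenIdx n)]
      refine ⟨fun j _ _ => c1 _ _, fun j hij => ?_, fun j hij => ?_⟩ <;>
        (rw [Fin.le_def] at hij
         simp only [fstIdx_evenIdx, midIdx_evenIdx, lstIdx_evenIdx] at hij
         have := i.isLt
         omega)
    · have h01 : i = 0 ∨ i = 1 := by omega
      rcases h01 with rfl | rfl
      · revert j
        rw [forall_three (evenIdx n)]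
        refine ⟨fun j _ _ => c1 _ _, fun j hij hne => ?_, fun j hij => ?_⟩
        · rw [Fin.le_def] at hij
          simp only [midIdx_evenIdx] at hij
          have : j = 0 := by omega
          simp [this] at hne
        · rw [Fin.le_def] at hij
          simp only [midIdx_evenIdx, lstIdx_evenIdx] at hij
          simp at hij
          omega
      · exact r2 j
  have hbt : H.BlockTriangular id := by
    intro i j hij
    change j < i at hij
    rw [hoff i j (le_of_lt hij) (Or.inr (ne_of_gt hij)), Matrix.one_apply_ne (ne_of_gt hij)]
  have hdet := hH.1
  rw [Matrix.det_of_isUpperTriangular hbt, Finset.prod_eq_single (midIdx (evenIdx n) 0)] at hdet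
  · refine upUnip_iff.2 ⟨hbt, fun i => ?_⟩
    by_cases hi : i = midIdx (evenIdx n) 0
    · rw [hi, hdet]
    · rw [hoff i i le_rfl (Or.inl hi), Matrix.one_apply_eq]
  · intro i _ hi
    rw [hoff i i le_rfl (Or.inl hi), Matrix.one_apply_eq]
  · simp

lemma upUnip_upThree {a A : Matrix (Fin n) (Fin n) F} (ha : upUnip F a) (hA : upUnip F A)
    (b : Matrix (Fin n) (Fin 2) F) (z : Matrix (Fin n) (Fin n) F) (b' : Matrix (Fin 2) (Fin n) F) :
    upUnip F (upThree (evenIdx n) a b z b' A) := by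
  have e11 := upThree_fst_fst (evenIdx n) (a := a) (b := b) (z := z) (b' := b') (A := A)
  have e21 := upThree_mid_fst (evenIdx n) (a := a) (b := b) (z := z) (b' := b') (A := A)
  have e22 := upThree_mid_mid (evenIdx n) (a := a) (b := b) (z := z) (b' := b') (A := A)
  have e31 := upThree_lst_fst (evenIdx n) (a := a) (b := b) (z := z) (b' := b') (A := A)
  have e32 := upThree_lst_mid (evenIdx n) (a := a) (b := b) (z := z) (b' := b') (A := A)
  have e33 := upThree_lst_lst (evenIdx n) (a := a) (b := b) (z := z) (b' := b') (A := A)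
  intro i
  revert i
  rw [forall_three (evenIdx n)]
  refine ⟨fun i => ?_, fun i => ?_, fun i => ?_⟩ <;>
    (rw [forall_three (evenIdx n)]
     refine ⟨fun j hij => ?_, fun j hij => ?_, fun j hij => ?_⟩)
  all_goals
    simp only [fstIdx_evenIdx, midIdx_evenIdx, lstIdx_evenIdx, Fin.ext_iff] at hij ⊢
    have hi := i.isLt
    have hj := j.isLt
  · refine (congrFun (congrFun e11 i) j).trans ?_
    rw [ha i j hij]
    simp only [Fin.ext_iff]
  · omega
  · omega
  · refine (congrFun (congrFun e21 i) j).trans ?_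
    rw [if_neg (by omega)]
    rfl
  · refine (congrFun (congrFun e22 i) j).trans ?_
    rw [Matrix.one_apply]
    simp only [Fin.ext_iff, Nat.add_left_cancel_iff]
  · omega
  · refine (congrFun (congrFun e31 i) j).trans ?_
    rw [if_neg (by omega)]
    rfl
  · refine (congrFun (congrFun e32 i) j).trans ?_
    rw [if_neg (by omega)]
    rfl
  · refine (congrFun (congrFun e33 i) j).trans ?_
    rw [hA i j (by omega)]
    simp only [Fin.ext_iff, Nat.add_left_cancel_iff]

lemma exists_lift (ρ : F) (h2 : (2 : F) ≠ 0) (hρ : ρ ≠ 0)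
    {m : Matrix (Fin (n + 1)) (Fin (n + 1)) F} (hm : upUnip F m) :
    ∃ u : SO2l F (n + 1) ρ, u ∈ USet F (n + 1) ρ ∧ mat F u * Pmat F n = Pmat F n * m := by
  set a : Matrix (Fin n) (Fin n) F := m.submatrix Fin.castSucc Fin.castSucc with ha
  have hau : upUnip F a := by
    intro i j hij
    rw [ha, Matrix.submatrix_apply, hm _ _ hij]
    simp
  set b : Matrix (Fin n) (Fin 2) F := Matrix.of fun i j => ![0, 2 * m i.castSucc (Fin.last n)] j
    with hb
  set A := aStar F n a
  set b' : Matrix (Fin 2) (Fin n) F := -(Matrix.diagonal ![1, -ρ⁻¹] * bᵀ * Jmat F n * A) with hb'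
  set z : Matrix (Fin n) (Fin n) F := -((2 : F)⁻¹ • (a * Jmat F n * (b'ᵀ * midForm ρ * b')))
    with hz
  set M := upThree (evenIdx n) a b z b' A with hM
  have hdeta : IsUnit a.det := by rw [hau.det_eq_one]; exact isUnit_one
  have h1 : aᵀ * Jmat F n * A = Jmat F n := transpose_mul_Jmat_mul_aStar hdeta
  have h1' : Aᵀ * Jmat F n * a = Jmat F n := by
    rw [← Matrix.transpose_inj]
    simpa only [Matrix.transpose_mul, Matrix.transpose_transpose, transpose_Jmat,
      Matrix.mul_assoc] using h1
  have hS : midForm ρ * Matrix.diagonal ![1, -ρ⁻¹] = 1 := by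
    rw [midForm, Matrix.diagonal_mul_diagonal, ← Matrix.diagonal_one]
    congr 1
    ext i
    fin_cases i <;> simp [hρ]
  have hSt : (midForm ρ)ᵀ = midForm ρ := Matrix.diagonal_transpose _
  have hform : Mᵀ * Jrho F (n + 1) ρ * M = Jrho F (n + 1) ρ := by
    rw [Jrho_eq]
    refine upThree_isometry (evenIdx n) transpose_Jmat hSt h1 ?_ ?_
    · rw [hb', Matrix.mul_neg]
      simp only [← Matrix.mul_assoc]
      rw [hS, Matrix.one_mul, add_neg_cancel]
    · have e1 : Aᵀ * Jmat F n * z = -((2 : F)⁻¹ • (b'ᵀ * midForm ρ * b')) := by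
        rw [hz, Matrix.mul_neg, Matrix.mul_smul]
        simp only [← Matrix.mul_assoc]
        rw [h1', Jmat_sq, Matrix.one_mul]
      have e2 : zᵀ * Jmat F n * A = -((2 : F)⁻¹ • (b'ᵀ * midForm ρ * b')) := by
        rw [← Matrix.transpose_inj, Matrix.transpose_mul, Matrix.transpose_mul,
          Matrix.transpose_transpose, transpose_Jmat, ← Matrix.mul_assoc, e1]
        simp only [Matrix.transpose_neg, Matrix.transpose_smul, Matrix.transpose_mul,
          Matrix.transpose_transpose, hSt, Matrix.mul_assoc]
      rw [e1, e2]
      have : b'ᵀ * midForm ρ * b' = (2 : F)⁻¹ • (b'ᵀ * midForm ρ * b') +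
          (2 : F)⁻¹ • (b'ᵀ * midForm ρ * b') := by
        rw [← add_smul, ← two_mul, mul_inv_cancel₀ h2, one_smul]
      nth_rw 2 [this]
      abel
  have hdet : M.det = 1 := by
    rw [hM, det_upThree, hau.det_eq_one, (upUnip_aStar hau).det_eq_one, one_mul]
  have hP : M * Pmat F n = Pmat F n * m := by
    obtain ⟨k1, k2, k3⟩ := upThree_mul (evenIdx n) a b z b' A (Pmat F n)
    have hl : (Pmat F n).submatrix (lstIdx (evenIdx n)) id = 0 := by
      ext i j
      exact Pmat_lst i j
    rw [hl, Matrix.mul_zero, add_zero] at k1 k2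
    rw [hl, Matrix.mul_zero] at k3
    refine rows_ext_three (evenIdx n) ?_ ?_ ?_
    · rw [k1]
      ext i j
      refine Eq.trans ?_ (Pmat_mul_fst m i j).symm
      refine Fin.lastCases ?_ (fun j => ?_) j
      · simp only [Matrix.add_apply, Matrix.mul_apply, Matrix.submatrix_apply, id_eq,
          Pmat_fst_last, Pmat_mid_last, hb, Matrix.of_apply, Fin.sum_univ_two]
        simp only [mul_zero, Finset.sum_const_zero, zero_add, Matrix.cons_val_zero,
          Matrix.cons_val_one]
        field_simp
      · simp [Matrix.mul_apply, Pmat_fst_castSucc, Pmat_mid_castSucc, ha]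
    · rw [k2]
      ext i j
      rw [Matrix.submatrix_apply, Matrix.submatrix_apply, id_eq, Pmat_mul_mid,
        hm _ _ (by have := j.isLt; rw [Fin.val_last]; omega)]
      refine Fin.lastCases ?_ (fun j => ?_) j <;>
        simp [Pmat_mid_castSucc, Pmat_mid_last, (Fin.castSucc_lt_last _).ne']
    · rw [k3]
      ext i j
      exact (Pmat_mul_lst m i j).symm
  have hu : IsUnit M.det := by rw [hdet]; exact isUnit_one
  refine ⟨⟨Matrix.nonsingInvUnit M hu, hdet, hform⟩, ?_, hP⟩
  change upUnip F M
  exact upUnip_upThree hau (upUnip_aStar hau) b z b'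

end WhittakerSide

section BesselLike

variable {F} {n : ℕ} {ρ : F} {ψ : AddChar F ℂ}

/-- The equivariance properties of a normalized Bessel function. -/
structure IsBesselLike (ρ : F) (ψ : AddChar F ℂ) (φ : SO2l F (n + 1) ρ → ℂ) : Prop where
  one : φ 1 = 1
  mul_left : ∀ u ∈ USet F (n + 1) ρ, ∀ g, φ (u * g) = psiU F (n + 1) ψ (mat F u) * φ g
  mul_right : ∀ u ∈ USet F (n + 1) ρ, ∀ g, φ (g * u) = psiU F (n + 1) ψ (mat F u) * φ g

lemma mat_mul {m : ℕ} {Jm : Matrix (Fin m) (Fin m) F} (g h : SOgrp F m Jm) :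
    mat F (g * h) = mat F g * mat F h := rfl

lemma mat_one {m : ℕ} {Jm : Matrix (Fin m) (Fin m) F} : mat F (1 : SOgrp F m Jm) = 1 := rfl

lemma mat_mem {m : ℕ} {Jm : Matrix (Fin m) (Fin m) F} (g : SOgrp F m Jm) :
    mat F g ∈ SOset F m Jm := g.2

lemma mat_injective {m : ℕ} {Jm : Matrix (Fin m) (Fin m) F} :
    Function.Injective (mat F : SOgrp F m Jm → _) :=
  fun _ _ h => Subtype.ext (Units.ext h)

lemma mem_USet_of_mul_Pmat (h2 : (2 : F) ≠ 0) (hρ : ρ ≠ 0) {h : SO2l F (n + 1) ρ}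
    (hP : mat F h * Pmat F n = Pmat F n) :
    h ∈ USet F (n + 1) ρ ∧ psiU F (n + 1) ψ (mat F h) = 1 := by
  refine ⟨upUnip_of_mul_Pmat ρ h2 hρ (mat_mem h) hP, ?_⟩
  rw [psiU_of_mul_Pmat ψ (m := 1) (by rw [hP, Matrix.mul_one]), glUSum_one, AddChar.map_zero_eq_one]

lemma inv_mul_Pmat {g : SO2l F (n + 1) ρ} {A B : Matrix (Fin (2 * (n + 1))) (Fin (n + 1)) F}
    (h : mat F g * A = B) : mat F g⁻¹ * B = A := by
  rw [← h, ← Matrix.mul_assoc, ← mat_mul, inv_mul_cancel, mat_one, Matrix.one_mul]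

namespace IsBesselLike

variable {φ φ' : SO2l F (n + 1) ρ → ℂ}

lemma mul_fixer (hφ : IsBesselLike ρ ψ φ) (h2 : (2 : F) ≠ 0) (hρ : ρ ≠ 0)
    {h : SO2l F (n + 1) ρ} (hP : mat F h * Pmat F n = Pmat F n) (g : SO2l F (n + 1) ρ) :
    φ (g * h) = φ g ∧ φ (h * g) = φ g := by
  obtain ⟨h3, h4⟩ := mem_USet_of_mul_Pmat (ψ := ψ) h2 hρ hP
  rw [hφ.mul_left h h3, hφ.mul_right h h3, h4, one_mul]
  exact ⟨rfl, rfl⟩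

lemma eq_of_mul_Pmat (hφ : IsBesselLike ρ ψ φ) (h2 : (2 : F) ≠ 0) (hρ : ρ ≠ 0)
    {g g' : SO2l F (n + 1) ρ} (h : mat F g * Pmat F n = mat F g' * Pmat F n) : φ g = φ g' := by
  have := (hφ.mul_fixer h2 hρ (h := g'⁻¹ * g)
    (by rw [mat_mul, Matrix.mul_assoc, h, inv_mul_Pmat rfl]) g').1
  rwa [mul_inv_cancel_left] at this

lemma glUSum_transvection_add {k i : Fin (n + 1)} (hki : k < i) (s : F) :
    upUnip F (1 + Matrix.single k i s) ∧
      glUSum F (n + 1) (1 + Matrix.single k i s) = if (i : ℕ) = k + 1 then s else 0 := by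
  constructor
  · intro a b hab
    rw [Matrix.add_apply, Matrix.one_apply, Matrix.single_apply, if_neg (c := _ ∧ _), add_zero]
    rintro ⟨rfl, rfl⟩
    exact absurd hab (not_le.2 hki)
  · rw [glUSum]
    simp only [Matrix.add_apply, Matrix.single_apply, Matrix.one_apply]
    rw [Finset.sum_eq_single k, Finset.sum_eq_single i]
    · rw [if_neg hki.ne]; simp
    · intro b _ hb
      split_ifs with h1 h2 h3 h4
      · rw [← h2] at h1; omega
      · rw [← h2] at h1; omega
      · exact absurd (by tauto) hb
      · simp
      · rfl
    · simp
    · intro a _ ha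
      refine Finset.sum_eq_zero fun b _ => ?_
      split_ifs with h1 h2 h3 h4
      · rw [← h2] at h1; omega
      · rw [← h2] at h1; omega
      · exact absurd (by tauto) ha
      · simp
      · rfl
    · simp

/-- If `i`-th and later rows of `m` are unipotent, then left multiplication by a suitable
unipotent matrix amounts to adding a multiple of column `k` to column `i`. -/
lemma exists_unip_of_rows {m : Matrix (Fin (n + 1)) (Fin (n + 1)) F} {q : Fin n} {k : Fin (n + 1)}
    (hk : k < q.succ) (hm : ∀ i j, q.succ ≤ i → j ≤ i → m i j = if i = j then 1 else 0) (s : F) :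
    ∃ m' : Matrix (Fin (n + 1)) (Fin (n + 1)) F, upUnip F m' ∧
      m' * m = m * (1 + Matrix.single k q.succ s) ∧ glUSum F (n + 1) m' = s * m q.castSucc k := by
  set M : Matrix (Fin (n + 1)) (Fin (n + 1)) F := Matrix.of fun a b =>
    if q.succ ≤ a then m a b else (1 : Matrix _ _ F) a b with hM
  have hMu : upUnip F M := by
    intro a b hab
    simp only [hM, Matrix.of_apply]
    split_ifs with h1 h2 h2
    · rw [hm a b h1 hab, if_pos h2]
    · rw [hm a b h1 hab, if_neg h2]
    · rw [h2, Matrix.one_apply_eq]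
    · rw [Matrix.one_apply_ne h2]
  have hMi := hMu.inv
  set w : Fin (n + 1) → F := M⁻¹ q.succ with hw
  have hw0 : ∀ b, b ≤ q.succ → w b = if q.succ = b then 1 else 0 := fun b hb => hMi _ _ hb
  have hwm : Matrix.vecMul w m = (1 : Matrix _ _ F) q.succ := by
    have h1 : M⁻¹ * M = 1 := by
      refine Matrix.nonsing_inv_mul _ ?_
      rw [hMu.det_eq_one]
      exact isUnit_one
    rw [← h1]
    ext b
    rw [Matrix.mul_apply, Matrix.vecMul, dotProduct]
    refine Finset.sum_congr rfl fun a _ => ?_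
    by_cases ha : q.succ ≤ a
    · simp [hM, hw, ha]
    · have := hw0 a (le_of_not_ge ha)
      rw [if_neg (by rintro rfl; exact ha le_rfl)] at this
      rw [this, zero_mul, ← hw, this, zero_mul]
  have hcol : ∀ a, q.succ ≤ a → m a k = 0 := fun a ha => by
    rw [hm a k ha (hk.le.trans ha), if_neg (hk.trans_le ha).ne']
  refine ⟨1 + s • Matrix.vecMulVec (fun a => m a k) w, ?_, ?_, ?_⟩
  · intro a b hab
    rw [Matrix.add_apply, Matrix.one_apply, Matrix.smul_apply, Matrix.vecMulVec_apply]
    rw [show m a k * w b = 0 from ?_, smul_zero, add_zero]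
    by_cases ha : q.succ ≤ a
    · rw [hcol a ha, zero_mul]
    · have hb : b < q.succ := lt_of_le_of_lt hab (not_le.1 ha)
      rw [hw0 b hb.le, if_neg hb.ne', mul_zero]
  · rw [Matrix.add_mul, Matrix.mul_add, Matrix.one_mul, Matrix.mul_one, Matrix.smul_mul,
      Matrix.vecMulVec_mul, hwm]
    congr 1
    ext a b
    by_cases hb : b = q.succ
    · subst hb
      simp [Matrix.vecMulVec_apply, mul_comm]
    · simp [Matrix.vecMulVec_apply, hb, Ne.symm hb]
  · rw [glUSum_succ, Finset.sum_eq_single q]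
    · simp [Matrix.vecMulVec_apply, hw0, (Fin.castSucc_lt_succ).ne]
    · intro a _ ha
      rw [Matrix.add_apply, Matrix.one_apply, if_neg (Fin.castSucc_lt_succ).ne,
        Matrix.smul_apply, Matrix.vecMulVec_apply]
      rcases lt_or_gt_of_ne ha with h | h
      · rw [hw0 a.succ (Fin.succ_le_succ_iff.2 h.le), if_neg (fun h' => ha (Fin.succ_injective _ h').symm)]
        simp
      · rw [hcol a.castSucc (by rw [Fin.le_def]; simpa using h)]
        simp
    · simp

lemma upUnip_of_ne_zero (hφ : IsBesselLike ρ ψ φ) (h2 : (2 : F) ≠ 0) (hρ : ρ ≠ 0) (hψ : ψ ≠ 1)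
    {g : SO2l F (n + 1) ρ} {m : Matrix (Fin (n + 1)) (Fin (n + 1)) F}
    (hg : mat F g * Pmat F n = Pmat F n * m)
    (hm : m (Fin.last n) = (1 : Matrix _ _ F) (Fin.last n)) (h0 : φ g ≠ 0) : upUnip F m := by
  suffices h : ∀ i : Fin (n + 1), ∀ a j, i ≤ a → j ≤ a → m a j = if a = j then 1 else 0 from
    fun a j haj => h 0 a j (Fin.zero_le _) haj
  intro i
  induction i using Fin.reverseInduction with
  | last =>
    intro a j ha _
    rw [Fin.last_le_iff.1 ha, hm, Matrix.one_apply]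
  | cast q ih =>
    intro a j ha hj
    rcases ha.eq_or_lt with rfl | ha
    swap
    · exact ih a j (Fin.castSucc_lt_iff_succ_le.1 ha) hj
    have hk : j < q.succ := lt_of_le_of_lt hj Fin.castSucc_lt_succ
    have key : ∀ s : F, ψ (s * m q.castSucc j) = ψ (if (q.succ : ℕ) = j + 1 then s else 0) := by
      intro s
      obtain ⟨m', hm'u, hm'm, hm's⟩ := exists_unip_of_rows hk ih s
      obtain ⟨hnu, hns⟩ := glUSum_transvection_add hk s
      obtain ⟨u, hu, huP⟩ := exists_lift ρ h2 hρ hm'u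
      obtain ⟨v, hv, hvP⟩ := exists_lift ρ h2 hρ hnu
      have h3 : φ (u * g) = φ (g * v) := by
        refine hφ.eq_of_mul_Pmat h2 hρ ?_
        rw [mat_mul, mat_mul, Matrix.mul_assoc, hg, ← Matrix.mul_assoc, huP, Matrix.mul_assoc,
          hm'm, Matrix.mul_assoc, hvP, ← Matrix.mul_assoc, ← Matrix.mul_assoc, hg]
      rw [hφ.mul_left u hu, hφ.mul_right v hv, psiU_of_mul_Pmat ψ huP, psiU_of_mul_Pmat ψ hvP] at h3
      rw [← hm's, ← hns]
      exact mul_right_cancel₀ h0 h3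
    by_contra hne
    apply hψ
    set d := m q.castSucc j - if q.castSucc = j then 1 else 0 with hd
    have hd0 : d ≠ 0 := sub_ne_zero.2 hne
    ext x
    have hx := key (x * d⁻¹)
    have e1 : x = x * d⁻¹ * m q.castSucc j - if (q.succ : ℕ) = j + 1 then x * d⁻¹ else 0 := by
      have : (if (q.succ : ℕ) = j + 1 then x * d⁻¹ else 0) =
          x * d⁻¹ * if q.castSucc = j then 1 else 0 := by
        simp [Fin.ext_iff]
      rw [this, ← mul_sub, ← hd, inv_mul_cancel_right₀ hd0]
    rw [e1, AddChar.map_sub_eq_div, hx, div_self, AddChar.one_apply]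
    rw [← hx]
    exact (ψ.val_isUnit _).ne_zero

lemma eq_on_siegel (hφ : IsBesselLike ρ ψ φ) (hφ' : IsBesselLike ρ ψ φ') (h2 : (2 : F) ≠ 0)
    (hρ : ρ ≠ 0) (hψ : ψ ≠ 1) {g : SO2l F (n + 1) ρ} {m : Matrix (Fin (n + 1)) (Fin (n + 1)) F}
    (hg : mat F g * Pmat F n = Pmat F n * m)
    (hm : m (Fin.last n) = (1 : Matrix _ _ F) (Fin.last n)) : φ g = φ' g := by
  by_cases hu : upUnip F m
  · obtain ⟨u, hu, huP⟩ := exists_lift ρ h2 hρ hu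
    have h3 {θ : SO2l F (n + 1) ρ → ℂ} (hθ : IsBesselLike ρ ψ θ) :
        θ g = psiU F (n + 1) ψ (mat F u) := by
      rw [hθ.eq_of_mul_Pmat h2 hρ (hg.trans huP.symm), ← mul_one u, hθ.mul_left u hu, hθ.one,
        mul_one, mul_one]
    rw [h3 hφ, h3 hφ']
  · rw [not_imp_comm.1 (hφ.upUnip_of_ne_zero h2 hρ hψ hg hm) hu,
      not_imp_comm.1 (hφ'.upUnip_of_ne_zero h2 hρ hψ hg hm) hu]

end IsBesselLike

lemma isBesselLike_Bessel {V : Type*} [AddCommGroup V] [Module ℂ V]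
    {π : Representation ℂ (SO2l F (n + 1) ρ) V} {Γ : V →ₗ[ℂ] ℂ}
    (hΓ : IsWhittaker F (n + 1) ρ ψ π Γ) {v₀ : V} (hv : IsWhitVec F (n + 1) ρ ψ π Γ v₀) :
    IsBesselLike ρ ψ (Bessel F (n + 1) ρ π Γ v₀) where
  one := by simp [Bessel, hv.1]
  mul_left u hu g := by
    simp only [Bessel, map_mul, Module.End.mul_apply]
    rw [hΓ.2 u hu, mul_div_assoc]
  mul_right u hu g := by
    simp only [Bessel, map_mul, Module.End.mul_apply]
    rw [hv.2 u hu, map_smul, map_smul, smul_eq_mul, mul_div_assoc]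

end BesselLike

section Fibre

variable {F} {n : ℕ} {ρ : F} {ψ : AddChar F ℂ}

/-- In an isometry, the top part of the column `mid 1` is determined by the remaining parts. -/
lemma submatrix_fst_mid_eq {H N : Matrix (Fin (2 * (n + 1))) (Fin (2 * (n + 1))) F}
    (hH : H ∈ SOset F (2 * (n + 1)) (Jrho F (n + 1) ρ))
    (hN : N ∈ SOset F (2 * (n + 1)) (Jrho F (n + 1) ρ))
    (hu : IsUnit (N.submatrix (lstIdx (evenIdx n)) (fstIdx (evenIdx n))))
    (hc : H.submatrix id (fstIdx (evenIdx n)) = N.submatrix id (fstIdx (evenIdx n)))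
    {γ : Type*} {g : γ → Fin (2 * (n + 1))}
    (hm : H.submatrix (midIdx (evenIdx n)) g = N.submatrix (midIdx (evenIdx n)) g)
    (hl : H.submatrix (lstIdx (evenIdx n)) g = N.submatrix (lstIdx (evenIdx n)) g) :
    H.submatrix (fstIdx (evenIdx n)) g = N.submatrix (fstIdx (evenIdx n)) g := by
  have hr {κ : Type} (r : κ → Fin (2 * (n + 1))) :
      H.submatrix r (fstIdx (evenIdx n)) = N.submatrix r (fstIdx (evenIdx n)) := by
    ext i j
    exact congrFun (congrFun hc (r i)) j
  have e1 := congrArg (fun M => M.submatrix (fstIdx (evenIdx n)) g) (hH.2.trans hN.2.symm)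
  simp only [Jrho_eq] at e1
  rw [form_submatrix_three, form_submatrix_three, hm, hl, hr, hr, hr] at e1
  have e2 := add_left_cancel e1
  have hu' : IsUnit ((N.submatrix (lstIdx (evenIdx n)) (fstIdx (evenIdx n)))ᵀ * Jmat F n) :=
    ((Matrix.isUnit_transpose _).2 hu).mul (IsUnit.of_mul_eq_one _ Jmat_sq)
  rw [Matrix.isUnit_iff_isUnit_det] at hu'
  have e3 := congrArg (fun M => ((N.submatrix (lstIdx (evenIdx n))
    (fstIdx (evenIdx n)))ᵀ * Jmat F n)⁻¹ * M) e2
  simpa only [Matrix.nonsing_inv_mul_cancel_left _ _ hu'] using e3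

/-- A unipotent element of the unipotent radical, with trivial last middle coordinate, fixes
the columns of `Pmat`. -/
lemma upThree_mul_Pmat {y : Matrix (Fin n) (Fin 2) F} (hy : ∀ i, y i 1 = 0)
    (z : Matrix (Fin n) (Fin n) F) (y' : Matrix (Fin 2) (Fin n) F) :
    upThree (evenIdx n) 1 y z y' 1 * Pmat F n = Pmat F n := by
  obtain ⟨k1, k2, k3⟩ := upThree_mul (evenIdx n) 1 y z y' 1 (Pmat F n)
  have hl : (Pmat F n).submatrix (lstIdx (evenIdx n)) id = 0 := by
    ext i j
    exact Pmat_lst i j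
  have hm : y * (Pmat F n).submatrix (midIdx (evenIdx n)) id = 0 := by
    ext i j
    rw [Matrix.mul_apply, Fin.sum_univ_two, hy, zero_mul, add_zero]
    refine Fin.lastCases ?_ (fun j => ?_) j <;> simp [Pmat_mid_castSucc, Pmat_mid_last]
  rw [hl, Matrix.mul_zero, add_zero] at k1 k2
  rw [hl, Matrix.mul_zero] at k3
  rw [hm, add_zero, Matrix.one_mul] at k1
  refine rows_ext_three (evenIdx n) k1 k2 (k3.trans hl.symm)

lemma IsBesselLike.eq_of_blocks {φ : SO2l F (n + 1) ρ → ℂ} (hφ : IsBesselLike ρ ψ φ)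
    (h2 : (2 : F) ≠ 0) (hρ : ρ ≠ 0) {g k : SO2l F (n + 1) ρ}
    (hff : (mat F k).submatrix (fstIdx (evenIdx n)) (fstIdx (evenIdx n)) = 0)
    (hmf : (mat F k).submatrix (midIdx (evenIdx n)) (fstIdx (evenIdx n)) = 0)
    (hu : IsUnit ((mat F k).submatrix (lstIdx (evenIdx n)) (fstIdx (evenIdx n))))
    (hlm : ∀ i, mat F k (lstIdx (evenIdx n) i) (midIdx (evenIdx n) 1) = 0)
    (hlf' : (mat F g).submatrix (lstIdx (evenIdx n)) (fstIdx (evenIdx n)) =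
      (mat F k).submatrix (lstIdx (evenIdx n)) (fstIdx (evenIdx n)))
    (hmf' : ∀ j, mat F g (midIdx (evenIdx n) 1) (fstIdx (evenIdx n) j) = 0)
    (hlm' : ∀ i, mat F g (lstIdx (evenIdx n) i) (midIdx (evenIdx n) 1) = 0)
    (hmm' : ∀ i, mat F g (midIdx (evenIdx n) i) (midIdx (evenIdx n) 1) =
      mat F k (midIdx (evenIdx n) i) (midIdx (evenIdx n) 1)) :
    φ g = φ k := by
  have hSt : (midForm ρ)ᵀ = midForm ρ := Matrix.diagonal_transpose _
  have hiso : ∀ x : SO2l F (n + 1) ρ,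
      ((mat F x)ᵀ * formThree (evenIdx n) (Jmat F n) (midForm ρ) * mat F x).submatrix
        (fstIdx (evenIdx n)) (fstIdx (evenIdx n)) =
      (formThree (evenIdx n) (Jmat F n) (midForm ρ)).submatrix
        (fstIdx (evenIdx n)) (fstIdx (evenIdx n)) := fun x => by
    rw [← Jrho_eq, (mat_mem x).2]
  have hrel := (hiso g).trans (hiso k).symm
  rw [form_submatrix_three, form_submatrix_three, hlf', hmf, hff] at hrel
  obtain ⟨y, z, y', hy, e1, e2, hform⟩ := exists_upThree_move (evenIdx n)
    (transpose_Jmat (F := F) (m := n)) Jmat_sq hSt hu hrel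
  have hy'1 : ∀ j, y' 1 j = 0 := by
    intro j
    have : Matrix.vecMul (y' 1) ((mat F k).submatrix (lstIdx (evenIdx n)) (fstIdx (evenIdx n))) =
        0 := by
      ext j
      have := congrFun (congrFun e1 1) j
      rw [zero_add] at this
      exact this.trans (hmf' j)
    exact congrFun (Matrix.eq_zero_of_vecMul_eq_zero
      ((Matrix.isUnit_iff_isUnit_det _).1 hu).ne_zero this) j
  have hy1 : ∀ i, y i 1 = 0 := by
    intro i
    rw [hy, midForm, Matrix.neg_apply, Matrix.mul_diagonal, Matrix.mul_apply]
    simp [hy'1]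
  have hfix := upThree_mul_Pmat hy1 z y'
  set N := upThree (evenIdx n) 1 y z y' 1 with hN
  have hNdet : N.det = 1 := by simp [hN, det_upThree]
  have hNform : Nᵀ * Jrho F (n + 1) ρ * N = Jrho F (n + 1) ρ := by rw [Jrho_eq]; exact hform
  let x : SO2l F (n + 1) ρ :=
    ⟨Matrix.nonsingInvUnit N (by rw [hNdet]; exact isUnit_one), hNdet, hNform⟩
  have hx : mat F x = N := rfl
  rw [← (hφ.mul_fixer h2 hρ (h := x) hfix k).2]
  obtain ⟨k1, k2, k3⟩ := upThree_mul (evenIdx n) 1 y z y' 1 (mat F k)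
  rw [← hN, ← hx, ← mat_mul, Matrix.one_mul] at k1
  rw [← hN, ← hx, ← mat_mul] at k2
  rw [← hN, ← hx, ← mat_mul, Matrix.one_mul] at k3
  have hlf : (mat F (x * k)).submatrix (lstIdx (evenIdx n)) (fstIdx (evenIdx n)) =
      (mat F k).submatrix (lstIdx (evenIdx n)) (fstIdx (evenIdx n)) :=
    congrArg (fun M => M.submatrix id (fstIdx (evenIdx n))) k3
  have hcols : (mat F g).submatrix id (fstIdx (evenIdx n)) =
      (mat F (x * k)).submatrix id (fstIdx (evenIdx n)) := by
    refine rows_ext_three (evenIdx n) ?_ ?_ ?_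
    · refine e2.symm.trans ?_
      rw [← hff, ← hmf]
      exact (congrArg (fun M => M.submatrix id (fstIdx (evenIdx n))) k1).symm
    · refine e1.symm.trans ?_
      rw [← hmf]
      exact (congrArg (fun M => M.submatrix id (fstIdx (evenIdx n))) k2).symm
    · exact hlf'.trans hlf.symm
  have hl : ∀ i, mat F (x * k) (lstIdx (evenIdx n) i) (midIdx (evenIdx n) 1) = 0 := fun i =>
    (congrFun (congrFun k3 i) (midIdx (evenIdx n) 1)).trans (hlm i)
  have hm : ∀ i, mat F (x * k) (midIdx (evenIdx n) i) (midIdx (evenIdx n) 1) =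
      mat F k (midIdx (evenIdx n) i) (midIdx (evenIdx n) 1) := fun i => by
    refine (congrFun (congrFun k2 i) (midIdx (evenIdx n) 1)).trans ?_
    rw [Matrix.add_apply, Matrix.mul_apply (M := y')]
    simp [hlm]
  have hf := submatrix_fst_mid_eq (mat_mem g) (mat_mem (x * k)) (by rw [hlf]; exact hu) hcols
    (g := fun _ : Unit => midIdx (evenIdx n) 1)
    (by ext i j; exact (hmm' i).trans (hm i).symm)
    (by ext i j; exact (hlm' i).trans (hl i).symm)
  refine hφ.eq_of_mul_Pmat h2 hρ ?_
  ext i j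
  refine Fin.lastCases ?_ (fun j => ?_) j
  · rw [mul_Pmat_last, mul_Pmat_last]
    congr 1
    revert i
    rw [forall_three (evenIdx n)]
    exact ⟨fun i => congrFun (congrFun hf i) (), fun i => (hmm' i).trans (hm i).symm,
      fun i => (hlm' i).trans (hl i).symm⟩
  · rw [mul_Pmat_castSucc, mul_Pmat_castSucc]
    exact congrFun (congrFun hcols i) j

end Fibre

section Flip

variable {F} {n : ℕ} {ρ : F} {ψ : AddChar F ℂ}

lemma matFun_apply {G M R : Type*} [Zero R] {c : G → M} (hc : Function.Injective c) (φ : G → R)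
    (g : G) : matFun c φ (c g) = φ g := by
  have h : ∃ g', c g' = c g := ⟨g, rfl⟩
  rw [matFun, dif_pos h, hc h.choose_spec]

variable (F n) in
/-- The reflection changing the sign of the coordinate `mid 0`. -/
def flipMat : Matrix (Fin (2 * (n + 1))) (Fin (2 * (n + 1))) F :=
  Matrix.diagonal fun i => if (i : ℕ) = n then -1 else 1

lemma flipMat_mul_self : flipMat F n * flipMat F n = 1 := by
  rw [flipMat, Matrix.diagonal_mul_diagonal, ← Matrix.diagonal_one]
  congr 1
  ext i
  split_ifs <;> simp

lemma flipMat_mul_apply {μ : Type*} (H : Matrix (Fin (2 * (n + 1))) μ F) (i j) :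
    (flipMat F n * H) i j = (if (i : ℕ) = n then -1 else 1) * H i j :=
  Matrix.diagonal_mul _ _ _ _

lemma mul_flipMat_apply {μ : Type*} (H : Matrix μ (Fin (2 * (n + 1))) F) (i j) :
    (H * flipMat F n) i j = H i j * (if (j : ℕ) = n then -1 else 1) :=
  Matrix.mul_diagonal _ _ _ _

lemma flipMat_mul_Pmat : flipMat F n * Pmat F n = Pmat F n := by
  ext i j
  rw [flipMat_mul_apply]
  have := j.isLt
  simp only [Pmat, Matrix.of_apply]
  split_ifs <;> first | omega | simp

lemma flipMat_Jrho : flipMat F n * Jrho F (n + 1) ρ * flipMat F n = Jrho F (n + 1) ρ := by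
  ext i j
  rw [mul_flipMat_apply, flipMat_mul_apply]
  have h : (Jrho F (n + 1) ρ i j ≠ 0) → ((i : ℕ) = n ↔ (j : ℕ) = n) := by
    have := i.isLt
    have := j.isLt
    rw [Dmat_evenIdx]
    simp only [Dmat, Matrix.of_apply, Fin.ext_iff, Fin.val_rev]
    split_ifs <;> first | omega | simp
  by_cases h0 : Jrho F (n + 1) ρ i j = 0
  · rw [h0]; simp
  · by_cases hi : (i : ℕ) = n
    · rw [if_pos hi, if_pos ((h h0).1 hi)]; ring
    · rw [if_neg hi, if_neg (mt (h h0).2 hi)]; ring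

lemma Pmat_transpose_Jrho_flipMat :
    (Pmat F n)ᵀ * Jrho F (n + 1) ρ * flipMat F n = (Pmat F n)ᵀ * Jrho F (n + 1) ρ := by
  conv_lhs => rw [← flipMat_mul_Pmat]
  rw [Matrix.transpose_mul, show (flipMat F n)ᵀ = flipMat F n from Matrix.diagonal_transpose _,
    Matrix.mul_assoc, Matrix.mul_assoc, ← Matrix.mul_assoc (flipMat F n), flipMat_Jrho]

/-- Conjugation of `SO_{2l}` by the reflection `flipMat`. -/
def flipConj (g : SO2l F (n + 1) ρ) : SO2l F (n + 1) ρ :=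
  have hd : (flipMat F n * mat F g * flipMat F n).det = 1 := by
    rw [Matrix.det_mul, Matrix.det_mul, (mat_mem g).1, mul_one, ← Matrix.det_mul,
      flipMat_mul_self, Matrix.det_one]
  ⟨Matrix.nonsingInvUnit (flipMat F n * mat F g * flipMat F n) (by rw [hd]; exact isUnit_one), hd, by
    change (flipMat F n * mat F g * flipMat F n)ᵀ * Jrho F (n + 1) ρ *
      (flipMat F n * mat F g * flipMat F n) = _
    rw [Matrix.transpose_mul, Matrix.transpose_mul,
      show (flipMat F n)ᵀ = flipMat F n from Matrix.diagonal_transpose _]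
    calc flipMat F n * ((mat F g)ᵀ * flipMat F n) * Jrho F (n + 1) ρ *
          (flipMat F n * mat F g * flipMat F n)
        = flipMat F n * ((mat F g)ᵀ * (flipMat F n * Jrho F (n + 1) ρ * flipMat F n) *
            mat F g) * flipMat F n := by simp only [Matrix.mul_assoc]
      _ = Jrho F (n + 1) ρ := by rw [flipMat_Jrho, (mat_mem g).2, flipMat_Jrho]⟩

lemma mat_flipConj (g : SO2l F (n + 1) ρ) :
    mat F (flipConj g) = flipMat F n * mat F g * flipMat F n := rfl

lemma flipConj_flipConj (g : SO2l F (n + 1) ρ) : flipConj (flipConj g) = g := by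
  apply mat_injective
  rw [mat_flipConj, mat_flipConj, Matrix.mul_assoc, Matrix.mul_assoc, Matrix.mul_assoc,
    flipMat_mul_self, Matrix.mul_one, ← Matrix.mul_assoc, flipMat_mul_self, Matrix.one_mul]

lemma BesselConj_eq (φ : SO2l F (n + 1) ρ → ℂ) (g : SO2l F (n + 1) ρ) :
    BesselConj F (n + 1) ρ φ g = φ (flipConj g) := by
  have ht : tTildeMat F (n + 1) * tTildeMat F (n + 1) = 1 := by
    have : tTildeMat F (n + 1) = Matrix.diagonal fun i : Fin (2 * (n + 1)) =>
        if (i : ℕ) = n ∨ (i : ℕ) = n + 1 then (-1 : F) else 1 := by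
      ext i j
      rw [Matrix.diagonal_apply]
      rfl
    rw [this, Matrix.diagonal_mul_diagonal, ← Matrix.diagonal_one]
    congr 1
    ext i
    split_ifs <;> simp
  have hinv : (tTildeMat F (n + 1))⁻¹ = tTildeMat F (n + 1) := Matrix.inv_eq_left_inv ht
  have hc : cMat F (n + 1) = Matrix.diagonal fun i : Fin (2 * (n + 1)) =>
      if (i : ℕ) = n + 1 then (-1 : F) else 1 := by
    ext i j
    rw [Matrix.diagonal_apply]
    rfl
  have htd : tTildeMat F (n + 1) = Matrix.diagonal fun i : Fin (2 * (n + 1)) =>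
      if (i : ℕ) = n ∨ (i : ℕ) = n + 1 then (-1 : F) else 1 := by
    ext i j
    rw [Matrix.diagonal_apply]
    rfl
  have h1 : cMat F (n + 1) * tTildeMat F (n + 1) = flipMat F n := by
    rw [hc, htd, Matrix.diagonal_mul_diagonal, flipMat]
    congr 1
    ext i
    split_ifs <;> first | omega | simp
  have h2 : tTildeMat F (n + 1) * cMat F (n + 1) = flipMat F n := by
    rw [hc, htd, Matrix.diagonal_mul_diagonal, flipMat]
    congr 1
    ext i
    split_ifs <;> first | omega | simp
  rw [BesselConj, hinv, h1, Matrix.mul_assoc, h2, ← mat_flipConj]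
  exact matFun_apply mat_injective φ _

/-- The Gram matrix of the columns of `Pmat` with their images under `H`. -/
def gramMat (ρ : F) (H : Matrix (Fin (2 * (n + 1))) (Fin (2 * (n + 1))) F) :
    Matrix (Fin (n + 1)) (Fin (n + 1)) F :=
  (Pmat F n)ᵀ * Jrho F (n + 1) ρ * H * Pmat F n

lemma gramMat_flipConj (g : SO2l F (n + 1) ρ) :
    gramMat ρ (mat F (flipConj g)) = gramMat ρ (mat F g) := by
  rw [gramMat, gramMat, mat_flipConj]
  calc (Pmat F n)ᵀ * Jrho F (n + 1) ρ * (flipMat F n * mat F g * flipMat F n) * Pmat F n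
      = (Pmat F n)ᵀ * Jrho F (n + 1) ρ * flipMat F n * mat F g * (flipMat F n * Pmat F n) := by
        simp only [Matrix.mul_assoc]
    _ = _ := by rw [flipMat_mul_Pmat, Pmat_transpose_Jrho_flipMat]

lemma gramMat_eq (H : Matrix (Fin (2 * (n + 1))) (Fin (2 * (n + 1))) F) :
    gramMat ρ H = ((Jrho F (n + 1) ρ * H * Pmat F n)ᵀ * Pmat F n)ᵀ := by
  rw [Matrix.transpose_mul, Matrix.transpose_transpose, gramMat]
  simp only [Matrix.mul_assoc]

lemma gramMat_castSucc_castSucc (H : Matrix (Fin (2 * (n + 1))) (Fin (2 * (n + 1))) F)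
    (i j : Fin n) : gramMat ρ H i.castSucc j.castSucc =
      H (lstIdx (evenIdx n) i.rev) (fstIdx (evenIdx n) j) := by
  rw [gramMat_eq, Matrix.transpose_apply, mul_Pmat_castSucc, Matrix.transpose_apply,
    mul_Pmat_castSucc, form_row_fst]

lemma gramMat_castSucc_last (H : Matrix (Fin (2 * (n + 1))) (Fin (2 * (n + 1))) F)
    (i : Fin n) : gramMat ρ H i.castSucc (Fin.last n) =
      H (lstIdx (evenIdx n) i.rev) (midIdx (evenIdx n) 1) * 2⁻¹ := by
  rw [gramMat_eq, Matrix.transpose_apply, mul_Pmat_castSucc, Matrix.transpose_apply,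
    mul_Pmat_last, form_row_fst]

lemma gramMat_last_castSucc (H : Matrix (Fin (2 * (n + 1))) (Fin (2 * (n + 1))) F)
    (j : Fin n) : gramMat ρ H (Fin.last n) j.castSucc =
      -ρ * H (midIdx (evenIdx n) 1) (fstIdx (evenIdx n) j) * 2⁻¹ := by
  rw [gramMat_eq, Matrix.transpose_apply, mul_Pmat_last, Matrix.transpose_apply,
    mul_Pmat_castSucc, form_row_mid]
  rfl

lemma gramMat_last_last (H : Matrix (Fin (2 * (n + 1))) (Fin (2 * (n + 1))) F) :
    gramMat ρ H (Fin.last n) (Fin.last n) =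
      -ρ * H (midIdx (evenIdx n) 1) (midIdx (evenIdx n) 1) * 2⁻¹ * 2⁻¹ := by
  rw [gramMat_eq, Matrix.transpose_apply, mul_Pmat_last, Matrix.transpose_apply,
    mul_Pmat_last, form_row_mid]
  rfl

lemma entries_of_gramMat (h2 : (2 : F) ≠ 0) (hρ : ρ ≠ 0)
    {H K : Matrix (Fin (2 * (n + 1))) (Fin (2 * (n + 1))) F} (h : gramMat ρ H = gramMat ρ K) :
    (∀ i j, H (lstIdx (evenIdx n) i) (fstIdx (evenIdx n) j) =
        K (lstIdx (evenIdx n) i) (fstIdx (evenIdx n) j)) ∧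
    (∀ i, H (lstIdx (evenIdx n) i) (midIdx (evenIdx n) 1) =
        K (lstIdx (evenIdx n) i) (midIdx (evenIdx n) 1)) ∧
    (∀ j, H (midIdx (evenIdx n) 1) (fstIdx (evenIdx n) j) =
        K (midIdx (evenIdx n) 1) (fstIdx (evenIdx n) j)) ∧
    H (midIdx (evenIdx n) 1) (midIdx (evenIdx n) 1) =
        K (midIdx (evenIdx n) 1) (midIdx (evenIdx n) 1) := by
  have h2' : (2⁻¹ : F) ≠ 0 := inv_ne_zero h2
  have hρ' : -ρ ≠ 0 := neg_ne_zero.2 hρ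
  refine ⟨fun i j => ?_, fun i => ?_, fun j => ?_, ?_⟩
  · have := congrFun (congrFun h i.rev.castSucc) j.castSucc
    rwa [gramMat_castSucc_castSucc, gramMat_castSucc_castSucc, Fin.rev_rev] at this
  · have := congrFun (congrFun h i.rev.castSucc) (Fin.last n)
    rw [gramMat_castSucc_last, gramMat_castSucc_last, Fin.rev_rev] at this
    exact mul_right_cancel₀ h2' this
  · have := congrFun (congrFun h (Fin.last n)) j.castSucc
    rw [gramMat_last_castSucc, gramMat_last_castSucc] at this
    exact mul_left_cancel₀ hρ' (mul_right_cancel₀ h2' this)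
  · have := congrFun (congrFun h (Fin.last n)) (Fin.last n)
    rw [gramMat_last_last, gramMat_last_last] at this
    exact mul_left_cancel₀ hρ' (mul_right_cancel₀ h2' (mul_right_cancel₀ h2' this))

/-- The shape of the torus times Weyl elements under consideration. -/
structure IsBig (H : Matrix (Fin (2 * (n + 1))) (Fin (2 * (n + 1))) F) : Prop where
  fst_fst : H.submatrix (fstIdx (evenIdx n)) (fstIdx (evenIdx n)) = 0
  mid_fst : H.submatrix (midIdx (evenIdx n)) (fstIdx (evenIdx n)) = 0
  lst_mid : ∀ i, H (lstIdx (evenIdx n) i) (midIdx (evenIdx n) 1) = 0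
  isUnit : IsUnit (H.submatrix (lstIdx (evenIdx n)) (fstIdx (evenIdx n)))

lemma IsBig.flipConj {k : SO2l F (n + 1) ρ} (hk : IsBig (mat F k)) :
    IsBig (mat F (flipConj k)) := by
  have key : ∀ i j, mat F (ConverseSO.flipConj k) i j =
      (if (i : ℕ) = n then -1 else 1) * mat F k i j * (if (j : ℕ) = n then -1 else 1) := fun i j => by
    rw [mat_flipConj, mul_flipMat_apply, flipMat_mul_apply]
  have hf : ∀ i : Fin n, ¬ ((fstIdx (evenIdx n) i : Fin (2 * (n + 1))) : ℕ) = n := fun i => by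
    rw [fstIdx_evenIdx]; have := i.isLt; omega
  have hl : ∀ i : Fin n, ¬ ((lstIdx (evenIdx n) i : Fin (2 * (n + 1))) : ℕ) = n := fun i => by
    rw [lstIdx_evenIdx]; omega
  refine ⟨?_, ?_, fun i => ?_, ?_⟩
  · ext i j
    have : mat F k (fstIdx (evenIdx n) i) (fstIdx (evenIdx n) j) = 0 :=
      congrFun (congrFun hk.fst_fst i) j
    simp [key, this]
  · ext i j
    have : mat F k (midIdx (evenIdx n) i) (fstIdx (evenIdx n) j) = 0 :=
      congrFun (congrFun hk.mid_fst i) j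
    simp [key, this]
  · simp [key, hk.lst_mid]
  · convert hk.isUnit using 1
    ext i j
    simp [key, hf, hl]

lemma mid_mid_sq {g : SO2l F (n + 1) ρ}
    (hl : ∀ i, mat F g (lstIdx (evenIdx n) i) (midIdx (evenIdx n) 1) = 0) :
    mat F g (midIdx (evenIdx n) 0) (midIdx (evenIdx n) 1) ^ 2 =
      ρ * mat F g (midIdx (evenIdx n) 1) (midIdx (evenIdx n) 1) ^ 2 - ρ := by
  have h := congrFun (congrFun (mat_mem g).2 (midIdx (evenIdx n) 1)) (midIdx (evenIdx n) 1)
  have hJ : Jrho F (n + 1) ρ (midIdx (evenIdx n) 1) (midIdx (evenIdx n) 1) = -ρ := by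
    have := form_row_mid ρ 1 1 (midIdx (evenIdx n) 1)
    rw [Matrix.mul_one, Matrix.one_apply_eq, mul_one] at this
    exact this
  rw [hJ, Matrix.mul_assoc, Matrix.mul_apply, sum_three (evenIdx n)] at h
  simp only [form_row_fst, form_row_mid, Matrix.transpose_apply, hl, mul_zero, zero_mul,
    Finset.sum_const_zero, zero_add, add_zero, Fin.sum_univ_two, Matrix.cons_val_zero,
    Matrix.cons_val_one] at h
  linear_combination h

lemma IsBesselLike.add_flipConj_eq {φ : SO2l F (n + 1) ρ → ℂ} (hφ : IsBesselLike ρ ψ φ)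
    (h2 : (2 : F) ≠ 0) (hρ : ρ ≠ 0) {g k : SO2l F (n + 1) ρ} (hk : IsBig (mat F k))
    (h : gramMat ρ (mat F g) = gramMat ρ (mat F k)) :
    φ g + φ (flipConj g) = φ k + φ (flipConj k) := by
  have key : ∀ {g k : SO2l F (n + 1) ρ}, IsBig (mat F k) →
      gramMat ρ (mat F g) = gramMat ρ (mat F k) →
      mat F g (midIdx (evenIdx n) 0) (midIdx (evenIdx n) 1) =
        mat F k (midIdx (evenIdx n) 0) (midIdx (evenIdx n) 1) → φ g = φ k := by
    intro g k hk h h0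
    obtain ⟨e1, e2, e3, e4⟩ := entries_of_gramMat h2 hρ h
    refine hφ.eq_of_blocks h2 hρ hk.fst_fst hk.mid_fst hk.isUnit hk.lst_mid ?_ ?_ ?_ ?_
    · ext i j
      exact e1 i j
    · exact fun j => (e3 j).trans (congrFun (congrFun hk.mid_fst 1) j)
    · exact fun i => (e2 i).trans (hk.lst_mid i)
    · intro i
      fin_cases i
      exacts [h0, e4]
  have hflip : ∀ x : SO2l F (n + 1) ρ,
      mat F (flipConj x) (midIdx (evenIdx n) 0) (midIdx (evenIdx n) 1) =
        -mat F x (midIdx (evenIdx n) 0) (midIdx (evenIdx n) 1) := fun x => by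
    rw [mat_flipConj, mul_flipMat_apply, flipMat_mul_apply]
    simp [midIdx_evenIdx]
  obtain ⟨-, e2, -, e4⟩ := entries_of_gramMat h2 hρ h
  have hsq := mid_mid_sq (fun i => (e2 i).trans (hk.lst_mid i))
  rw [e4, ← mid_mid_sq hk.lst_mid] at hsq
  rcases sq_eq_sq_iff_eq_or_eq_neg.1 hsq with h0 | h0
  · rw [key hk h h0, key (g := flipConj g) hk.flipConj
      (by rw [gramMat_flipConj, gramMat_flipConj, h]) (by rw [hflip, hflip, h0])]
  · rw [add_comm, key (g := flipConj g) hk (by rw [gramMat_flipConj, h])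
      (by rw [hflip, h0, neg_neg]), key (g := g) hk.flipConj
      (by rw [gramMat_flipConj, h]) (by rw [hflip, h0])]

end Flip

section BigCell

variable {F} {n : ℕ} {ρ : F}

/-- The invariant of `g` evaluated by the intertwining operator. -/
def bigCell (ρ : F) (H : Matrix (Fin (2 * (n + 1))) (Fin (2 * (n + 1))) F) :
    Matrix (Fin (n + 1)) (Fin (n + 1)) F :=
  dnMat F (n + 1) * (wllEmb ρ H).submatrix (lstIdx (oddIdx (n + 1))) (fstIdx (oddIdx (n + 1)))

lemma bigCell_eq (h2 : (2 : F) ≠ 0) (hρ : ρ ≠ 0)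
    (H : Matrix (Fin (2 * (n + 1))) (Fin (2 * (n + 1))) F) :
    bigCell ρ H = dnMat F (n + 1) * (Jmat F (n + 1) *
      ((ρ / 2)⁻¹ • (gramMat ρ H + (ρ * (2⁻¹ * 2⁻¹)) • lastUnit F n))) := by
  rw [bigCell, wllEmb_lst_fst ρ h2 hρ]
  rfl

lemma bigCell_eq_iff (h2 : (2 : F) ≠ 0) (hρ : ρ ≠ 0)
    {H K : Matrix (Fin (2 * (n + 1))) (Fin (2 * (n + 1))) F} :
    bigCell ρ H = bigCell ρ K ↔ gramMat ρ H = gramMat ρ K := by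
  refine ⟨fun h => ?_, fun h => by rw [bigCell_eq h2 hρ, bigCell_eq h2 hρ, h]⟩
  rw [bigCell_eq h2 hρ, bigCell_eq h2 hρ] at h
  have h1 := congrArg (fun M => Jmat F (n + 1) * (dnMat F (n + 1) * M)) h
  simp only [← Matrix.mul_assoc (dnMat F (n + 1)) (dnMat F (n + 1)), dnMat_sq, Matrix.one_mul] at h1
  simp only [← Matrix.mul_assoc (Jmat F (n + 1)) (Jmat F (n + 1)), Jmat_sq, Matrix.one_mul] at h1
  exact add_right_cancel (smul_right_injective _ (inv_ne_zero (div_ne_zero hρ h2)) h1)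

lemma transpose_mul_lastUnit {m : Matrix (Fin (n + 1)) (Fin (n + 1)) F} (hm : upUnip F m) :
    mᵀ * lastUnit F n = lastUnit F n := by
  have hlast : ∀ i, m (Fin.last n) i = if i = Fin.last n then 1 else 0 := fun i => by
    rw [hm _ _ (Fin.val_fin_le.2 (Fin.le_last i))]
    simp only [eq_comm]
  ext i j
  rw [lastUnit, Matrix.mul_apply, Finset.sum_eq_single (Fin.last n) (fun k _ hk => ?_) (by simp),
    Matrix.transpose_apply, hlast i]
  · by_cases hi : i = Fin.last n
    · rw [if_pos hi, one_mul, hi]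
    · rw [if_neg hi, zero_mul, Matrix.single_apply, if_neg fun h => hi h.1.symm]
  · rw [Matrix.single_apply (Fin.last n) (Fin.last n) (1 : F) k j, if_neg fun h => hk h.1.symm,
      mul_zero]

lemma bigCell_mul (h2 : (2 : F) ≠ 0) (hρ : ρ ≠ 0) {u : SO2l F (n + 1) ρ}
    {m : Matrix (Fin (n + 1)) (Fin (n + 1)) F} (hm : upUnip F m)
    (hu : mat F u * Pmat F n = Pmat F n * m)
    (H : Matrix (Fin (2 * (n + 1))) (Fin (2 * (n + 1))) F) :
    bigCell ρ (mat F u * H) =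
      dnMat F (n + 1) * aStar F (n + 1) m * dnMat F (n + 1) * bigCell ρ H := by
  have hmd : IsUnit mᵀ.det := by rw [Matrix.det_transpose, hm.det_eq_one]; exact isUnit_one
  have hg : mᵀ * gramMat ρ (mat F u * H) = gramMat ρ H := by
    calc mᵀ * gramMat ρ (mat F u * H)
        = (Pmat F n * m)ᵀ * Jrho F (n + 1) ρ * mat F u * H * Pmat F n := by
          rw [gramMat, Matrix.transpose_mul]
          simp only [Matrix.mul_assoc]
      _ = (Pmat F n)ᵀ * ((mat F u)ᵀ * Jrho F (n + 1) ρ * mat F u) * H * Pmat F n := by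
          rw [← hu, Matrix.transpose_mul]
          simp only [Matrix.mul_assoc]
      _ = gramMat ρ H := by rw [(mat_mem u).2, gramMat]
  set N := (ρ / 2)⁻¹ • (gramMat ρ (mat F u * H) + (ρ * (2⁻¹ * 2⁻¹)) • lastUnit F n) with hN
  set N' := (ρ / 2)⁻¹ • (gramMat ρ H + (ρ * (2⁻¹ * 2⁻¹)) • lastUnit F n) with hN'
  have hNN : N = (m⁻¹)ᵀ * N' := by
    have : mᵀ * N = N' := by
      rw [hN, hN', Matrix.mul_smul, Matrix.mul_add, hg, Matrix.mul_smul, transpose_mul_lastUnit hm]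
    rw [← this, Matrix.transpose_nonsing_inv, Matrix.nonsing_inv_mul_cancel_left _ _ hmd]
  rw [bigCell_eq h2 hρ, bigCell_eq h2 hρ, ← hN, ← hN', hNN, aStar]
  have hJ : ∀ M : Matrix (Fin (n + 1)) (Fin (n + 1)) F,
      Jmat F (n + 1) * (Jmat F (n + 1) * M) = M := fun M => by
    rw [← Matrix.mul_assoc, Jmat_sq, Matrix.one_mul]
  have hd : ∀ M : Matrix (Fin (n + 1)) (Fin (n + 1)) F,
      dnMat F (n + 1) * (dnMat F (n + 1) * M) = M := fun M => by
    rw [← Matrix.mul_assoc, dnMat_sq, Matrix.one_mul]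
  simp only [Matrix.mul_assoc, hd, hJ]

lemma isUnit_bigCell (h2 : (2 : F) ≠ 0) (hρ : ρ ≠ 0)
    {H : Matrix (Fin (2 * (n + 1))) (Fin (2 * (n + 1))) F} (hH : IsBig H)
    (ha : H (midIdx (evenIdx n) 1) (midIdx (evenIdx n) 1) ≠ 1) : IsUnit (bigCell ρ H) := by
  rw [bigCell_eq h2 hρ]
  refine (IsUnit.of_mul_eq_one _ dnMat_sq).mul ((IsUnit.of_mul_eq_one _ Jmat_sq).mul ?_)
  rw [← Matrix.mulVec_injective_iff_isUnit]
  refine (injective_iff_map_eq_zero (Matrix.mulVecLin _)).2 fun v hv => ?_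
  replace hv : (gramMat ρ H + (ρ * (2⁻¹ * 2⁻¹)) • lastUnit F n) *ᵥ v = 0 := by
    rw [Matrix.mulVecLin_apply, Matrix.smul_mulVec] at hv
    exact (smul_eq_zero.1 hv).resolve_left (inv_ne_zero (div_ne_zero hρ h2))
  have hl : v (Fin.last n) = 0 := by
    have h := congrFun hv (Fin.last n)
    have hmf : ∀ j, H (midIdx (evenIdx n) 1) (fstIdx (evenIdx n) j) = 0 := fun j =>
      congrFun (congrFun hH.mid_fst 1) j
    simp only [Matrix.mulVec, dotProduct, Fin.sum_univ_castSucc, Matrix.add_apply,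
      gramMat_last_castSucc, gramMat_last_last, hmf, lastUnit, Matrix.smul_apply,
      Matrix.single_apply, Pi.zero_apply] at h
    simp only [(Fin.castSucc_lt_last _).ne', and_false, if_false, if_true, and_self, mul_zero,
      smul_eq_mul, zero_mul, add_zero, Finset.sum_const_zero, zero_add, mul_one] at h
    have h' : ρ * (2⁻¹ * 2⁻¹) * (1 - H (midIdx (evenIdx n) 1) (midIdx (evenIdx n) 1)) *
        v (Fin.last n) = 0 := by linear_combination h
    refine (mul_eq_zero.1 h').resolve_left (mul_ne_zero (mul_ne_zero hρ
      (mul_ne_zero (inv_ne_zero h2) (inv_ne_zero h2))) (sub_ne_zero.2 ha.symm))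
  have hc : (H.submatrix (lstIdx (evenIdx n)) (fstIdx (evenIdx n))) *ᵥ
      (fun j => v j.castSucc) = 0 := by
    ext i
    have h := congrFun hv i.rev.castSucc
    simp only [Matrix.mulVec, dotProduct, Fin.sum_univ_castSucc, Matrix.add_apply,
      gramMat_castSucc_castSucc, hl, mul_zero, add_zero, lastUnit, Matrix.smul_apply,
      Matrix.single_apply, Pi.zero_apply, Fin.rev_rev, (Fin.castSucc_lt_last _).ne', and_false,
      if_false, smul_zero] at h
    exact h
  have hv' := Matrix.mulVec_injective_of_isUnit hH.isUnit (hc.trans (Matrix.mulVec_zero _).symm)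
  ext j
  refine Fin.lastCases hl (fun j => ?_) j
  exact congrFun hv' j

lemma weyl_apply {s : Matrix (Fin n) (Fin n) F} :
    (∀ i j, (tnMat F (n + 1) n s * wTildeMat F (n + 1) n)
      (fstIdx (evenIdx n) i) (fstIdx (evenIdx n) j) = 0) ∧
    (∀ i j, (tnMat F (n + 1) n s * wTildeMat F (n + 1) n)
      (midIdx (evenIdx n) i) (fstIdx (evenIdx n) j) = 0) ∧
    (∀ i j, (tnMat F (n + 1) n s * wTildeMat F (n + 1) n)
      (lstIdx (evenIdx n) i) (midIdx (evenIdx n) j) = 0) ∧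
    ∀ i, (tnMat F (n + 1) n s * wTildeMat F (n + 1) n)
      (midIdx (evenIdx n) i) (midIdx (evenIdx n) 1) = if i = 1 then 1 else 0 := by
  refine ⟨fun i j => ?_, fun i j => ?_, fun i j => ?_, fun i => ?_⟩
  · rw [Matrix.mul_apply]
    refine Finset.sum_eq_zero fun x _ => ?_
    have := i.isLt
    have := j.isLt
    simp only [tnMat, wTildeMat, Matrix.of_apply, Fin.ext_iff, fstIdx_evenIdx]
    split_ifs <;> first | omega | simp
  · rw [Matrix.mul_apply]
    refine Finset.sum_eq_zero fun x _ => ?_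
    have := i.isLt
    have := j.isLt
    simp only [tnMat, wTildeMat, Matrix.of_apply, Fin.ext_iff, fstIdx_evenIdx, midIdx_evenIdx]
    split_ifs <;> first | omega | simp
  · rw [Matrix.mul_apply]
    refine Finset.sum_eq_zero fun x _ => ?_
    have := i.isLt
    have := j.isLt
    simp only [tnMat, wTildeMat, Matrix.of_apply, Fin.ext_iff, lstIdx_evenIdx, midIdx_evenIdx]
    split_ifs <;> first | omega | simp
  · rw [Matrix.mul_apply, Finset.sum_eq_single (midIdx (evenIdx n) i) (fun x _ hx => ?_) (by simp)]
    · have hn : n + 1 < 2 * (n + 1) - n := by omega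
      fin_cases i <;>
      · simp only [tnMat, wTildeMat, Matrix.of_apply, Fin.ext_iff, midIdx_evenIdx]
        simp [hn]
    · have := i.isLt
      rw [Ne, Fin.ext_iff, midIdx_evenIdx] at hx
      simp only [tnMat, Matrix.of_apply, Fin.ext_iff, midIdx_evenIdx]
      split_ifs <;> first | omega | simp

lemma isBig_torus_mul_weyl {k : SO2l F (n + 1) ρ} {tv : ℕ → Fˣ} {a b : F}
    {s : Matrix (Fin n) (Fin n) F}
    (hk : mat F k = torusMat F (n + 1) ρ tv a b * (tnMat F (n + 1) n s * wTildeMat F (n + 1) n)) :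
    IsBig (mat F k) ∧ mat F k (midIdx (evenIdx n) 1) (midIdx (evenIdx n) 1) = a := by
  obtain ⟨w1, w2, w3, w4⟩ := weyl_apply (n := n) (s := s)
  set W := tnMat F (n + 1) n s * wTildeMat F (n + 1) n with hW
  have tf : ∀ i, ∃ c : F, ∀ j, mat F k (fstIdx (evenIdx n) i) j =
      c * W (fstIdx (evenIdx n) i) j := by
    refine fun i => ⟨tv i, fun j => ?_⟩
    rw [hk, Matrix.mul_apply, Finset.sum_eq_single (fstIdx (evenIdx n) i) (fun x _ hx => ?_)
      (by simp)]
    · simp [torusMat, fstIdx_evenIdx]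
    · have := i.isLt
      simp only [torusMat, Matrix.of_apply, if_neg hx.symm, fstIdx_evenIdx]
      split_ifs <;> first | omega | simp
  have tl : ∀ i, ∃ c : F, ∀ j, mat F k (lstIdx (evenIdx n) i) j =
      c * W (lstIdx (evenIdx n) i) j := by
    refine fun i => ⟨torusMat F (n + 1) ρ tv a b (lstIdx (evenIdx n) i) (lstIdx (evenIdx n) i),
      fun j => ?_⟩
    rw [hk, Matrix.mul_apply, Finset.sum_eq_single (lstIdx (evenIdx n) i) (fun x _ hx => ?_)
      (by simp)]
    have := i.isLt
    simp only [torusMat, Matrix.of_apply, if_neg hx.symm, lstIdx_evenIdx]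
    split_ifs <;> first | omega | simp
  have tm : ∀ i : Fin 2, ∀ j, mat F k (midIdx (evenIdx n) i) j =
      torusMat F (n + 1) ρ tv a b (midIdx (evenIdx n) i) (midIdx (evenIdx n) 0) *
        W (midIdx (evenIdx n) 0) j +
      torusMat F (n + 1) ρ tv a b (midIdx (evenIdx n) i) (midIdx (evenIdx n) 1) *
        W (midIdx (evenIdx n) 1) j := by
    intro i j
    rw [hk, Matrix.mul_apply, sum_three (evenIdx n), Fin.sum_univ_two, Finset.sum_eq_zero,
      Finset.sum_eq_zero, zero_add, add_zero]
    · intro x _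
      have := i.isLt
      simp only [torusMat, Matrix.of_apply, lstIdx_evenIdx, midIdx_evenIdx, Fin.ext_iff]
      split_ifs <;> first | omega | simp
    · intro x _
      have := i.isLt
      have := x.isLt
      simp only [torusMat, Matrix.of_apply, fstIdx_evenIdx, midIdx_evenIdx, Fin.ext_iff]
      split_ifs <;> first | omega | simp
  have hff : (mat F k).submatrix (fstIdx (evenIdx n)) (fstIdx (evenIdx n)) = 0 := by
    ext i j
    obtain ⟨c, hc⟩ := tf i
    exact (hc _).trans (by rw [w1, mul_zero]; rfl)
  have hmf : (mat F k).submatrix (midIdx (evenIdx n)) (fstIdx (evenIdx n)) = 0 := by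
    ext i j
    exact (tm i _).trans (by rw [w2, w2, mul_zero, mul_zero, add_zero]; rfl)
  refine ⟨⟨hff, hmf, fun i => ?_, ?_⟩, ?_⟩
  · obtain ⟨c, hc⟩ := tl i
    rw [hc, w3, mul_zero]
  · have h1 : mat F k⁻¹ * mat F k = 1 := by rw [← mat_mul, inv_mul_cancel, mat_one]
    have h3 : (mat F k⁻¹).submatrix (fstIdx (evenIdx n)) (lstIdx (evenIdx n)) *
        (mat F k).submatrix (lstIdx (evenIdx n)) (fstIdx (evenIdx n)) = 1 := by
      ext i j
      have h4 := congrFun (congrFun h1 (fstIdx (evenIdx n) i)) (fstIdx (evenIdx n) j)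
      rw [Matrix.mul_apply, sum_three (evenIdx n), Finset.sum_eq_zero, Finset.sum_eq_zero,
        zero_add, zero_add] at h4
      · refine Eq.trans h4 ?_
        simp only [Matrix.one_apply, Fin.ext_iff, fstIdx_evenIdx]
      · exact fun x _ => by
          rw [show mat F k (midIdx (evenIdx n) x) (fstIdx (evenIdx n) j) = 0 from
            congrFun (congrFun hmf x) j, mul_zero]
      · exact fun x _ => by
          rw [show mat F k (fstIdx (evenIdx n) x) (fstIdx (evenIdx n) j) = 0 from
            congrFun (congrFun hff x) j, mul_zero]
    exact IsUnit.of_mul_eq_one_right _ h3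
  · rw [tm, w4, w4]
    simp [torusMat, midIdx_evenIdx]

end BigCell

section Conclusion

variable {F} {n : ℕ} {ρ : F} {ψ : AddChar F ℂ}

/-- A matrix as an element of the group algebra of `GL_m`, zero if it is not invertible. -/
def toAlg {m : ℕ} (M : Matrix (Fin m) (Fin m) F) : MonoidAlgebra ℂ (GL (Fin m) F) :=
  matFun (fun g : GL (Fin m) F => (g : Matrix (Fin m) (Fin m) F))
    (fun g => MonoidAlgebra.single g (1 : ℂ)) M

lemma toAlg_coe {m : ℕ} (x : GL (Fin m) F) :
    toAlg (x : Matrix (Fin m) (Fin m) F) = MonoidAlgebra.single x 1 :=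
  matFun_apply (fun _ _ h => Units.ext h) _ x

lemma toAlg_of_not_isUnit {m : ℕ} {M : Matrix (Fin m) (Fin m) F} (hM : ¬ IsUnit M) :
    toAlg M = 0 :=
  dif_neg fun ⟨g, hg⟩ => hM ⟨g, hg⟩

lemma asAlgebraHom_toAlg {m : ℕ} {W : Type*} [AddCommGroup W] [Module ℂ W]
    (τ : Representation ℂ (GL (Fin m) F) W) (M : Matrix (Fin m) (Fin m) F) :
    τ.asAlgebraHom (toAlg M) = tauApp F m τ M := by
  by_cases hM : IsUnit M
  · obtain ⟨x, rfl⟩ := hM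
    rw [toAlg_coe, Representation.asAlgebraHom_single, one_smul, tauApp_coe]
  · rw [toAlg_of_not_isUnit hM, tauApp_of_not_isUnit τ hM, map_zero]

lemma single_mul_toAlg {m : ℕ} (x : GL (Fin m) F) (M : Matrix (Fin m) (Fin m) F) :
    MonoidAlgebra.single x 1 * toAlg M = toAlg ((x : Matrix (Fin m) (Fin m) F) * M) := by
  by_cases hM : IsUnit M
  · obtain ⟨y, rfl⟩ := hM
    rw [← Units.val_mul, toAlg_coe, toAlg_coe, MonoidAlgebra.single_mul_single, one_mul]
  · rw [toAlg_of_not_isUnit hM, toAlg_of_not_isUnit (by rwa [Units.isUnit_units_mul]), mul_zero]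

open Classical in
lemma coeff_toAlg_apply {m : ℕ} (M : Matrix (Fin m) (Fin m) F) (x : GL (Fin m) F) :
    (toAlg M).coeff x = if M = (x : Matrix (Fin m) (Fin m) F) then 1 else 0 := by
  by_cases hM : IsUnit M
  · obtain ⟨y, rfl⟩ := hM
    rw [toAlg_coe, MonoidAlgebra.coeff_single, Finsupp.single_apply]
    simp only [Units.ext_iff]
  · rw [toAlg_of_not_isUnit hM, if_neg (by rintro rfl; exact hM x.isUnit),
      MonoidAlgebra.coeff_zero,
      Finsupp.zero_apply]

variable [Fintype (SO2l F (n + 1) ρ)] {φ φ' : SO2l F (n + 1) ρ → ℂ}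

/-- The difference of two Bessel-like functions, pushed forward along `bigCell` to the
group algebra. -/
def besselAlg (φ φ' : SO2l F (n + 1) ρ → ℂ) : MonoidAlgebra ℂ (GL (Fin (n + 1)) F) :=
  ∑ g, (φ g - φ' g) • toAlg (bigCell ρ (mat F g))

lemma single_mul_besselAlg (hφ : IsBesselLike ρ ψ φ) (hφ' : IsBesselLike ρ ψ φ')
    (h2 : (2 : F) ≠ 0) (hρ : ρ ≠ 0) {x : GL (Fin (n + 1)) F}
    (hx : upUnip F (x : Matrix (Fin (n + 1)) (Fin (n + 1)) F)) :
    MonoidAlgebra.single x 1 * besselAlg φ φ' =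
      ψ (-glUSum F (n + 1) (x : Matrix (Fin (n + 1)) (Fin (n + 1)) F)) • besselAlg φ φ' := by
  set y := dnMat F (n + 1) * (x : Matrix (Fin (n + 1)) (Fin (n + 1)) F) * dnMat F (n + 1) with hy
  have hyu : upUnip F y := upUnip_dnMat_conj hx
  obtain ⟨u, hu, huP⟩ := exists_lift ρ h2 hρ (upUnip_aStar hyu)
  have hψu : psiU F (n + 1) ψ (mat F u) =
      ψ (glUSum F (n + 1) (x : Matrix (Fin (n + 1)) (Fin (n + 1)) F)) := by
    rw [psiU_of_mul_Pmat ψ huP, glUSum_aStar hyu, hy, glUSum_dnMat_conj, neg_neg]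
  have hcell : ∀ g : SO2l F (n + 1) ρ, bigCell ρ (mat F (u * g)) =
      (x : Matrix (Fin (n + 1)) (Fin (n + 1)) F) * bigCell ρ (mat F g) := fun g => by
    rw [mat_mul, bigCell_mul h2 hρ (upUnip_aStar hyu) huP,
      aStar_aStar (by rw [hyu.det_eq_one]; exact isUnit_one), hy]
    congr 1
    rw [Matrix.mul_assoc, Matrix.mul_assoc, Matrix.mul_assoc, dnMat_sq, Matrix.mul_one,
      ← Matrix.mul_assoc, dnMat_sq, Matrix.one_mul]
  rw [besselAlg, Finset.mul_sum, Finset.smul_sum]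
  refine Fintype.sum_equiv (Equiv.mulLeft u) _ _ fun g => ?_
  rw [mul_smul_comm, single_mul_toAlg, Equiv.coe_mulLeft, hφ.mul_left u hu, hφ'.mul_left u hu,
    hcell, smul_smul, hψu]
  congr 1
  rw [← mul_sub, ← mul_assoc, ← AddChar.map_add_eq_mul, neg_add_cancel, AddChar.map_zero_eq_one,
    one_mul]

lemma Zeta_self (φ : SO2l F (n + 1) ρ → ℂ)
    (f : Matrix (Fin (2 * (n + 1) + 1)) (Fin (2 * (n + 1) + 1)) F →
      Matrix (Fin (n + 1)) (Fin (n + 1)) F → ℂ) :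
    Zeta F (n + 1) ρ (n + 1) φ f = (Nat.card (USet F (n + 1) ρ) : ℂ)⁻¹ *
      ∑ g : SO2l F (n + 1) ρ, φ g * f (wllEmb ρ (mat F g)) 1 := by
  rw [Zeta, if_neg (lt_irrefl _), dif_pos rfl, cast_eq, ZetaTop, finsum_eq_sum_of_fintype]
  rfl

lemma sum_tauApp_eq_zero (hφ : IsBesselLike ρ ψ φ) (hφ' : IsBesselLike ρ ψ φ')
    (h2 : (2 : F) ≠ 0) (hρ : ρ ≠ 0) (hψ : ψ ≠ 1) {W : Type*} [AddCommGroup W] [Module ℂ W]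
    {τ : Representation ℂ (GL (Fin (n + 1)) F) W} {Λ : W →ₗ[ℂ] ℂ} {c : ℂ}
    (hc : ∀ θ ∈ ({φ, φ'} : Set (SO2l F (n + 1) ρ → ℂ)), ∀ f ∈ Imodel F (n + 1) τ Λ,
      c * Zeta F (n + 1) ρ (n + 1) θ f = Zeta F (n + 1) ρ (n + 1) θ (MOp F (n + 1) f)) (v : W) :
    ∑ g, (φ g - φ' g) * Λ (tauApp F (n + 1) τ (bigCell ρ (mat F g)) v) = 0 := by
  set f : Matrix (Fin (2 * (n + 1) + 1)) (Fin (2 * (n + 1) + 1)) F →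
      Matrix (Fin (n + 1)) (Fin (n + 1)) F → ℂ :=
    fun g a => Λ (tauApp F (n + 1) τ a (siegelSection τ v g)) with hf
  have hfI : f ∈ Imodel F (n + 1) τ Λ := ⟨_, siegelSection_mem τ v, rfl⟩
  have hcard : (Nat.card (USet F (n + 1) ρ) : ℂ)⁻¹ ≠ 0 := by
    have : Nonempty (USet F (n + 1) ρ) := ⟨⟨1, upUnip_one⟩⟩
    exact inv_ne_zero (Nat.cast_ne_zero.2 Nat.card_pos.ne')
  have hsec : ∀ g, φ g * f (wllEmb ρ (mat F g)) 1 = φ' g * f (wllEmb ρ (mat F g)) 1 := fun g => by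
    by_cases h : wllEmb ρ (mat F g) ∈ SOset F (2 * (n + 1) + 1) (Jmat F (2 * (n + 1) + 1)) ∧
      (wllEmb ρ (mat F g)).submatrix (midIdx (oddIdx (n + 1))) (fstIdx (oddIdx (n + 1))) = 0 ∧
      (wllEmb ρ (mat F g)).submatrix (lstIdx (oddIdx (n + 1))) (fstIdx (oddIdx (n + 1))) = 0
    · obtain ⟨m, hm, hl⟩ := mul_Pmat_of_siegel ρ h2 hρ _ h.2.1 h.2.2
      rw [hφ.eq_on_siegel hφ' h2 hρ hψ hm hl]
    · have h0 : f (wllEmb ρ (mat F g)) 1 = 0 := by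
        simp only [hf]
        rw [siegelSection, if_neg h, map_zero, map_zero]
      rw [h0, mul_zero, mul_zero]
  have hM : ∀ g : SO2l F (n + 1) ρ, MOp F (n + 1) f (wllEmb ρ (mat F g)) 1 =
      Λ (tauApp F (n + 1) τ (bigCell ρ (mat F g)) v) := fun g =>
    MOp_siegelSection τ Λ v (wllEmb_mem ρ h2 hρ (mat_mem g))
  have e1 := hc φ (Or.inl rfl) f hfI
  have e2 := hc φ' (Or.inr rfl) f hfI
  simp only [Zeta_self, hM] at e1 e2
  rw [Finset.sum_congr rfl fun g _ => hsec g, e2] at e1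
  have e3 := mul_left_cancel₀ hcard e1
  simp only [sub_mul, Finset.sum_sub_distrib]
  rw [e3, sub_self]

open Classical in
lemma sum_fibre_eq_zero (he : besselAlg φ φ' = 0) {k : SO2l F (n + 1) ρ} (h2 : (2 : F) ≠ 0)
    (hρ : ρ ≠ 0) (hk : IsUnit (bigCell ρ (mat F k))) :
    ∑ g : SO2l F (n + 1) ρ with gramMat ρ (mat F g) = gramMat ρ (mat F k), (φ g - φ' g) = 0 := by
  obtain ⟨x, hx⟩ := hk
  have h : (besselAlg φ φ').coeff x = 0 := by rw [he, MonoidAlgebra.coeff_zero, Finsupp.zero_apply]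
  rw [besselAlg, MonoidAlgebra.coeff_sum, Finsupp.finsetSum_apply] at h
  rw [Finset.sum_filter]
  refine Eq.trans ?_ h
  refine Finset.sum_congr rfl fun g _ => ?_
  rw [MonoidAlgebra.coeff_smul_apply, coeff_toAlg_apply, hx]
  simp only [bigCell_eq_iff h2 hρ]
  split_ifs <;> simp

lemma add_flipConj_eq_of_besselAlg_eq_zero (hφ : IsBesselLike ρ ψ φ) (hφ' : IsBesselLike ρ ψ φ')
    (h2 : (2 : F) ≠ 0) (hρ : ρ ≠ 0) (he : besselAlg φ φ' = 0) {k : SO2l F (n + 1) ρ}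
    (hk : IsBig (mat F k)) (ha : mat F k (midIdx (evenIdx n) 1) (midIdx (evenIdx n) 1) ≠ 1) :
    φ k + φ (flipConj k) = φ' k + φ' (flipConj k) := by
  classical
  set s : Finset (SO2l F (n + 1) ρ) :=
    Finset.univ.filter fun g => gramMat ρ (mat F g) = gramMat ρ (mat F k) with hs
  have h1 : ∑ g ∈ s, (φ g - φ' g) = 0 := sum_fibre_eq_zero he h2 hρ (isUnit_bigCell h2 hρ hk ha)
  have h3 : ∑ g ∈ s, (φ (flipConj g) - φ' (flipConj g)) = 0 := by
    rw [← h1]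
    refine Finset.sum_nbij' flipConj flipConj ?_ ?_ (fun g _ => flipConj_flipConj g)
      (fun g _ => flipConj_flipConj g) fun g _ => rfl
    all_goals
      intro g hg
      simp only [hs, Finset.mem_filter, Finset.mem_univ, true_and] at hg ⊢
      rw [gramMat_flipConj, hg]
  have h4 : ∑ g ∈ s, ((φ k + φ (flipConj k)) - (φ' k + φ' (flipConj k))) = 0 := by
    rw [← add_zero (0 : ℂ)]
    nth_rw 1 [← h1]
    rw [← h3, ← Finset.sum_add_distrib]
    refine Finset.sum_congr rfl fun g hg => ?_
    have hg' : gramMat ρ (mat F g) = gramMat ρ (mat F k) := (Finset.mem_filter.1 hg).2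
    rw [← hφ.add_flipConj_eq h2 hρ hk hg', ← hφ'.add_flipConj_eq h2 hρ hk hg']
    ring
  rw [Finset.sum_const, smul_eq_zero] at h4
  have hne : s.card ≠ 0 := Finset.card_ne_zero.2 ⟨k, by simp [hs]⟩
  exact sub_eq_zero.1 (h4.resolve_left hne)

lemma besselAlg_eq_zero (hφ : IsBesselLike ρ ψ φ) (hφ' : IsBesselLike ρ ψ φ')
    (h2 : (2 : F) ≠ 0) (hρ : ρ ≠ 0) (hψ : ψ ≠ 1)
    (hγ : ∀ (W : Type) [AddCommGroup W] [Module ℂ W],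
      ∀ (τ : Representation ℂ (GL (Fin (n + 1)) F) W) (Λ : W →ₗ[ℂ] ℂ),
        IsIrrep τ → IsGenericGLinv F (n + 1) ψ τ Λ →
        ∃ c : ℂ, ∀ θ ∈ ({φ, φ'} : Set (SO2l F (n + 1) ρ → ℂ)), ∀ f ∈ Imodel F (n + 1) τ Λ,
          c * Zeta F (n + 1) ρ (n + 1) θ f = Zeta F (n + 1) ρ (n + 1) θ (MOp F (n + 1) f)) :
    besselAlg φ φ' = 0 := by
  refine eq_zero_of_generic_coeffs (upUnipSubgroup F (n + 1))
    (fun x => ψ (-glUSum F (n + 1) (x : Matrix (Fin (n + 1)) (Fin (n + 1)) F))) ?_ ?_ _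
    (fun x hx => single_mul_besselAlg hφ hφ' h2 hρ hx) ?_
  · simp [glUSum_one]
  · intro x hx y hy
    rw [Units.val_mul, glUSum_mul hx hy, neg_add, AddChar.map_add_eq_mul]
  · intro W _ _ τ Λ hτ hΛ hΛU v
    obtain ⟨c, hc⟩ := hγ W τ Λ hτ ⟨hΛ, hΛU⟩
    have h := sum_tauApp_eq_zero hφ hφ' h2 hρ hψ hc v
    rw [besselAlg, map_sum, LinearMap.sum_apply, map_sum, ← h]
    refine Finset.sum_congr rfl fun g _ => ?_
    rw [map_smul, asAlgebraHom_toAlg, LinearMap.smul_apply, map_smul, smul_eq_mul]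

end Conclusion

/-- `IsGamma` applied to the vector `(Γ v₀)⁻¹ • v₀`, whose matrix coefficient is the Bessel
function. -/
lemma IsGamma.bessel {F} [Field F] [Fintype F] {l n : ℕ} {ρ : F} {V : Type*} [AddCommGroup V]
    [Module ℂ V] {π : Representation ℂ (SO2l F l ρ) V} {Γ : V →ₗ[ℂ] ℂ} {Wτ : Type*}
    [AddCommGroup Wτ] [Module ℂ Wτ] {τ : Representation ℂ (GL (Fin n) F) Wτ} {Λ : Wτ →ₗ[ℂ] ℂ}
    {c : ℂ} (h : IsGamma F l ρ n π Γ τ Λ c) (v₀ : V) :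
    ∀ f ∈ Imodel F n τ Λ, c * Zeta F l ρ n (Bessel F l ρ π Γ v₀) f =
      Zeta F l ρ n (Bessel F l ρ π Γ v₀) (MOp F n f) := by
  have hB : Bessel F l ρ π Γ v₀ = fun g => Γ (π g ((Γ v₀)⁻¹ • v₀)) := by
    funext g
    rw [Bessel, map_smul, map_smul, smul_eq_mul, div_eq_inv_mul]
  rw [hB]
  exact h _

theorem gl_l_twists_determine_bessel_sum
    (F : Type) [Field F] [Fintype F] (p r : ℕ) (hp : p.Prime) (hp2 : p ≠ 2)
    (hr : 0 < r) (hcard : Fintype.card F = p ^ r)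
    (ψ : AddChar F ℂ) (hψ : ψ ≠ 1)
    (l : ℕ) (hl : 2 ≤ l) (ρ : F) (hρ : ∀ x : F, x ^ 2 ≠ ρ)
    (V : Type) [AddCommGroup V] [Module ℂ V]
    (π : Representation ℂ (SO2l F l ρ) V)
    (hπirr : IsIrrep π)
    (hπcusp : IsCuspidal F l ρ π)
    (Γ : V →ₗ[ℂ] ℂ) (hΓ : IsWhittaker F l ρ ψ π Γ)
    (v₀ : V) (hv₀ : IsWhitVec F l ρ ψ π Γ v₀)
    (V' : Type) [AddCommGroup V'] [Module ℂ V']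
    (π' : Representation ℂ (SO2l F l ρ) V')
    (hπ'irr : IsIrrep π')
    (hπ'cusp : IsCuspidal F l ρ π')
    (Γ' : V' →ₗ[ℂ] ℂ) (hΓ' : IsWhittaker F l ρ ψ π' Γ')
    (v₀' : V') (hv₀' : IsWhitVec F l ρ ψ π' Γ' v₀')
    (hcc : SameCentralChar F l ρ π π')
    (hγ : ∀ (Wτ : Type) [AddCommGroup Wτ] [Module ℂ Wτ],
      ∀ (τ : Representation ℂ (GL (Fin (l)) F) Wτ) (Λ : Wτ →ₗ[ℂ] ℂ),
        IsIrrep τ → IsGenericGLinv F (l) ψ τ Λ →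
        ∃ c : ℂ, IsGamma F l ρ (l) π Γ τ Λ c ∧ IsGamma F l ρ (l) π' Γ' τ Λ c)
 :
    ∀ (tv : ℕ → Fˣ) (a b : F), a ^ 2 - b ^ 2 * ρ = 1 → a ≠ 1 →
      ∀ t w : SO2l F l ρ, mat F t = torusMat F l ρ tv a b →
      (∃ σp : Equiv.Perm (Fin (l - 1)),
        mat F w = tnMat F l (l - 1) (permMat F (l - 1) σp) * wTildeMat F l (l - 1)) →
      Bessel F l ρ π Γ v₀ (t * w) + BesselConj F l ρ (Bessel F l ρ π Γ v₀) (t * w) =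
        Bessel F l ρ π' Γ' v₀' (t * w) + BesselConj F l ρ (Bessel F l ρ π' Γ' v₀') (t * w) := by
  obtain ⟨n, rfl⟩ : ∃ n, l = n + 1 := ⟨l - 1, by omega⟩
  have : Fintype (SO2l F (n + 1) ρ) := Fintype.ofFinite _
  have h2 : (2 : F) ≠ 0 := by
    refine Ring.two_ne_zero fun h => ?_
    have := FiniteField.even_card_of_char_two h
    rw [hcard] at this
    exact absurd ((hp.odd_of_ne_two hp2).pow (n := r)) (by
      rw [Nat.not_odd_iff_even, Nat.even_iff]; exact this)
  have hρ0 : ρ ≠ 0 := fun h => hρ 0 (by rw [h, zero_pow two_ne_zero])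
  have hφ := isBesselLike_Bessel hΓ hv₀
  have hφ' := isBesselLike_Bessel hΓ' hv₀'
  have he := besselAlg_eq_zero hφ hφ' h2 hρ0 hψ fun W _ _ τ Λ hτ hΛ => by
    obtain ⟨c, hc, hc'⟩ := hγ W τ Λ hτ hΛ
    refine ⟨c, ?_⟩
    rintro _ (rfl | rfl)
    exacts [hc.bessel v₀, hc'.bessel v₀']
  rintro tv a b - ha t w ht ⟨σp, hw⟩
  obtain ⟨hbig, hmid⟩ := isBig_torus_mul_weyl (n := n) (k := t * w) (tv := tv) (a := a) (b := b)
    (s := permMat F n σp) (by rw [mat_mul, ht, hw]; rfl)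
  rw [BesselConj_eq, BesselConj_eq]
  exact add_flipConj_eq_of_besselAlg_eq_zero hφ hφ' h2 hρ0 he hbig (hmid.symm ▸ ha)

end ConverseSO
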